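/- Let n be a positive integer. Let η : ℝˣ → ℂˣ be a continuous group homomorphism such that γ = η ∘ det is a good character of GL_n(ℝ). Let N = {(x,y) ∈ M_n(ℝ) × M_n(ℝ) : (x·y)ⁿ = 0} be the nilpotent cone. Let T : 𝓢(M_n(ℝ) × M_n(ℝ), ℂ) → ℂ be a tempered distribution such that: (1) for all g, h ∈ GL_n(ℝ) and every Schwartz φ, T((x,y) ↦ φ(g x h⁻¹, h y g⁻¹)) = γ(g)⁻¹ · γ(h) · T(φ); (2) T(φ) = 0 for every compactly supported Schwartz function φ whose support is disjoint from N; (3) T(ℱφ) = 0 for every compactly supported Schwartz function φ whose support is disjoint from N, where ℱ is the Fourier transform with respect to the pairing ⟨(x,y),(u,v)⟩ = tr(x v) + tr(y u). Then T = 0. -/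

import Mathlib

/-!
Archimedean case of Proposition `reduce2` of the paper: a
`(γ⁻¹ ⊠ γ)`-equivariant tempered distribution on `Mₙ(ℝ) × Mₙ(ℝ)` (for a good
character `γ = η ∘ det` of `GLₙ(ℝ)`) which is supported, together with its
Fourier transform, in the nilpotent cone `N = {(x,y) : (x·y)ⁿ = 0}` vanishes.
-/

open SchwartzMap Matrix MeasureTheory

attribute [local instance] Matrix.normedAddCommGroup Matrix.normedSpace

noncomputable instance (n : ℕ) : MeasureSpace (Matrix (Fin n) (Fin n) ℝ) :=
  inferInstanceAs (MeasureSpace (Fin n → Fin n → ℝ))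

/-- A character of `ℝˣ` (given as a function `ℝˣ → ℂ`) is pseudo-algebraic if it is
`t ↦ t ^ m'` for some non-negative integer `m'`. -/
def IsPseudoAlgebraicChar (ξ : ℝˣ → ℂ) : Prop :=
  ∃ m' : ℕ, ∀ t : ℝˣ, ξ t = ((t : ℝ) : ℂ) ^ m'

/-- The character `γ = η ∘ det` of `GLₙ(ℝ)` is good if for all
`r ∈ {−n, …, −1, 1, …, n}` and `m ∈ {1, …, 2n²}` the character
`t ↦ η(t) ^ (2r) · |t| ^ (−m)` of `ℝˣ` is not pseudo-algebraic. -/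
def IsGoodChar (n : ℕ) (η : ℝˣ →* ℂˣ) : Prop :=
  ∀ r : ℤ, r ≠ 0 → |r| ≤ (n : ℤ) → ∀ m : ℕ, 1 ≤ m → m ≤ 2 * n ^ 2 →
    ¬ IsPseudoAlgebraicChar fun t : ℝˣ =>
        ((η t : ℂ) ^ (2 * r)) * ((|(t : ℝ)| ^ (-(m : ℤ)) : ℝ) : ℂ)

/-- The nilpotent cone in `Mₙ(ℝ) × Mₙ(ℝ)`. -/
def nilpotentCone (n : ℕ) : Set (Matrix (Fin n) (Fin n) ℝ × Matrix (Fin n) (Fin n) ℝ) :=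
  {p | (p.1 * p.2) ^ n = 0}

section

open scoped ContDiff Topology

section

variable {V : Type*} [NormedAddCommGroup V] [NormedSpace ℝ V]

/-- Smooth compactly supported functions with topological support in `U`. -/
structure IsTestFun (U : Set V) (f : V → ℂ) : Prop where
  smooth : ContDiff ℝ ∞ f
  compact : HasCompactSupport f
  supp : tsupport f ⊆ U

namespace IsTestFun

theorem mono {U U' : Set V} {f : V → ℂ} (hf : IsTestFun U f) (h : U ⊆ U') : IsTestFun U' f :=
  ⟨hf.smooth, hf.compact, hf.supp.trans h⟩

theorem mul_left {U : Set V} {f : V → ℂ} (hf : IsTestFun U f) {a : V → ℂ}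
    (ha : ContDiff ℝ ∞ a) : IsTestFun U (fun x => a x * f x) :=
  ⟨ha.mul hf.smooth, hf.compact.mul_left, (tsupport_mul_subset_right).trans hf.supp⟩

theorem fderiv_apply {U : Set V} {f : V → ℂ} (hf : IsTestFun U f) {Y : V → V}
    (hY : ContDiff ℝ ∞ Y) : IsTestFun U (fun x => fderiv ℝ f x (Y x)) := by
  have hs : tsupport (fun x => fderiv ℝ f x (Y x)) ⊆ tsupport f := by
    refine closure_minimal ?_ (isClosed_tsupport f)
    intro x hx
    by_contra h
    exact hx (by simp [fderiv_of_notMem_tsupport (𝕜 := ℝ) h])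
  refine ⟨?_, hf.compact.of_isClosed_subset (isClosed_tsupport _) hs, hs.trans hf.supp⟩
  exact (hf.smooth.fderiv_right (by simp)).clm_apply hY

end IsTestFun

/-- `T` vanishes on all test functions supported in `U`. -/
def VanishesOn (T : (V → ℂ) →ₗ[ℂ] ℂ) (U : Set V) : Prop := ∀ f, IsTestFun U f → T f = 0

/-- `T` has order at most `L` on compactly supported smooth functions. -/
def HasOrderLE (T : (V → ℂ) →ₗ[ℂ] ℂ) (L : ℕ) : Prop :=
  ∀ K : Set V, IsCompact K → ∃ C : ℝ, 0 ≤ C ∧ ∀ f : V → ℂ, IsTestFun K f → ∀ M : ℝ,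
    (∀ l ≤ L, ∀ x, ‖iteratedFDeriv ℝ l f x‖ ≤ M) → ‖T f‖ ≤ C * M

/-- A linear functional on Schwartz functions extends to all functions. -/
theorem exists_linear_extension (T : 𝓢(V, ℂ) →L[ℂ] ℂ) :
    ∃ S : (V → ℂ) →ₗ[ℂ] ℂ, ∀ φ : 𝓢(V, ℂ), S φ = T φ := by
  let i : 𝓢(V, ℂ) →ₗ[ℂ] (V → ℂ) :=
    { toFun := fun φ => φ, map_add' := fun _ _ => rfl, map_smul' := fun _ _ => rfl }
  obtain ⟨g, hg⟩ := LinearMap.exists_leftInverse_of_injective i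
    (LinearMap.ker_eq_bot.2 DFunLike.coe_injective)
  refine ⟨T.toLinearMap ∘ₗ g, fun φ => ?_⟩
  have : g (i φ) = φ := LinearMap.congr_fun hg φ
  simpa [i] using congrArg T this

@[simp] theorem coe_toSchwartzMap {f : V → ℂ} (h₁ : HasCompactSupport f) (h₂ : ContDiff ℝ ∞ f) :
    ⇑(h₁.toSchwartzMap h₂) = f := rfl

theorem exists_bound_seminorm (T : 𝓢(V, ℂ) →L[ℂ] ℂ) :
    ∃ L : ℕ, ∃ C : ℝ, 0 ≤ C ∧ ∀ φ : 𝓢(V, ℂ), ∀ M : ℝ,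
      (∀ k ≤ L, ∀ l ≤ L, ∀ x, ‖x‖ ^ k * ‖iteratedFDeriv ℝ l φ x‖ ≤ M) → ‖T φ‖ ≤ C * M := by
  obtain ⟨s, C, -, h⟩ := Seminorm.bound_of_continuous (schwartz_withSeminorms ℝ V ℂ)
    ((normSeminorm ℝ ℂ).comp (T.restrictScalars ℝ).toLinearMap)
    (by
      refine continuous_norm.comp T.continuous)
  refine ⟨s.sup (fun p => p.1 + p.2), C, C.2, fun φ M hM => (h φ).trans ?_⟩
  have hM0 : 0 ≤ M := le_trans (by positivity) (hM 0 (by simp) 0 (by simp) 0)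
  have : (s.sup (schwartzSeminormFamily ℝ V ℂ)) φ ≤ M := by
    refine Seminorm.finset_sup_apply_le hM0 fun p hp => ?_
    refine SchwartzMap.seminorm_le_bound ℝ _ _ φ hM0 fun x => ?_
    have := Finset.le_sup (f := fun p : ℕ × ℕ => p.1 + p.2) hp
    exact hM _ (by omega) _ (by omega) x
  simp only [_root_.smul_apply]
  exact mul_le_mul_of_nonneg_left this C.2

theorem exists_hasOrderLE (T : 𝓢(V, ℂ) →L[ℂ] ℂ) (S : (V → ℂ) →ₗ[ℂ] ℂ)
    (hS : ∀ φ : 𝓢(V, ℂ), S φ = T φ) : ∃ L, HasOrderLE S L := by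
  obtain ⟨L, C, hC, h⟩ := exists_bound_seminorm T
  refine ⟨L, fun K hK => ?_⟩
  obtain ⟨R, hR⟩ := hK.isBounded.exists_norm_le
  set R' := max R 1
  refine ⟨C * R' ^ L, by positivity, fun f hf M hM => ?_⟩
  have hM0 : 0 ≤ M := le_trans (norm_nonneg _) (hM 0 (by simp) 0)
  have e := hS (hf.compact.toSchwartzMap hf.smooth)
  simp only [coe_toSchwartzMap] at e
  rw [e, mul_assoc]
  refine h _ _ fun k hk l hl x => ?_
  simp only [coe_toSchwartzMap]
  by_cases hx : x ∈ tsupport f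
  · have h1 : ‖x‖ ≤ R' := (hR x (hf.supp hx)).trans (le_max_left _ _)
    have h2 : ‖x‖ ^ k ≤ R' ^ L := (pow_le_pow_left₀ (norm_nonneg _) h1 k).trans
      (pow_le_pow_right₀ (le_max_right _ _) hk)
    exact mul_le_mul h2 (hM l hl x) (norm_nonneg _) (by positivity)
  · have : iteratedFDeriv ℝ l f x = 0 := by
      by_contra h0
      exact hx (support_iteratedFDeriv_subset l h0)
    rw [this]; simp only [norm_zero, mul_zero]; positivity

theorem exists_norm_iteratedFDeriv_le_of_hasCompactSupport {F : Type*} [NormedAddCommGroup F]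
    [NormedSpace ℝ F] {f : V → F} (hf : ContDiff ℝ ∞ f) (hc : HasCompactSupport f) (L : ℕ) :
    ∃ C : ℝ, 0 ≤ C ∧ ∀ l ≤ L, ∀ x, ‖iteratedFDeriv ℝ l f x‖ ≤ C := by
  have h : ∀ l : ℕ, ∃ C : ℝ, ∀ x, ‖iteratedFDeriv ℝ l f x‖ ≤ C := fun l =>
    (hc.iteratedFDeriv l).exists_bound_of_continuous
      (hf.continuous_iteratedFDeriv (by exact_mod_cast le_top))
  choose C hC using h
  refine ⟨∑ l ∈ Finset.range (L + 1), |C l|, Finset.sum_nonneg fun _ _ => abs_nonneg _,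
    fun l hl x => (hC l x).trans ((le_abs_self _).trans ?_)⟩
  exact Finset.single_le_sum (f := fun l => |C l|) (fun _ _ => abs_nonneg _)
    (Finset.mem_range.2 (by omega))

variable [FiniteDimensional ℝ V]

theorem eq_zero_of_forall_hasCompactSupport (T : 𝓢(V, ℂ) →L[ℂ] ℂ)
    (h : ∀ φ : 𝓢(V, ℂ), HasCompactSupport φ → T φ = 0) : T = 0 := by
  obtain ⟨L, C, hC, hT⟩ := exists_bound_seminorm T
  let ρ : ContDiffBump (0 : V) := ⟨1, 2, by norm_num, by norm_num⟩
  have hρs : ContDiff ℝ ∞ (fun x => (ρ x : ℂ)) :=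
    Complex.ofRealCLM.contDiff.comp ρ.contDiff
  have hρc : HasCompactSupport (fun x => (ρ x : ℂ)) :=
    ρ.hasCompactSupport.comp_left (g := Complex.ofReal) (by simp)
  obtain ⟨B, hB0, hB⟩ := exists_norm_iteratedFDeriv_le_of_hasCompactSupport hρs hρc L
  ext φ
  have hφ : ∃ S : ℝ, 0 ≤ S ∧ ∀ k ≤ L, ∀ l ≤ L, ∀ x,
      ‖x‖ ^ (k + 1) * ‖iteratedFDeriv ℝ l φ x‖ ≤ S := by
    choose D hD using fun k l => φ.decay k l
    refine ⟨∑ k ∈ Finset.range (L + 1), ∑ l ∈ Finset.range (L + 1), D (k + 1) l,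
      Finset.sum_nonneg fun _ _ => Finset.sum_nonneg fun _ _ => (hD _ _).1.le,
      fun k hk l hl x => ((hD (k + 1) l).2 x).trans ?_⟩
    refine le_trans ?_ (Finset.single_le_sum
      (f := fun k => ∑ l ∈ Finset.range (L + 1), D (k + 1) l)
      (fun _ _ => Finset.sum_nonneg fun _ _ => (hD _ _).1.le)
      (Finset.mem_range.2 (show k < L + 1 by omega)))
    exact Finset.single_le_sum (f := fun l => D (k + 1) l) (fun _ _ => (hD _ _).1.le)
      (Finset.mem_range.2 (show l < L + 1 by omega))
  obtain ⟨S, hS0, hS⟩ := hφ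
  have key : ∀ R : ℝ, 1 ≤ R → ‖T φ‖ ≤ C * (2 ^ L * ((B + 1) * S)) * R⁻¹ := by
    intro R hR
    let g : V →L[ℝ] V := R⁻¹ • ContinuousLinearMap.id ℝ V
    have hg : ‖g‖ ≤ 1 := by
      refine (norm_smul_le (R⁻¹) (ContinuousLinearMap.id ℝ V)).trans ?_
      have h1 : ‖R⁻¹‖ ≤ 1 := by
        rw [norm_inv, Real.norm_eq_abs, abs_of_pos (by linarith)]
        exact inv_le_one_of_one_le₀ hR
      have h2 := ContinuousLinearMap.norm_id_le (𝕜 := ℝ) (E := V)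
      nlinarith [norm_nonneg (R⁻¹), norm_nonneg (ContinuousLinearMap.id ℝ V)]
    let a : V → ℂ := fun x => (ρ (g x) : ℂ)
    have ha : ContDiff ℝ ∞ a := hρs.comp g.contDiff
    have haφ : HasCompactSupport (fun x => a x * φ x) := by
      have : HasCompactSupport a := by
        have hinj : Topology.IsClosedEmbedding g := by
          have : Function.Injective g := fun x y hxy => by
            have hR' : R⁻¹ ≠ 0 := by positivity
            simpa [g, hR', (by linarith : R ≠ 0), show R ≠ 0 by positivity] using hxy
          exact g.toLinearMap.isClosedEmbedding_of_injective (LinearMap.ker_eq_bot.2 this)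
        exact hρc.comp_isClosedEmbedding hinj
      exact this.mul_right
    have haφs : ContDiff ℝ ∞ (fun x => a x * φ x) := ha.mul φ.smooth'
    have hT0 : T φ = T (φ - haφ.toSchwartzMap haφs) := by
      rw [map_sub, h (haφ.toSchwartzMap haφs) (by simpa using haφ), sub_zero]
    rw [hT0, mul_assoc]
    refine hT _ _ fun k hk l hl x => ?_
    have hcoe : ⇑(φ - haφ.toSchwartzMap haφs) = fun x => (1 - a x) * φ x := by
      ext x; simp; ring
    rw [hcoe]
    have ha1 : ContDiff ℝ ∞ (fun x => 1 - a x) := contDiff_const.sub ha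
    by_cases hx : ‖x‖ < R
    · have : (fun x => (1 - a x) * φ x) =ᶠ[nhds x] fun _ => 0 := by
        have : ∀ᶠ y in nhds x, ‖y‖ < R := continuous_norm.continuousAt.eventually_lt
          continuousAt_const hx
        filter_upwards [this] with y hy
        have : ρ (g y) = 1 := by
          apply ρ.one_of_mem_closedBall
          simp only [g, _root_.smul_apply, ContinuousLinearMap.id_apply,
            mem_closedBall_zero_iff, norm_smul, norm_inv, Real.norm_eq_abs, ρ]
          rw [abs_of_pos (by linarith), inv_mul_le_iff₀ (by linarith)]
          linarith
        simp [a, this]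
      rw [(this.iteratedFDeriv ℝ l).eq_of_nhds]
      have h0 : iteratedFDeriv ℝ l (fun _ : V => (0 : ℂ)) x = 0 := by
        have := iteratedFDeriv_fun_zero (𝕜 := ℝ) (E := V) (F := ℂ) (n := l)
        exact congrFun this x
      rw [h0]
      simp only [norm_zero, mul_zero]
      positivity
    · push Not at hx
      have hle := norm_iteratedFDeriv_mul_le (𝕜 := ℝ) (n := l) ha1 φ.smooth' x
        (by exact_mod_cast le_top)
      have hx0 : 0 ≤ ‖x‖ ^ k := by positivity
      refine (mul_le_mul_of_nonneg_left hle hx0).trans ?_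
      rw [Finset.mul_sum]
      have hterm : ∀ i ∈ Finset.range (l + 1), ‖x‖ ^ k * ((l.choose i : ℝ) *
          ‖iteratedFDeriv ℝ i (fun x => 1 - a x) x‖ * ‖iteratedFDeriv ℝ (l - i) φ x‖) ≤
          (l.choose i : ℝ) * ((B + 1) * (S * R⁻¹)) := by
        intro i hi
        have hi' : i ≤ l := by simpa [Nat.lt_succ_iff] using hi
        have h1 : ‖iteratedFDeriv ℝ i (fun x => 1 - a x) x‖ ≤ B + 1 := by
          have hai : ‖iteratedFDeriv ℝ i a x‖ ≤ B := by
            have := g.iteratedFDeriv_comp_right hρs x (i := i) (by exact_mod_cast le_top)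
            have e : a = (fun x => (ρ x : ℂ)) ∘ g := rfl
            rw [e, this]
            refine (ContinuousMultilinearMap.norm_compContinuousLinearMap_le _ _).trans ?_
            have hp : ∏ _j : Fin i, ‖g‖ ≤ 1 := by
              simpa using pow_le_one₀ (norm_nonneg g) hg
            calc _ ≤ B * 1 := mul_le_mul (hB i (by omega) _) hp
                  (Finset.prod_nonneg fun _ _ => norm_nonneg _) hB0
              _ = B := mul_one B
          have e := iteratedFDeriv_sub_apply (𝕜 := ℝ) (i := i) (x := x) (f := fun _ : V => (1 : ℂ))
            (g := a) contDiff_const.contDiffAt (ha.contDiffAt.of_le (by exact_mod_cast le_top))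
          have e2 : ‖iteratedFDeriv ℝ i (fun _ : V => (1 : ℂ)) x‖ ≤ 1 := by
            rcases Nat.eq_zero_or_pos i with rfl | hi0
            · simp
            · rw [iteratedFDeriv_const_of_ne (by omega)]; simp
          have e3 : (fun x => 1 - a x) = (fun _ : V => (1 : ℂ)) - a := rfl
          rw [e3, e]
          refine (norm_sub_le _ _).trans (by linarith)
        have h2 : ‖x‖ ^ k * ‖iteratedFDeriv ℝ (l - i) φ x‖ ≤ S * R⁻¹ := by
          have := hS k hk (l - i) (by omega) x
          rw [← div_eq_mul_inv, le_div_iff₀ (by linarith)]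
          refine le_trans ?_ this
          rw [pow_succ, mul_assoc, mul_assoc, mul_comm _ R]
          gcongr
        calc _ = (l.choose i : ℝ) * (‖iteratedFDeriv ℝ i (fun x => 1 - a x) x‖ *
              (‖x‖ ^ k * ‖iteratedFDeriv ℝ (l - i) φ x‖)) := by ring
          _ ≤ _ := by gcongr
      refine (Finset.sum_le_sum hterm).trans ?_
      rw [← Finset.sum_mul]
      have hch : ∑ i ∈ Finset.range (l + 1), (l.choose i : ℝ) = 2 ^ l := by
        exact_mod_cast Nat.sum_range_choose l
      rw [hch]
      have : (2 : ℝ) ^ l ≤ 2 ^ L := pow_le_pow_right₀ (by norm_num) hl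
      have h0 : 0 ≤ (B + 1) * (S * R⁻¹) := by positivity
      calc _ ≤ (2 : ℝ) ^ L * ((B + 1) * (S * R⁻¹)) := by gcongr
        _ = _ := by ring
  have hlim : Filter.Tendsto (fun R : ℝ => C * (2 ^ L * ((B + 1) * S)) * R⁻¹) Filter.atTop
      (nhds 0) := by
    simpa using tendsto_inv_atTop_zero.const_mul (C * (2 ^ L * ((B + 1) * S)))
  have : ‖T φ‖ ≤ 0 := ge_of_tendsto hlim
    ((Filter.eventually_ge_atTop 1).mono fun R hR => key R hR)
  simpa using this

end

section

variable {V : Type*} [NormedAddCommGroup V] [NormedSpace ℝ V]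

/-- The support of a functional: points with no neighbourhood on which it vanishes. -/
def distSupport (T : (V → ℂ) →ₗ[ℂ] ℂ) : Set V :=
  {x | ∀ U : Set V, IsOpen U → x ∈ U → ¬ VanishesOn T U}

theorem vanishesOn_compl_distSupport [FiniteDimensional ℝ V] (T : (V → ℂ) →ₗ[ℂ] ℂ) :
    VanishesOn T (distSupport T)ᶜ := by
  intro f hf
  have hloc : ∀ x : tsupport f, ∃ U : Set V, IsOpen U ∧ (x : V) ∈ U ∧ VanishesOn T U := by
    intro x
    have hx := hf.supp x.2
    simp only [distSupport, Set.mem_compl_iff, Set.mem_ofPred_eq, not_forall, not_not] at hx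
    obtain ⟨U, hU, hxU, hT⟩ := hx
    exact ⟨U, hU, hxU, hT⟩
  choose U hU hxU hT using hloc
  have hball : ∀ x : tsupport f, ∃ r : ℝ, 0 < r ∧ Metric.closedBall (x : V) r ⊆ U x := fun x =>
    Metric.nhds_basis_closedBall.mem_iff.1 ((hU x).mem_nhds (hxU x))
  choose r hr hrU using hball
  let ρ : ∀ x : tsupport f, ContDiffBump (x : V) := fun x => ⟨r x / 2, r x, by linarith [hr x],
    by linarith [hr x]⟩
  have hρs : ∀ x, ContDiff ℝ ∞ (fun y => (ρ x y : ℂ)) := fun x =>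
    Complex.ofRealCLM.contDiff.comp (ρ x).contDiff
  obtain ⟨t, ht⟩ := hf.compact.elim_finite_subcover
    (fun x : tsupport f => Metric.ball (x : V) (r x / 2)) (fun _ => Metric.isOpen_ball)
    (fun x hx => Set.mem_iUnion.2 ⟨⟨x, hx⟩, Metric.mem_ball_self (by linarith [hr ⟨x, hx⟩])⟩)
  have hprod : ∀ s : Finset (tsupport f), ContDiff ℝ ∞ (fun y => ∏ x ∈ s, (1 - (ρ x y : ℂ))) :=
    fun s => contDiff_prod fun x _ => contDiff_const.sub (hρs x)
  have key : ∀ s : Finset (tsupport f), T (fun y => (∏ x ∈ s, (1 - (ρ x y : ℂ))) * f y) = T f := by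
    classical
    intro s
    induction s using Finset.induction_on with
    | empty => simp
    | insert a s ha ih =>
      rw [← ih]
      have e : (fun y => (∏ x ∈ insert a s, (1 - (ρ x y : ℂ))) * f y) =
          (fun y => (∏ x ∈ s, (1 - (ρ x y : ℂ))) * f y) -
          (fun y => (ρ a y : ℂ) * ((∏ x ∈ s, (1 - (ρ x y : ℂ))) * f y)) := by
        ext y
        simp only [Finset.prod_insert ha, Pi.sub_apply]
        ring
      rw [e, map_sub, sub_eq_self]
      have h1 := (hf.mul_left (hprod s)).mul_left (hρs a)
      refine hT a _ ⟨h1.smooth, h1.compact, ?_⟩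
      refine (tsupport_mul_subset_left).trans (Set.Subset.trans ?_ (hrU a))
      have : Function.support (fun y => (ρ a y : ℂ)) ⊆ Metric.closedBall (a : V) (r a) := by
        intro y hy
        have hy' : y ∈ Function.support (ρ a) := by
          intro h0; exact hy (by simp [h0])
        rw [(ρ a).support_eq] at hy'
        exact Metric.ball_subset_closedBall hy'
      exact closure_minimal this Metric.isClosed_closedBall
  rw [← key t]
  have : (fun y => (∏ x ∈ t, (1 - (ρ x y : ℂ))) * f y) = 0 := by
    ext y
    by_cases hy : y ∈ tsupport f
    · obtain ⟨x, hx, hxy⟩ := Set.mem_iUnion₂.1 (ht hy)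
      have h1 : ρ x y = 1 := (ρ x).one_of_mem_closedBall (Metric.ball_subset_closedBall hxy)
      have : ∏ x ∈ t, (1 - (ρ x y : ℂ)) = 0 := Finset.prod_eq_zero hx (by simp [h1])
      simp [this]
    · simp [image_eq_zero_of_notMem_tsupport hy]
  rw [this, map_zero]

/-- A functional of finite order is annihilated by a high power of any smooth function vanishing on
its support. -/
theorem HasOrderLE.pow_mul_eq_zero [FiniteDimensional ℝ V] {T : (V → ℂ) →ₗ[ℂ] ℂ} {L : ℕ}
    (hT : HasOrderLE T L) {Z U : Set V} (hZ : VanishesOn T Zᶜ) {p : V → ℝ}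
    (hp : ContDiff ℝ ∞ p) (hpZ : ∀ x ∈ Z ∩ U, p x = 0) {f : V → ℂ} (hf : IsTestFun U f) :
    T (fun x => (p x : ℂ) ^ (L + 1) * f x) = 0 := by
  let ρ : ContDiffBump (0 : ℝ) := ⟨1, 2, by norm_num, by norm_num⟩
  let θ : ℝ → ℝ := fun s => s ^ (L + 1) * ρ s
  have hθ : ContDiff ℝ ∞ θ := (contDiff_id.pow _).mul ρ.contDiff
  have hθc : HasCompactSupport θ := ρ.hasCompactSupport.mul_left
  obtain ⟨B, hB0, hB⟩ := exists_norm_iteratedFDeriv_le_of_hasCompactSupport hθ hθc L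
  obtain ⟨C, hC0, hC⟩ := hT (tsupport f) hf.compact
  -- bounds of the derivatives of `p` and `f` on the support of `f`
  have hpD : ∃ D : ℝ, 1 ≤ D ∧ ∀ l ≤ L, ∀ x ∈ tsupport f, ‖iteratedFDeriv ℝ l p x‖ ≤ D := by
    have h : ∀ l : ℕ, ∃ D : ℝ, ∀ x ∈ tsupport f, ‖iteratedFDeriv ℝ l p x‖ ≤ D := fun l =>
      hf.compact.isCompact.exists_bound_of_continuousOn
        (hp.continuous_iteratedFDeriv (m := l) (by exact_mod_cast le_top)).continuousOn
    choose D hD using h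
    refine ⟨1 + ∑ l ∈ Finset.range (L + 1), |D l|, by
      have := Finset.sum_nonneg (s := Finset.range (L + 1)) fun l _ => abs_nonneg (D l)
      linarith, fun l hl x hx => (hD l x hx).trans ((le_abs_self _).trans ?_)⟩
    have := Finset.single_le_sum (f := fun l => |D l|) (fun _ _ => abs_nonneg _)
      (Finset.mem_range.2 (show l < L + 1 by omega))
    linarith
  obtain ⟨D, hD1, hD⟩ := hpD
  obtain ⟨F, hF0, hF⟩ := exists_norm_iteratedFDeriv_le_of_hasCompactSupport hf.smooth hf.compact L
  have key : ∀ ε : ℝ, 0 < ε → ε ≤ 1 → ‖T (fun x => (p x : ℂ) ^ (L + 1) * f x)‖ ≤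
      C * ((2 ^ L * ((L.factorial * B * D ^ L) * F)) * ε) := by
    intro ε hε hε1
    let a : V → ℝ := fun x => ε ^ (L + 1) * θ (ε⁻¹ * p x)
    have ha : ContDiff ℝ ∞ a := contDiff_const.mul (hθ.comp (contDiff_const.mul hp))
    have haC : ContDiff ℝ ∞ (fun x => (a x : ℂ)) := Complex.ofRealCLM.contDiff.comp ha
    have h0 : T (fun x => (p x : ℂ) ^ (L + 1) * f x) = T (fun x => (a x : ℂ) * f x) := by
      have hsub : (fun x => (p x : ℂ) ^ (L + 1) * f x) - (fun x => (a x : ℂ) * f x) =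
          fun x => (((p x) ^ (L + 1) * (1 - ρ (ε⁻¹ * p x)) : ℝ) : ℂ) * f x := by
        ext x
        simp only [a, θ, Pi.sub_apply]
        push_cast
        have : (ε : ℂ) ≠ 0 := by exact_mod_cast hε.ne'
        rw [mul_pow, inv_pow]
        field_simp
      rw [← sub_eq_zero, ← map_sub, hsub]
      have hm : ContDiff ℝ ∞ fun x => (((p x) ^ (L + 1) * (1 - ρ (ε⁻¹ * p x)) : ℝ) : ℂ) :=
        Complex.ofRealCLM.contDiff.comp ((hp.pow _).mul (contDiff_const.sub
          (ρ.contDiff.comp (contDiff_const.mul hp))))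
      have h1 := hf.mul_left hm
      refine hZ _ ⟨h1.smooth, h1.compact, fun x hx hxZ => ?_⟩
      have hxU := h1.supp hx
      have hpx := hpZ x ⟨hxZ, hxU⟩
      refine (notMem_tsupport_iff_eventuallyEq.2 ?_) hx
      have hcont : ContinuousAt (fun y => |ε⁻¹ * p y|) x :=
        (continuous_const.mul hp.continuous).abs.continuousAt
      have : ∀ᶠ y in nhds x, |ε⁻¹ * p y| < 1 :=
        hcont.eventually_lt continuousAt_const (by simp [hpx])
      filter_upwards [this] with y hy
      have : ρ (ε⁻¹ * p y) = 1 := ρ.one_of_mem_closedBall (by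
        simpa [Real.norm_eq_abs, ρ] using hy.le)
      simp [this]
    rw [h0]
    refine hC _ ⟨haC.mul hf.smooth, hf.compact.mul_left, tsupport_mul_subset_right⟩ _ ?_
    intro l hl x
    by_cases hx : x ∈ tsupport f
    swap
    · have : iteratedFDeriv ℝ l (fun x => (a x : ℂ) * f x) x = 0 := by
        by_contra h
        exact hx (tsupport_mul_subset_right (support_iteratedFDeriv_subset l h))
      rw [this, norm_zero]; positivity
    refine (norm_iteratedFDeriv_mul_le haC hf.smooth x (by exact_mod_cast le_top)).trans ?_
    have hai : ∀ i ≤ l, ‖iteratedFDeriv ℝ i (fun x => (a x : ℂ)) x‖ ≤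
        (L.factorial * B * D ^ L) * ε := by
      intro i hi
      have e1 : ‖iteratedFDeriv ℝ i (fun x => (a x : ℂ)) x‖ ≤ ‖iteratedFDeriv ℝ i a x‖ := by
        have := Complex.ofRealLI.norm_iteratedFDeriv_comp_left (f := a) (x := x) (i := i)
          (n := ∞) ha.contDiffAt (by exact_mod_cast le_top)
        exact this.le
      refine e1.trans ?_
      have e2 : iteratedFDeriv ℝ i a x = ε ^ (L + 1) •
          iteratedFDeriv ℝ i (θ ∘ fun y => ε⁻¹ • p y) x := by
        have : a = fun y => ε ^ (L + 1) • (θ ∘ fun y => ε⁻¹ • p y) y := by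
          ext y; simp [a]
        rw [this]
        exact iteratedFDeriv_const_smul_apply' ((hθ.comp (hp.const_smul _)).contDiffAt.of_le
          (by exact_mod_cast le_top))
      rw [e2, norm_smul]
      have e3 := norm_iteratedFDeriv_comp_le (𝕜 := ℝ) (g := θ) (f := fun y => ε⁻¹ • p y) (n := i)
        (N := ∞) hθ (hp.const_smul _) (by exact_mod_cast le_top) x (C := B) (D := ε⁻¹ * D)
        (fun j hj => hB j (by omega) _) (fun j hj1 hj => by
          have : iteratedFDeriv ℝ j (fun y => ε⁻¹ • p y) x = ε⁻¹ • iteratedFDeriv ℝ j p x :=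
            iteratedFDeriv_const_smul_apply' (hp.contDiffAt.of_le (by exact_mod_cast le_top))
          rw [this, norm_smul, norm_inv, Real.norm_eq_abs, abs_of_pos hε]
          have hεi : 1 ≤ ε⁻¹ * D := by
            have : 1 ≤ ε⁻¹ := (one_le_inv₀ hε).2 hε1
            nlinarith
          calc _ ≤ ε⁻¹ * D := by
                have := hD j (by omega) x hx
                have h2 : 0 ≤ ε⁻¹ := by positivity
                nlinarith
            _ ≤ _ := le_self_pow₀ hεi (by omega))
      rw [Real.norm_eq_abs, abs_of_pos (by positivity)]
      refine (mul_le_mul_of_nonneg_left e3 (by positivity)).trans ?_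
      have f1 : (i.factorial : ℝ) ≤ L.factorial := by
        exact_mod_cast Nat.factorial_le (by omega)
      have f2 : ε ^ (L + 1) * (ε⁻¹ * D) ^ i ≤ D ^ L * ε := by
        rw [mul_pow, inv_pow]
        have g1 : D ^ i ≤ D ^ L := pow_le_pow_right₀ hD1 (by omega)
        have g2 : ε ^ (L + 1) * (ε ^ i)⁻¹ ≤ ε := by
          rw [← div_eq_mul_inv, div_le_iff₀ (by positivity), ← pow_succ']
          exact pow_le_pow_of_le_one hε.le hε1 (by omega)
        calc _ = (ε ^ (L + 1) * (ε ^ i)⁻¹) * D ^ i := by ring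
          _ ≤ ε * D ^ L := by gcongr
          _ = _ := mul_comm _ _
      calc _ = (i.factorial : ℝ) * B * (ε ^ (L + 1) * (ε⁻¹ * D) ^ i) := by ring
        _ ≤ L.factorial * B * (D ^ L * ε) := by gcongr
        _ = _ := by ring
    have hterm : ∀ i ∈ Finset.range (l + 1), (l.choose i : ℝ) *
        ‖iteratedFDeriv ℝ i (fun x => (a x : ℂ)) x‖ * ‖iteratedFDeriv ℝ (l - i) f x‖ ≤
        (l.choose i : ℝ) * (((L.factorial * B * D ^ L) * ε) * F) := by
      intro i hi
      have hi' : i ≤ l := by simpa [Nat.lt_succ_iff] using hi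
      rw [mul_assoc]
      have := hai i hi'
      have := hF (l - i) (by omega) x
      gcongr
    refine (Finset.sum_le_sum hterm).trans ?_
    rw [← Finset.sum_mul]
    have hch : ∑ i ∈ Finset.range (l + 1), (l.choose i : ℝ) = 2 ^ l := by
      exact_mod_cast Nat.sum_range_choose l
    rw [hch]
    have : (2 : ℝ) ^ l ≤ 2 ^ L := pow_le_pow_right₀ (by norm_num) hl
    calc _ ≤ (2 : ℝ) ^ L * (((L.factorial * B * D ^ L) * ε) * F) := by gcongr
      _ = _ := by ring
  have hlim : Filter.Tendsto (fun ε : ℝ => C * ((2 ^ L * ((L.factorial * B * D ^ L) * F)) * ε))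
      (nhdsWithin 0 (Set.Ioi 0)) (nhds 0) := by
    have : Continuous fun ε : ℝ => C * ((2 ^ L * ((L.factorial * B * D ^ L) * F)) * ε) := by
      fun_prop
    simpa using (this.tendsto 0).mono_left nhdsWithin_le_nhds
  have : ‖T (fun x => (p x : ℂ) ^ (L + 1) * f x)‖ ≤ 0 := by
    refine ge_of_tendsto hlim ?_
    filter_upwards [Ioo_mem_nhdsGT (zero_lt_one (α := ℝ))] with ε hε
    exact key ε hε.1 hε.2.le
  simpa using this

end

section

variable {V : Type} [NormedAddCommGroup V] [NormedSpace ℝ V]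

theorem norm_taylor_remainder_le {F : Type*} [NormedAddCommGroup F] [NormedSpace ℝ F]
    {γ γ' γ'' : ℝ → F} {C t : ℝ} (hγ : ∀ s, HasDerivAt γ (γ' s) s)
    (hγ' : ∀ s, HasDerivAt γ' (γ'' s) s) (hC : ∀ s, |s| ≤ 1 → ‖γ'' s‖ ≤ C) (ht : |t| ≤ 1) :
    ‖γ t - γ 0 - t • γ' 0‖ ≤ C * t ^ 2 := by
  have hC0 : 0 ≤ C := (norm_nonneg _).trans (hC 0 (by simp))
  have h1 : ∀ s, |s| ≤ 1 → ‖γ' s - γ' 0‖ ≤ C * |s| := by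
    intro s hs
    have := Convex.norm_image_sub_le_of_norm_hasDerivWithin_le (s := Metric.closedBall (0 : ℝ) 1)
      (f := γ') (f' := γ'') (C := C) (x := 0) (y := s) (fun r _ => (hγ' r).hasDerivWithinAt)
      (fun r hr => hC r (by simpa using hr)) (convex_closedBall _ _) (by simp) (by simpa using hs)
    simpa using this
  have h2 := Convex.norm_image_sub_le_of_norm_hasDerivWithin_le
    (s := Metric.closedBall (0 : ℝ) |t|)
    (f := fun s => γ s - γ 0 - s • γ' 0) (f' := fun s => γ' s - γ' 0) (C := C * |t|) (x := 0)
    (y := t) (fun r _ => by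
      have : HasDerivAt (fun s => γ s - γ 0 - s • γ' 0) (γ' r - (1 : ℝ) • γ' 0) r :=
        ((hγ r).sub_const (γ 0)).sub ((hasDerivAt_id r).smul_const (γ' 0))
      rw [one_smul] at this
      exact this.hasDerivWithinAt)
    (fun r hr => by
      have hr' : |r| ≤ |t| := by simpa using hr
      exact (h1 r (hr'.trans ht)).trans (mul_le_mul_of_nonneg_left hr' hC0))
    (convex_closedBall _ _) (by simp) (by simp)
  simp only [zero_smul, sub_zero, sub_self, Real.norm_eq_abs] at h2
  calc _ ≤ _ := h2
    _ = C * t ^ 2 := by rw [mul_assoc, ← abs_mul, ← pow_two, abs_of_nonneg (sq_nonneg t)]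

theorem exists_norm_iteratedFDeriv_remainder_le {K : Set V} (hK : IsCompact K) (l : ℕ) :
    ∀ {F : Type} [NormedAddCommGroup F] [NormedSpace ℝ F] (Ψ : ℝ × V → F), ContDiff ℝ ∞ Ψ →
      ∃ C : ℝ, 0 ≤ C ∧ ∀ t : ℝ, |t| ≤ 1 → ∀ x ∈ K, ‖iteratedFDeriv ℝ l
        (fun x => Ψ (t, x) - Ψ (0, x) - t • fderiv ℝ Ψ (0, x) (1, 0)) x‖ ≤ C * t ^ 2 := by
  induction l with
  | zero =>
    intro F _ _ Ψ hΨ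
    have hΨ1 : ContDiff ℝ ∞ fun p => fderiv ℝ Ψ p ((1 : ℝ), (0 : V)) :=
      (hΨ.fderiv_right (by simp)).clm_apply contDiff_const
    have hΨ2 : ContDiff ℝ ∞ fun p => fderiv ℝ (fun p => fderiv ℝ Ψ p ((1 : ℝ), (0 : V))) p (1, 0) :=
      (hΨ1.fderiv_right (by simp)).clm_apply contDiff_const
    obtain ⟨C, hC⟩ := ((isCompact_closedBall (0 : ℝ) 1).prod hK).exists_bound_of_continuousOn
      hΨ2.continuous.continuousOn
    refine ⟨max C 0, le_max_right _ _, fun t ht x hx => ?_⟩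
    rw [norm_iteratedFDeriv_zero]
    have hline : ∀ s : ℝ, HasDerivAt (fun s : ℝ => (s, x)) ((1 : ℝ), (0 : V)) s := fun s =>
      (hasDerivAt_id s).prodMk (hasDerivAt_const s x)
    refine norm_taylor_remainder_le (γ := fun s => Ψ (s, x))
      (γ' := fun s => fderiv ℝ Ψ (s, x) (1, 0))
      (γ'' := fun s => fderiv ℝ (fun p => fderiv ℝ Ψ p ((1 : ℝ), (0 : V))) (s, x) (1, 0))
      (fun s => ((hΨ.differentiable (by simp)).differentiableAt.hasFDerivAt
        (x := (s, x))).comp_hasDerivAt s (hline s))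
      (fun s => HasFDerivAt.comp_hasDerivAt (l := fun p => fderiv ℝ Ψ p ((1 : ℝ), (0 : V))) s
          ((hΨ1.differentiable (by simp)).differentiableAt.hasFDerivAt
        (x := (s, x))) (hline s))
      (fun s hs => (hC (s, x) ⟨by simpa using hs, hx⟩).trans (le_max_left _ _)) ht
  | succ l ih =>
    intro F _ _ Ψ hΨ
    have hdf : ContDiff ℝ ∞ (fderiv ℝ Ψ) := hΨ.fderiv_right (by simp)
    let Φ : ℝ × V → (V →L[ℝ] F) := fun p => (fderiv ℝ Ψ p).comp (ContinuousLinearMap.inr ℝ ℝ V)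
    have hΦ : ContDiff ℝ ∞ Φ := hdf.clm_comp contDiff_const
    obtain ⟨C, hC0, hC⟩ := ih Φ hΦ
    refine ⟨C, hC0, fun t ht x hx => ?_⟩
    refine le_trans (le_of_eq ?_) (hC t ht x hx)
    rw [← norm_iteratedFDeriv_fderiv]
    congr 2
    ext y w
    have hin : ∀ s : ℝ, HasFDerivAt (fun y : V => (s, y)) (ContinuousLinearMap.inr ℝ ℝ V) y :=
      fun s => hasFDerivAt_prodMk_right s y
    have hd : ∀ s, HasFDerivAt (fun y => Ψ (s, y)) (Φ (s, y)) y := fun s =>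
      ((hΨ.differentiable (by simp)).differentiableAt.hasFDerivAt (x := (s, y))).comp y (hin s)
    have hdd := (((hdf.differentiable (by simp)).differentiableAt.hasFDerivAt
      (x := ((0 : ℝ), y))).comp y (hin 0)).clm_apply (hasFDerivAt_const ((1 : ℝ), (0 : V)) y)
    have htot := ((hd t).sub (hd 0)).sub (hdd.const_smul t)
    have e := htot.fderiv
    have e' : (fun y => Ψ (t, y) - Ψ (0, y) - t • fderiv ℝ Ψ (0, y) (1, 0)) =
      (((fun y => Ψ (t, y)) - fun y => Ψ (0, y)) -
        t • fun y => ((fderiv ℝ Ψ) ∘ fun y => ((0 : ℝ), y)) y ((1 : ℝ), (0 : V))) := rfl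
    rw [e', e]
    have hsymm : IsSymmSndFDerivAt ℝ Ψ ((0 : ℝ), y) :=
      hΨ.contDiffAt.isSymmSndFDerivAt (by
      rw [minSmoothness_of_isRCLikeNormedField]
      exact (WithTop.coe_le_coe.2 le_top : ((2 : ℕ∞) : WithTop ℕ∞) ≤ ∞))
    have e3 : fderiv ℝ Φ (0, y) (1, 0) w = fderiv ℝ (fderiv ℝ Ψ) (0, y) (1, 0) (0, w) := by
      have := ((hdf.differentiable (by simp)).differentiableAt.hasFDerivAt
        (x := ((0 : ℝ), y))).clm_comp (hasFDerivAt_const (ContinuousLinearMap.inr ℝ ℝ V)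
          ((0 : ℝ), y))
      rw [show Φ = fun p => (fderiv ℝ Ψ p).comp (ContinuousLinearMap.inr ℝ ℝ V) from rfl,
        this.fderiv]
      simp
    simp only [_root_.sub_apply, _root_.smul_apply, e3, hsymm.eq (1, 0) (0, w)]
    simp [Φ]

theorem HasOrderLE.hasDerivAt {T : (V → ℂ) →ₗ[ℂ] ℂ} {L : ℕ} (hT : HasOrderLE T L)
    {Ψ : ℝ × V → ℂ} (hΨ : ContDiff ℝ ∞ Ψ) {K : Set V} (hK : IsCompact K)
    (hsupp : ∀ t : ℝ, |t| ≤ 1 → ∀ x ∉ K, Ψ (t, x) = 0) :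
    HasDerivAt (fun t => T fun x => Ψ (t, x)) (T fun x => fderiv ℝ Ψ (0, x) (1, 0)) 0 := by
  obtain ⟨C, hC0, hC⟩ := hT K hK
  choose D hD0 hD using fun l => exists_norm_iteratedFDeriv_remainder_le hK l Ψ hΨ
  set M := ∑ l ∈ Finset.range (L + 1), D l
  have hbound : ∀ t : ℝ, |t| ≤ 1 → ‖(T fun x => Ψ (t, x)) - (T fun x => Ψ (0, x)) -
      t • (T fun x => fderiv ℝ Ψ (0, x) (1, 0))‖ ≤ C * M * t ^ 2 := by
    intro t ht
    have hR : ContDiff ℝ ∞ fun x => Ψ (t, x) - Ψ (0, x) - t • fderiv ℝ Ψ (0, x) (1, 0) :=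
      ((hΨ.comp (contDiff_prodMk_right t)).sub (hΨ.comp (contDiff_prodMk_right 0))).sub
        ((((hΨ.fderiv_right (m := ∞) (by simp)).clm_apply contDiff_const).comp
          (contDiff_prodMk_right (0 : ℝ))).const_smul t)
    have hz : ∀ x ∉ K, Ψ (t, x) - Ψ (0, x) - t • fderiv ℝ Ψ (0, x) (1, 0) = 0 := by
      intro x hx
      have hd : HasDerivAt (fun s : ℝ => Ψ (s, x)) (fderiv ℝ Ψ (0, x) (1, 0)) 0 :=
        ((hΨ.differentiable (by simp)).differentiableAt.hasFDerivAt
          (x := ((0 : ℝ), x))).comp_hasDerivAt 0 ((hasDerivAt_id 0).prodMk (hasDerivAt_const 0 x))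
      have : (fun s : ℝ => Ψ (s, x)) =ᶠ[nhds 0] fun _ => 0 := by
        filter_upwards [Metric.closedBall_mem_nhds (0 : ℝ) one_pos] with s hs
        exact hsupp s (by simpa using hs) x hx
      have h0 := (hd.congr_of_eventuallyEq this.symm).unique (hasDerivAt_const (0 : ℝ) (0 : ℂ))
      rw [hsupp t ht x hx, hsupp 0 (by simp) x hx, h0]
      simp
    have hts : tsupport (fun x => Ψ (t, x) - Ψ (0, x) - t • fderiv ℝ Ψ (0, x) (1, 0)) ⊆ K :=
      closure_minimal (fun x hx => by
        by_contra h
        exact hx (hz x h)) hK.isClosed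
    have htest : IsTestFun K fun x => Ψ (t, x) - Ψ (0, x) - t • fderiv ℝ Ψ (0, x) (1, 0) :=
      ⟨hR, hK.of_isClosed_subset (isClosed_tsupport _) hts, hts⟩
    have e : (T fun x => Ψ (t, x)) - (T fun x => Ψ (0, x)) -
        t • (T fun x => fderiv ℝ Ψ (0, x) (1, 0)) =
        T fun x => Ψ (t, x) - Ψ (0, x) - t • fderiv ℝ Ψ (0, x) (1, 0) := by
      have : (fun x => Ψ (t, x) - Ψ (0, x) - t • fderiv ℝ Ψ (0, x) (1, 0)) =
        (fun x => Ψ (t, x)) - (fun x => Ψ (0, x)) -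
          (t : ℂ) • (fun x => fderiv ℝ Ψ (0, x) (1, 0)) := by
        ext x; simp
      rw [this, map_sub, map_sub, map_smul]
      simp
    rw [e, mul_assoc]
    refine hC _ htest _ fun l hl x => ?_
    by_cases hx : x ∈ K
    · refine (hD l t ht x hx).trans (mul_le_mul_of_nonneg_right ?_ (sq_nonneg t))
      exact Finset.single_le_sum (f := D) (fun _ _ => hD0 _) (Finset.mem_range.2 (by omega))
    · have : iteratedFDeriv ℝ l
          (fun x => Ψ (t, x) - Ψ (0, x) - t • fderiv ℝ Ψ (0, x) (1, 0)) x = 0 := by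
        by_contra h
        exact hx (hts (support_iteratedFDeriv_subset l h))
      rw [this, norm_zero]
      exact mul_nonneg (Finset.sum_nonneg fun _ _ => hD0 _) (sq_nonneg t)
  rw [hasDerivAt_iff_isLittleO_nhds_zero]
  refine Asymptotics.IsBigO.trans_isLittleO (g := fun t : ℝ => t ^ 2) ?_ ?_
  · refine Asymptotics.IsBigO.of_bound (C * M) ?_
    filter_upwards [Metric.closedBall_mem_nhds (0 : ℝ) one_pos] with t ht
    simpa using hbound t (by simpa using ht)
  · simpa using Asymptotics.isLittleO_pow_id (𝕜 := ℝ) (n := 2) (by norm_num)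

end

section

/-- The functional `f ↦ T (a * f)`. -/
def mulFunctional {V : Type*} (a : V → ℂ) (T : (V → ℂ) →ₗ[ℂ] ℂ) : (V → ℂ) →ₗ[ℂ] ℂ where
  toFun f := T (fun x => a x * f x)
  map_add' f g := by
    rw [← map_add]; congr 1; ext x; simp [mul_add]
  map_smul' c f := by
    rw [RingHom.id_apply, ← map_smul]; congr 1; ext x; simp [mul_left_comm]

@[simp] theorem mulFunctional_apply {V : Type*} (a : V → ℂ) (T : (V → ℂ) →ₗ[ℂ] ℂ) (f : V → ℂ) :
    mulFunctional a T f = T (fun x => a x * f x) := rfl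

theorem mulFunctional_pow_succ {V : Type*} (a : V → ℂ) (m : ℕ) (T : (V → ℂ) →ₗ[ℂ] ℂ) (f : V → ℂ) :
    mulFunctional (fun x => a x ^ m) (mulFunctional a T) f =
      mulFunctional (fun x => a x ^ (m + 1)) T f := by
  simp only [mulFunctional_apply]; congr 1; ext x; ring

variable {V : Type*} [NormedAddCommGroup V] [NormedSpace ℝ V]

/-- Local data around `e` for the vanishing theorem: a linear vector field `B` which is written,
near `e`, as a combination of vector fields `d i` along the orbit (with coefficients `β i * q i`)
and of vector fields `Y j` (with coefficients `w j * v j`), where the functions `v j` cut out the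
orbit and are `B`-eigenfunctions. -/
structure VanishingChart (I J : Type*) [Fintype I] [Fintype J] (V : Type*) [NormedAddCommGroup V]
    [NormedSpace ℝ V] (U : Set V) (e : V) (B : V →L[ℝ] V) (β : I → ℝ) (w : J → ℝ) where
  /-- coordinates along the orbit -/
  q : I → V → ℝ
  /-- equations of the orbit -/
  v : J → V → ℝ
  /-- vector fields along the orbit -/
  d : I → V → V
  /-- transversal vector fields -/
  Y : J → V → V
  contDiff_q : ∀ i, ContDiff ℝ ∞ (q i)
  contDiff_v : ∀ j, ContDiff ℝ ∞ (v j)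
  contDiff_Y : ∀ j, ContDiff ℝ ∞ (Y j)
  isOpen : IsOpen U
  mem : e ∈ U
  fderiv_v_B : ∀ j, ∀ x ∈ U, fderiv ℝ (v j) x (B x) = w j * v j x
  fderiv_v_d : ∀ i j, ∀ x ∈ U, fderiv ℝ (v j) x (d i x) = 0
  fderiv_q_d : ∀ i, ∀ x ∈ U, fderiv ℝ (q i) x (d i x) = 1
  B_eq : ∀ x ∈ U, B x = (∑ i, (β i * q i x) • d i x) + ∑ j, (w j * v j x) • Y j x
  q_e : ∀ i, q i e = 0

theorem fderiv_ofReal_mul {a : V → ℝ} {f : V → ℂ} (ha : ContDiff ℝ ∞ a) (hf : ContDiff ℝ ∞ f)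
    (x u : V) : fderiv ℝ (fun y => (a y : ℂ) * f y) x u =
      (fderiv ℝ a x u : ℂ) * f x + (a x : ℂ) * fderiv ℝ f x u := by
  have h1 : HasFDerivAt (fun y => (a y : ℂ)) (Complex.ofRealCLM.comp (fderiv ℝ a x)) x :=
    Complex.ofRealCLM.hasFDerivAt.comp x (ha.differentiable (by simp)).differentiableAt.hasFDerivAt
  have h2 := h1.mul (hf.differentiable (by simp)).differentiableAt.hasFDerivAt
  rw [show (fun y => (a y : ℂ) * f y) = (fun y => (a y : ℂ)) * f from rfl, h2.fderiv]
  simp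
  ring

/-- A functional which is homogeneous for `B`, quasi-invariant along the vector fields `d i` and
annihilated by high powers of the functions `v j` vanishes near `e`, provided certain scalars do
not vanish. -/
theorem VanishingChart.exists_vanishesOn {I J : Type*} [Fintype I] [Fintype J]
    {U : Set V} {e : V} {B : V →L[ℝ] V} {β : I → ℝ}
    {w : J → ℝ} (𝒞 : VanishingChart I J V U e B β w) {a : I → V → ℂ}
    (ha : ∀ i, ContDiff ℝ ∞ (a i)) (N : ℕ) :
    ∀ (T : (V → ℂ) →ₗ[ℂ] ℂ) (c : ℂ) (k : J → ℕ),
      (∀ f, IsTestFun U f → T (fun x => fderiv ℝ f x (B x)) = c * T f) →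
      (∀ i f, IsTestFun U f → T (fun x => fderiv ℝ f x (𝒞.d i x)) = T fun x => a i x * f x) →
      (∀ j, VanishesOn (mulFunctional (fun x => (𝒞.v j x : ℂ) ^ k j) T) U) →
      (∀ α : J → ℕ, c - ∑ j, (α j : ℂ) * w j + ∑ i, (β i : ℂ) ≠ 0) →
      ∑ j, k j = N → ∃ U', IsOpen U' ∧ e ∈ U' ∧ VanishesOn T U' := by
  classical
  induction N using Nat.strong_induction_on with
  | _ N ih =>
  intro T c k hB hd hk hc hN
  have hC : ∀ j, ContDiff ℝ ∞ fun x => (𝒞.v j x : ℂ) := fun j =>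
    Complex.ofRealCLM.contDiff.comp (𝒞.contDiff_v j)
  have hCq : ∀ i, ContDiff ℝ ∞ fun x => (𝒞.q i x : ℂ) := fun i =>
    Complex.ofRealCLM.contDiff.comp (𝒞.contDiff_q i)
  have hzero : ∀ {f : V → ℂ}, IsTestFun U f → ∀ x ∉ U, f x = 0 ∧ ∀ u, fderiv ℝ f x u = 0 := by
    intro f hf x hx
    have hx' : x ∉ tsupport f := fun h => hx (hf.supp h)
    exact ⟨image_eq_zero_of_notMem_tsupport hx', fun u => by
      simp [fderiv_of_notMem_tsupport (𝕜 := ℝ) hx']⟩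
  have hv : ∀ j, ∃ U', IsOpen U' ∧ e ∈ U' ∧
      VanishesOn (mulFunctional (fun x => (𝒞.v j x : ℂ)) T) U' := by
    intro j
    by_cases hkj : k j = 0
    · refine ⟨U, 𝒞.isOpen, 𝒞.mem, fun f hf => ?_⟩
      simpa [hkj] using hk j _ (hf.mul_left (hC j))
    refine ih (∑ i, Function.update k j (k j - 1) i) ?_ (mulFunctional (fun x => (𝒞.v j x : ℂ)) T)
      (c - w j) (Function.update k j (k j - 1)) ?_ ?_ ?_ ?_ rfl
    · rw [← hN]
      refine Finset.sum_lt_sum (fun i _ => ?_) ⟨j, Finset.mem_univ _, ?_⟩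
      · by_cases hij : i = j
        · subst hij; simp
        · simp [hij]
      · simp; omega
    · intro f hf
      have e1 := hB _ (hf.mul_left (hC j))
      have e2 : (fun x => fderiv ℝ (fun x => (𝒞.v j x : ℂ) * f x) x (B x)) =
          (w j : ℂ) • (fun x => (𝒞.v j x : ℂ) * f x) +
            fun x => (𝒞.v j x : ℂ) * fderiv ℝ f x (B x) := by
        ext x
        by_cases hx : x ∈ U
        · rw [fderiv_ofReal_mul (𝒞.contDiff_v j) hf.smooth, 𝒞.fderiv_v_B j x hx]
          simp; ring
        · simp only [Pi.add_apply, Pi.smul_apply, (hzero hf x hx).1, (hzero hf x hx).2,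
            (hzero (hf.mul_left (hC j)) x hx).2]
          simp
      rw [e2, map_add, map_smul, smul_eq_mul] at e1
      simp only [mulFunctional_apply]
      linear_combination e1
    · intro i f hf
      have e1 := hd i _ (hf.mul_left (hC j))
      have e2 : (fun x => fderiv ℝ (fun x => (𝒞.v j x : ℂ) * f x) x (𝒞.d i x)) =
            fun x => (𝒞.v j x : ℂ) * fderiv ℝ f x (𝒞.d i x) := by
        ext x
        by_cases hx : x ∈ U
        · rw [fderiv_ofReal_mul (𝒞.contDiff_v j) hf.smooth, 𝒞.fderiv_v_d i j x hx]
          simp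
        · simp only [(hzero hf x hx).2, (hzero (hf.mul_left (hC j)) x hx).2, mul_zero]
      rw [e2] at e1
      simp only [mulFunctional_apply]
      rw [e1]; congr 1; ext x; ring
    · intro i f hf
      by_cases hij : i = j
      · subst hij
        rw [mulFunctional_pow_succ]
        have := hk i f hf
        rwa [Function.update_self, Nat.sub_add_cancel (by omega)]
      · have := hk i _ (hf.mul_left (hC j))
        simp only [mulFunctional_apply, Function.update_of_ne hij] at this ⊢
        rw [← this]; congr 1; ext x; ring
    · intro α h0
      refine hc (α + Pi.single j 1) ?_
      rw [← h0]
      simp only [Pi.add_apply, Nat.cast_add, add_mul, Finset.sum_add_distrib]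
      have : ∑ x, ((Pi.single j 1 : J → ℕ) x : ℂ) * (w x : ℂ) = w j := by
        rw [Finset.sum_eq_single j (fun i _ hij => by simp [Pi.single_eq_of_ne hij]) (by simp)]
        simp
      rw [this]; ring
  choose U' hU'o hU'e hU' using hv
  let m : V → ℂ := fun x => c + ∑ i, (β i : ℂ) - ∑ i, (β i : ℂ) * a i x * 𝒞.q i x
  have hm : ContDiff ℝ ∞ m := contDiff_const.sub
    (ContDiff.sum fun i _ => (contDiff_const.mul (ha i)).mul (hCq i))
  have hme : m e ≠ 0 := by
    simpa [m, 𝒞.q_e] using hc 0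
  refine ⟨U ∩ (⋂ j, U' j) ∩ {x | m x ≠ 0}, (𝒞.isOpen.inter (isOpen_iInter_of_finite hU'o)).inter
    (isOpen_ne_fun hm.continuous continuous_const), ⟨⟨𝒞.mem, Set.mem_iInter.2 hU'e⟩, hme⟩, ?_⟩
  have hmul : ∀ f, IsTestFun (U ∩ ⋂ j, U' j) f → T (fun x => m x * f x) = 0 := by
    intro f hf
    have hfU : IsTestFun U f := hf.mono Set.inter_subset_left
    have hfU' : ∀ j, IsTestFun (U' j) f := fun j =>
      hf.mono (Set.inter_subset_right.trans (Set.iInter_subset _ _))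
    have e1 := hB f hfU
    have e2 : (fun x => fderiv ℝ f x (B x)) =
        (∑ i, (β i : ℂ) • fun x => (𝒞.q i x : ℂ) * fderiv ℝ f x (𝒞.d i x)) +
        ∑ j, (w j : ℂ) • fun x => (𝒞.v j x : ℂ) * fderiv ℝ f x (𝒞.Y j x) := by
      ext x
      simp only [Pi.add_apply, Finset.sum_apply, Pi.smul_apply, smul_eq_mul]
      by_cases hx : x ∈ U
      · rw [𝒞.B_eq x hx, map_add, map_sum, map_sum]
        simp [mul_assoc]
      · simp [(hzero hfU x hx).2]
    have e3 : ∀ j, T (fun x => (𝒞.v j x : ℂ) * fderiv ℝ f x (𝒞.Y j x)) = 0 := fun j =>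
      hU' j _ ((hfU' j).fderiv_apply (𝒞.contDiff_Y j))
    have e4 : ∀ i, T (fun x => (𝒞.q i x : ℂ) * fderiv ℝ f x (𝒞.d i x)) =
        T (fun x => a i x * 𝒞.q i x * f x) - T f := by
      intro i
      have h1 := hd i _ (hfU.mul_left (hCq i))
      have h2 : (fun x => fderiv ℝ (fun x => (𝒞.q i x : ℂ) * f x) x (𝒞.d i x)) =
          f + fun x => (𝒞.q i x : ℂ) * fderiv ℝ f x (𝒞.d i x) := by
        ext x
        by_cases hx : x ∈ U
        · rw [fderiv_ofReal_mul (𝒞.contDiff_q i) hfU.smooth, 𝒞.fderiv_q_d i x hx]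
          simp
        · simp [(hzero hfU x hx).1, (hzero hfU x hx).2, (hzero (hfU.mul_left (hCq i)) x hx).2]
      rw [h2, map_add] at h1
      have h3 : (fun x => a i x * 𝒞.q i x * f x) = fun x => a i x * (𝒞.q i x * f x) := by
        ext x; ring
      rw [h3, ← h1]; ring
    rw [e2, map_add, map_sum, map_sum] at e1
    simp only [map_smul, smul_eq_mul, e3, e4, mul_zero, Finset.sum_const_zero, add_zero] at e1
    have e5 : (fun x => m x * f x) = (c + ∑ i, (β i : ℂ)) • f -
        ∑ i, (β i : ℂ) • fun x => a i x * 𝒞.q i x * f x := by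
      ext x
      simp only [m, Pi.sub_apply, Pi.smul_apply, Finset.sum_apply, smul_eq_mul, sub_mul,
        Finset.sum_mul]
      congr 1
      exact Finset.sum_congr rfl fun i _ => by ring
    rw [e5, map_sub, map_smul, map_sum]
    simp only [map_smul, smul_eq_mul]
    simp only [mul_sub, Finset.sum_sub_distrib, ← Finset.sum_mul] at e1
    linear_combination -e1
  intro f hf
  have hfm : IsTestFun (U ∩ ⋂ j, U' j) fun x => (m x)⁻¹ * f x := by
    refine ⟨?_, hf.compact.mul_left, tsupport_mul_subset_right.trans
      (hf.supp.trans Set.inter_subset_left)⟩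
    rw [contDiff_iff_contDiffAt]
    intro x
    by_cases hx : x ∈ tsupport f
    · exact (hm.contDiffAt.inv (hf.supp hx).2).mul hf.smooth.contDiffAt
    · have : (fun x => (m x)⁻¹ * f x) =ᶠ[nhds x] fun _ => 0 := by
        filter_upwards [notMem_tsupport_iff_eventuallyEq.1 hx] with y hy
        simp [hy]
      exact contDiffAt_const.congr_of_eventuallyEq this
  have := hmul _ hfm
  rw [← this]
  congr 1
  ext x
  by_cases hx : x ∈ tsupport f
  · rw [mul_inv_cancel_left₀ (hf.supp hx).2]
  · simp [image_eq_zero_of_notMem_tsupport hx]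

end

section

/-- A nilpotent endomorphism `e`, odd for the grading involution `ε`, is part of a graded
`sl₂`-triple with integral weights of bounded graded trace. -/
def HasGradedTriple {E : Type*} [AddCommGroup E] [Module ℝ E] (e ε : Module.End ℝ E) : Prop :=
  ∃ (h f : Module.End ℝ E) (ι : Type) (_ : Fintype ι) (b : Module.Basis ι ℝ E) (wt sg : ι → ℤ),
    h * e - e * h = 2 • e ∧ h * f - f * h = -(2 • f) ∧ e * f - f * e = h ∧ f * ε = -(ε * f) ∧
    (∀ i, h (b i) = (wt i : ℝ) • b i) ∧ (∀ i, ε (b i) = (sg i : ℝ) • b i) ∧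
    (∀ i, sg i = 1 ∨ sg i = -1) ∧ |∑ i, sg i * wt i| ≤ Fintype.card ι

theorem HasGradedTriple.of_prod {E C W : Type*} [AddCommGroup E] [Module ℝ E] [AddCommGroup C]
    [Module ℝ C] [AddCommGroup W] [Module ℝ W] {e ε : Module.End ℝ E} {e₁ ε₁ : Module.End ℝ C}
    {e₂ ε₂ : Module.End ℝ W} (h₁ : HasGradedTriple e₁ ε₁) (h₂ : HasGradedTriple e₂ ε₂)
    (Θ : (C × W) ≃ₗ[ℝ] E) (he : ∀ x, e (Θ x) = Θ (e₁ x.1, e₂ x.2))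
    (hε : ∀ x, ε (Θ x) = Θ (ε₁ x.1, ε₂ x.2)) : HasGradedTriple e ε := by
  obtain ⟨h, f, ι, _, b, wt, sg, h1, h2, h3, h4, h5, h6, h7, h8⟩ := h₁
  obtain ⟨h', f', ι', _, b', wt', sg', h1', h2', h3', h4', h5', h6', h7', h8'⟩ := h₂
  have hconj : ∀ (A : Module.End ℝ C) (B : Module.End ℝ W) (x : C × W),
      Θ.conj (A.prodMap B) (Θ x) = Θ (A x.1, B x.2) := fun A B x => by
    simp [LinearEquiv.conj_apply_apply, LinearMap.prodMap_apply]
  refine ⟨Θ.conj (h.prodMap h'), Θ.conj (f.prodMap f'), ι ⊕ ι', inferInstance,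
    (b.prod b').map Θ, Sum.elim wt wt', Sum.elim sg sg', ?_, ?_, ?_, ?_, ?_, ?_, ?_, ?_⟩
  · refine LinearMap.ext fun y => ?_
    obtain ⟨x, rfl⟩ := Θ.surjective y
    have e1 := LinearMap.congr_fun h1 x.1
    have e2 := LinearMap.congr_fun h1' x.2
    simp only [LinearMap.sub_apply, Module.End.mul_apply, LinearMap.smul_apply] at e1 e2 ⊢
    rw [he, hconj, hconj, he, ← map_sub, ← map_nsmul, Prod.mk_sub_mk, Prod.smul_mk, e1, e2]
  · refine LinearMap.ext fun y => ?_
    obtain ⟨x, rfl⟩ := Θ.surjective y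
    have e1 := LinearMap.congr_fun h2 x.1
    have e2 := LinearMap.congr_fun h2' x.2
    simp only [LinearMap.sub_apply, Module.End.mul_apply, LinearMap.smul_apply,
      LinearMap.neg_apply] at e1 e2 ⊢
    rw [hconj, hconj, hconj, hconj, ← map_sub, ← map_nsmul, ← map_neg, Prod.mk_sub_mk,
      Prod.smul_mk, Prod.neg_mk, e1, e2]
  · refine LinearMap.ext fun y => ?_
    obtain ⟨x, rfl⟩ := Θ.surjective y
    have e1 := LinearMap.congr_fun h3 x.1
    have e2 := LinearMap.congr_fun h3' x.2
    simp only [LinearMap.sub_apply, Module.End.mul_apply] at e1 e2 ⊢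
    rw [he, hconj, hconj, he, hconj, ← map_sub, Prod.mk_sub_mk, e1, e2]
  · refine LinearMap.ext fun y => ?_
    obtain ⟨x, rfl⟩ := Θ.surjective y
    have e1 := LinearMap.congr_fun h4 x.1
    have e2 := LinearMap.congr_fun h4' x.2
    simp only [Module.End.mul_apply, LinearMap.neg_apply] at e1 e2 ⊢
    rw [hε, hconj, hconj, hε, ← map_neg, Prod.neg_mk, e1, e2]
  · rintro (i | i)
    · rw [Module.Basis.map_apply, hconj]
      simp [h5, ← map_smul]
    · rw [Module.Basis.map_apply, hconj]
      simp [h5', ← map_smul]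
  · rintro (i | i)
    · rw [Module.Basis.map_apply, hε]
      simp [h6, ← map_smul]
    · rw [Module.Basis.map_apply, hε]
      simp [h6', ← map_smul]
  · rintro (i | i)
    · simpa using h7 i
    · simpa using h7' i
  · rw [Fintype.sum_sum_type, Fintype.card_sum]
    push_cast
    refine (abs_add_le _ _).trans ?_
    simpa using add_le_add h8 h8'

theorem sum_range_neg_one_pow_mul (k : ℕ) (c : ℤ) :
    ∑ a ∈ Finset.range (2 * k), (-1 : ℤ) ^ a * (2 * a - c) = -2 * k := by
  induction k with
  | zero => simp
  | succ k ih =>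
    rw [show 2 * (k + 1) = 2 * k + 1 + 1 by ring, Finset.sum_range_succ, Finset.sum_range_succ, ih]
    simp only [pow_add, pow_mul]
    push_cast
    ring

theorem abs_sum_range_neg_one_pow_mul_le (m : ℕ) :
    |∑ a ∈ Finset.range m, (-1 : ℤ) ^ a * (2 * a - m + 1)| ≤ m := by
  obtain ⟨k, rfl | rfl⟩ := m.even_or_odd'
  · have := sum_range_neg_one_pow_mul k (2 * k - 1)
    have e : ∀ a ∈ Finset.range (2 * k), (-1 : ℤ) ^ a * (2 * a - ((2 * k : ℕ) : ℤ) + 1) =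
        (-1 : ℤ) ^ a * (2 * a - (2 * k - 1)) := fun a _ => by push_cast; ring
    rw [Finset.sum_congr rfl e, this]
    rw [abs_le]; push_cast; constructor <;> linarith
  · rw [Finset.sum_range_succ]
    have := sum_range_neg_one_pow_mul k (2 * k)
    have e : ∀ a ∈ Finset.range (2 * k), (-1 : ℤ) ^ a * (2 * a - ((2 * k + 1 : ℕ) : ℤ) + 1) =
        (-1 : ℤ) ^ a * (2 * a - (2 * k)) := fun a _ => by push_cast; ring
    rw [Finset.sum_congr rfl e, this]
    simp only [pow_mul]
    rw [abs_le]; push_cast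
    constructor <;> norm_num <;> linarith

/-- The shift on `ℝ^m`. -/
def shiftEnd (m : ℕ) : Module.End ℝ (Fin m → ℝ) where
  toFun x a := if h : (a : ℕ) = 0 then 0 else x ⟨a - 1, by omega⟩
  map_add' x y := by ext a; dsimp; split_ifs <;> simp
  map_smul' c x := by ext a; dsimp; split_ifs <;> simp

/-- The lowering operator of the irreducible `sl₂`-representation on `ℝ^m`. -/
def lowerEnd (m : ℕ) : Module.End ℝ (Fin m → ℝ) where
  toFun x a := if h : (a : ℕ) + 1 < m then ((a : ℝ) + 1) * (m - a - 1) * x ⟨a + 1, h⟩ else 0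
  map_add' x y := by ext a; dsimp; split_ifs <;> ring
  map_smul' c x := by ext a; dsimp; split_ifs <;> ring

/-- A diagonal endomorphism of `ℝ^m`. -/
def diagEnd {m : ℕ} (d : Fin m → ℝ) : Module.End ℝ (Fin m → ℝ) where
  toFun x a := d a * x a
  map_add' x y := by ext a; simp [mul_add]
  map_smul' c x := by ext a; simp [mul_left_comm]

theorem hasGradedTriple_shiftEnd (m : ℕ) {s : ℤ} (hs : s = 1 ∨ s = -1) :
    HasGradedTriple (shiftEnd m) (diagEnd fun a : Fin m => ((s * (-1) ^ (a : ℕ) : ℤ) : ℝ)) := by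
  refine ⟨diagEnd fun a => ((2 * a - m + 1 : ℤ) : ℝ), lowerEnd m, Fin m, inferInstance,
    Pi.basisFun ℝ (Fin m), fun a => 2 * a - m + 1, fun a => s * (-1) ^ (a : ℕ),
    ?_, ?_, ?_, ?_, ?_, ?_, ?_, ?_⟩
  · refine LinearMap.ext fun x => funext fun a => ?_
    simp only [diagEnd, shiftEnd, LinearMap.sub_apply, Module.End.mul_apply, LinearMap.coe_mk,
      AddHom.coe_mk, LinearMap.smul_apply, Pi.sub_apply, Pi.smul_apply]
    split_ifs with h
    · simp
    · push_cast [Nat.cast_sub (show 1 ≤ (a : ℕ) by omega)]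
      simp; ring
  · refine LinearMap.ext fun x => funext fun a => ?_
    simp only [diagEnd, lowerEnd, LinearMap.sub_apply, Module.End.mul_apply, LinearMap.coe_mk,
      AddHom.coe_mk, LinearMap.smul_apply, Pi.sub_apply, Pi.smul_apply, LinearMap.neg_apply,
      Pi.neg_apply]
    split_ifs with h
    · push_cast
      simp; ring
    · simp
  · refine LinearMap.ext fun x => funext fun a => ?_
    simp only [diagEnd, shiftEnd, lowerEnd, LinearMap.sub_apply, Module.End.mul_apply,
      LinearMap.coe_mk, AddHom.coe_mk, Pi.sub_apply]
    have e1 : (if h : (a : ℕ) = 0 then (0 : ℝ) else if h_1 : (a : ℕ) - 1 + 1 < m then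
        (((a - 1 : ℕ) : ℝ) + 1) * (m - ((a - 1 : ℕ) : ℝ) - 1) * x ⟨(a : ℕ) - 1 + 1, h_1⟩ else 0) =
        a * (m - a) * x a := by
      split_ifs with h h'
      · simp [h]
      · have : (⟨(a : ℕ) - 1 + 1, h'⟩ : Fin m) = a := Fin.ext (by simp; omega)
        rw [this]
        push_cast [Nat.cast_sub (show 1 ≤ (a : ℕ) by omega)]
        ring
      · omega
    have e2 : (if h : (a : ℕ) + 1 < m then ((a : ℝ) + 1) * (m - a - 1) *
        (if h_1 : (a : ℕ) + 1 = 0 then 0 else x ⟨(a : ℕ) + 1 - 1, by omega⟩) else 0) =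
        (a + 1) * (m - a - 1) * x a := by
      by_cases h : (a : ℕ) + 1 < m
      · rw [dif_pos h, dif_neg (by omega)]; rfl
      · rw [dif_neg h]
        have : (m : ℝ) = a + 1 := by exact_mod_cast (show m = (a : ℕ) + 1 by omega)
        rw [this]; ring
    rw [e1, e2]
    push_cast
    ring
  · refine LinearMap.ext fun x => funext fun a => ?_
    simp only [diagEnd, lowerEnd, Module.End.mul_apply, LinearMap.coe_mk,
      AddHom.coe_mk, LinearMap.neg_apply, Pi.neg_apply]
    split_ifs with h
    · push_cast
      rw [pow_succ]; ring
    · simp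
  · intro i
    ext a
    by_cases h : a = i
    · subst h; simp [diagEnd]
    · simp [diagEnd, Pi.single_eq_of_ne h]
  · intro i
    ext a
    by_cases h : a = i
    · subst h; simp [diagEnd]
    · simp [diagEnd, Pi.single_eq_of_ne h]
  · intro i
    rcases neg_one_pow_eq_or ℤ (i : ℕ) with h | h <;> rcases hs with rfl | rfl <;> simp [h]
  · have := abs_sum_range_neg_one_pow_mul_le m
    rw [Fintype.card_fin]
    refine le_trans (le_of_eq ?_) this
    rw [← Fin.sum_univ_eq_sum_range (fun a => (-1 : ℤ) ^ a * (2 * a - m + 1)) m]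
    have e : ∑ i : Fin m, s * (-1) ^ (i : ℕ) * (2 * (i : ℤ) - m + 1) =
        s * ∑ i : Fin m, (-1) ^ (i : ℕ) * (2 * (i : ℤ) - m + 1) := by
      rw [Finset.mul_sum]; exact Finset.sum_congr rfl fun _ _ => by ring
    rw [e, abs_mul]
    rcases hs with rfl | rfl <;> simp

end

section

theorem pow_mul_of_anticommute {E : Type*} [AddCommGroup E] [Module ℝ E] {e ε : Module.End ℝ E}
    (h : ε * e = -(e * ε)) (b : ℕ) (v : E) :
    ε ((e ^ b) v) = (-1 : ℝ) ^ b • (e ^ b) (ε v) := by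
  induction b generalizing v with
  | zero => simp
  | succ b ih =>
    have h1 : ε (e v) = -(e (ε v)) := LinearMap.congr_fun h v
    rw [pow_succ, Module.End.mul_apply, ih, h1, Module.End.mul_apply, map_neg, pow_succ]
    simp

theorem linearIndependent_pow_apply {E : Type*} [AddCommGroup E] [Module ℝ E] {e : Module.End ℝ E}
    {k : ℕ} {u : E} (hu : (e ^ k) u ≠ 0) (he : e ^ (k + 1) = 0) :
    LinearIndependent ℝ fun b : Fin (k + 1) => (e ^ (b : ℕ)) u := by
  rw [Fintype.linearIndependent_iff]
  intro g hg
  have key : ∀ i : ℕ, ∀ hi : i < k + 1, g ⟨i, hi⟩ = 0 := by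
    intro i
    induction i using Nat.strong_induction_on with
    | _ i ih =>
      intro hi
      have h1 := congrArg (e ^ (k - i)) hg
      rw [map_sum, map_zero, Finset.sum_eq_single ⟨i, hi⟩] at h1
      · rw [map_smul, ← Module.End.mul_apply, ← pow_add, Nat.sub_add_cancel (by omega)] at h1
        exact (smul_eq_zero.1 h1).resolve_right hu
      · intro b _ hb
        have hb' : (b : ℕ) ≠ i := fun h => hb (Fin.ext h)
        rcases lt_or_gt_of_ne hb' with h | h
        · have := ih b h b.2
          rw [Fin.eta] at this
          simp [this]
        · rw [map_smul, ← Module.End.mul_apply, ← pow_add,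
            pow_eq_zero_of_le (show k + 1 ≤ k - i + b by omega) he]
          simp
      · simp
  exact fun i => key i i.2

theorem hasGradedTriple_of_isNilpotent (N : ℕ) : ∀ {E : Type} [AddCommGroup E] [Module ℝ E]
    [FiniteDimensional ℝ E] {e ε : Module.End ℝ E}, Module.finrank ℝ E = N → ε * ε = 1 →
    ε * e = -(e * ε) → IsNilpotent e → HasGradedTriple e ε := by
  induction N using Nat.strong_induction_on with
  | _ N ih =>
  classical
  intro E _ _ _ e ε hN hεε hεe he
  rcases subsingleton_or_nontrivial E with hE | hE
  · have hz : ∀ A : Module.End ℝ E, A = 0 := fun A => LinearMap.ext fun x => Subsingleton.elim _ _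
    refine ⟨0, 0, Empty, inferInstance, Module.Basis.empty E, fun _ => 0, fun _ => 0, ?_, ?_, ?_,
      ?_, fun i => i.elim, fun i => i.elim, fun i => i.elim, by simp⟩
    all_goals exact (hz _).trans (hz _).symm
  obtain ⟨k, hk1, hk⟩ : ∃ k, e ^ (k + 1) = 0 ∧ e ^ k ≠ 0 := by
    have hpos := pos_nilpotencyClass_iff.2 he
    refine ⟨nilpotencyClass e - 1, ?_, pow_pred_nilpotencyClass he⟩
    rw [Nat.sub_add_cancel hpos]
    exact pow_nilpotencyClass he
  have hε2 : ∀ v, ε (ε v) = v := fun v => LinearMap.congr_fun hεε v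
  -- a homogeneous cyclic vector
  obtain ⟨u, s, hs, hεu, hu⟩ : ∃ (u : E) (s : ℤ), (s = 1 ∨ s = -1) ∧ ε u = (s : ℝ) • u ∧
      (e ^ k) u ≠ 0 := by
    obtain ⟨w, hw⟩ : ∃ w, (e ^ k) w ≠ 0 := by
      by_contra! h
      exact hk (LinearMap.ext h)
    by_cases h1 : (e ^ k) (w + ε w) = 0
    · refine ⟨w - ε w, -1, Or.inr rfl, by simp [hε2], fun h2 => hw ?_⟩
      have : (2 : ℝ) • w = (w + ε w) + (w - ε w) := by rw [two_smul]; abel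
      have h3 : (2 : ℝ) • (e ^ k) w = 0 := by rw [← map_smul, this, map_add, h1, h2, add_zero]
      exact (smul_eq_zero.1 h3).resolve_left two_ne_zero
    · exact ⟨w + ε w, 1, Or.inl rfl, by simp [hε2, add_comm], h1⟩
  let c : ℕ → E := fun b => (e ^ b) u
  have hc0 : ∀ b, k < b → c b = 0 := fun b hb => by
    simp only [c]; rw [pow_eq_zero_of_le hb hk1]; rfl
  have hεc : ∀ b, ε (c b) = ((s * (-1) ^ b : ℤ) : ℝ) • c b := fun b => by
    simp only [c]
    rw [pow_mul_of_anticommute hεe, hεu, map_smul, smul_smul]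
    push_cast; rw [mul_comm]
  -- a homogeneous functional dual to the top of the chain
  obtain ⟨ℓ, s', hℓε, hℓ⟩ : ∃ (ℓ : E →ₗ[ℝ] ℝ) (s' : ℝ), (∀ v, ℓ (ε v) = s' * ℓ v) ∧
      ∀ b, ℓ (c b) = if b = k then 1 else 0 := by
    have hli := linearIndependent_pow_apply hu hk1
    let B := Module.Basis.extend hli.linearIndepOn_id
    have hmem : ∀ b : Fin (k + 1), (e ^ (b : ℕ)) u ∈ hli.linearIndepOn_id.extend
        (Set.subset_univ _) := fun b => hli.linearIndepOn_id.subset_extend _ ⟨b, rfl⟩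
    let ℓ₀ := B.coord ⟨_, hmem ⟨k, by omega⟩⟩
    have h0 : ∀ b, ℓ₀ (c b) = if b = k then 1 else 0 := by
      intro b
      by_cases hb : b < k + 1
      · have : c b = B ⟨_, hmem ⟨b, hb⟩⟩ := by simp [B, c]
        rw [this, Module.Basis.coord_apply, Module.Basis.repr_self, Finsupp.single_apply]
        congr 1
        simp only [Subtype.mk.injEq, eq_iff_iff]
        constructor
        · intro h
          have := hli.injective (a₁ := ⟨b, hb⟩) (a₂ := ⟨k, by omega⟩) h
          simpa using this
        · rintro rfl; rfl
      · rw [hc0 b (by omega), map_zero, if_neg (by omega)]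
    have hs2 : ((s * (-1) ^ k : ℤ) : ℝ) * ((s * (-1) ^ k : ℤ) : ℝ) = 1 := by
      rcases hs with rfl | rfl <;> rcases neg_one_pow_eq_or ℤ k with h | h <;> simp [h]
    set s' : ℝ := ((s * (-1) ^ k : ℤ) : ℝ)
    refine ⟨(2 : ℝ)⁻¹ • (ℓ₀ + s' • ℓ₀ ∘ₗ ε), s', fun v => ?_, fun b => ?_⟩
    · simp only [LinearMap.smul_apply, LinearMap.add_apply, LinearMap.comp_apply, hε2, smul_eq_mul]
      linear_combination (-(2 : ℝ)⁻¹ * ℓ₀ (ε v)) * hs2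
    · simp only [LinearMap.smul_apply, LinearMap.add_apply, LinearMap.comp_apply, hεc, map_smul,
        smul_eq_mul, h0]
      split_ifs with h
      · subst h
        change (2 : ℝ)⁻¹ * (1 + s' * (s' * 1)) = 1
        rw [mul_one, hs2]; norm_num
      · simp
  let G : Fin (k + 1) → E →ₗ[ℝ] ℝ := fun a => ℓ ∘ₗ (e ^ (k - a) : Module.End ℝ E)
  have hG : ∀ a b : Fin (k + 1), G a (c b) = if b = a then 1 else 0 := by
    intro a b
    have : (e ^ (k - (a : ℕ))) (c b) = c (k - a + b) := by
      simp only [c]; rw [pow_add]; rfl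
    simp only [G, LinearMap.comp_apply, this, hℓ]
    congr 1
    rw [eq_iff_iff, Fin.ext_iff]
    omega
  let W : Submodule ℝ E := ⨅ a, LinearMap.ker (G a)
  have hW : ∀ w, w ∈ W ↔ ∀ a, G a w = 0 := fun w => by simp [W, Submodule.mem_iInf]
  have heW : ∀ w ∈ W, e w ∈ W := by
    intro w hw
    rw [hW] at hw ⊢
    intro a
    have : G a (e w) = ℓ ((e ^ (k - a + 1)) w) := by
      simp only [G, LinearMap.comp_apply]; rw [pow_succ]; rfl
    rw [this]
    by_cases ha : (a : ℕ) = 0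
    · rw [pow_eq_zero_of_le (show k + 1 ≤ k - a + 1 by omega) hk1]; simp
    · have := hw ⟨a - 1, by omega⟩
      simp only [G, LinearMap.comp_apply] at this
      rwa [show k - (a - 1 : ℕ) = k - a + 1 by omega] at this
  have hεW : ∀ w ∈ W, ε w ∈ W := by
    intro w hw
    rw [hW] at hw ⊢
    intro a
    have h1 := hw a
    simp only [G, LinearMap.comp_apply] at h1 ⊢
    have h2 := congrArg ℓ (pow_mul_of_anticommute hεe (k - a) w)
    rw [hℓε, h1, mul_zero, map_smul, smul_eq_mul] at h2
    exact (mul_eq_zero.1 h2.symm).resolve_left (pow_ne_zero _ (by norm_num))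
  have hWlt : Module.finrank ℝ W < N := by
    rw [← hN]
    refine Submodule.finrank_lt fun htop => ?_
    have h1 : c ((0 : Fin (k + 1)) : ℕ) ∈ W := htop ▸ Submodule.mem_top
    have h2 := (hW _).1 h1 0
    rw [hG] at h2
    simp at h2
  have hWn : IsNilpotent (e.restrict heW) := by
    refine ⟨k + 1, LinearMap.ext fun w => Subtype.ext ?_⟩
    rw [Module.End.pow_restrict]
    simp [hk1]
  have hWt : HasGradedTriple (e.restrict heW) (ε.restrict hεW) := by
    refine ih _ hWlt rfl ?_ ?_ hWn
    · refine LinearMap.ext fun w => Subtype.ext ?_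
      simpa using hε2 w
    · refine LinearMap.ext fun w => Subtype.ext ?_
      have := LinearMap.congr_fun hεe (w : E)
      simpa using this
  let Φ : ((Fin (k + 1) → ℝ) × W) →ₗ[ℝ] E :=
    (Fintype.linearCombination ℝ fun a : Fin (k + 1) => c a).coprod W.subtype
  have hΦ : ∀ x, Φ x = ∑ a, x.1 a • c a + x.2 := fun x => by
    simp [Φ, Fintype.linearCombination_apply]
  have hGs : ∀ (x : Fin (k + 1) → ℝ) b, G b (∑ a, x a • c a) = x b := fun x b => by
    rw [map_sum]; simp [hG]
  have hinj : Function.Injective Φ := by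
    rw [injective_iff_map_eq_zero]
    rintro ⟨x, w⟩ h
    rw [hΦ] at h
    have hx : x = 0 := funext fun b => by
      have := congrArg (G b) h
      rw [map_add, hGs, (hW _).1 w.2 b, add_zero, map_zero] at this
      exact this
    subst hx
    simp only [Pi.zero_apply, zero_smul, Finset.sum_const_zero, zero_add] at h
    exact Prod.ext rfl (Subtype.ext h)
  have hsurj : Function.Surjective Φ := by
    intro v
    refine ⟨(fun a => G a v, ⟨v - ∑ a, G a v • c a, (hW _).2 fun b => ?_⟩), ?_⟩
    · rw [map_sub, hGs (fun a => G a v), sub_self]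
    · rw [hΦ]; simp
  refine (hasGradedTriple_shiftEnd (k + 1) hs).of_prod hWt (LinearEquiv.ofBijective Φ ⟨hinj, hsurj⟩)
    ?_ ?_
  · rintro ⟨x, w⟩
    change e (Φ (x, w)) = Φ (shiftEnd (k + 1) x, e.restrict heW w)
    rw [hΦ, hΦ, map_add, map_sum]
    simp only [map_smul]
    congr 1
    have hec : ∀ b, e (c b) = c (b + 1) := fun b => by simp only [c]; rw [pow_succ']; rfl
    simp only [hec]
    rw [Fin.sum_univ_castSucc, Fin.sum_univ_succ]
    have : c ((Fin.last k : ℕ) + 1) = 0 := hc0 _ (by simp)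
    rw [this, smul_zero, add_zero]
    simp only [shiftEnd, LinearMap.coe_mk, AddHom.coe_mk]
    simp
    rfl
  · rintro ⟨x, w⟩
    change ε (Φ (x, w)) = Φ (diagEnd _ x, ε.restrict hεW w)
    rw [hΦ, hΦ, map_add, map_sum]
    simp only [map_smul, hεc]
    congr 1
    refine Finset.sum_congr rfl fun a _ => ?_
    rw [smul_smul, mul_comm]
    rfl

end

section

theorem sl2_mul_pow {R : Type*} [Ring R] {X H : R} (hHX : H * X = X * H + 2 * X) (k : ℕ) :
    H * X ^ k = X ^ k * (H + 2 * k) := by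
  induction k with
  | zero => simp
  | succ k ih =>
    rw [pow_succ, ← mul_assoc, ih, mul_assoc, add_mul, hHX]
    push_cast
    have : (2 * (k : R)) * X = X * (2 * (k : R)) := by
      rw [mul_assoc, (Nat.cast_commute k X).eq, ← mul_assoc, ← mul_assoc]
      congr 1
      exact (Nat.cast_commute 2 X).eq
    have h2 : (2 : R) * X = X * 2 := (Nat.cast_commute 2 X).eq
    rw [this, h2]
    noncomm_ring

theorem sl2_pow_mul {R : Type*} [Ring R] {X Y H : R} (hXY : X * Y = Y * X + H)
    (hHX : H * X = X * H + 2 * X) (k : ℕ) :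
    X ^ (k + 1) * Y = Y * X ^ (k + 1) + (k + 1) * X ^ k * (H + k) := by
  induction k with
  | zero => simp [hXY]
  | succ k ih =>
    have h1 := sl2_mul_pow hHX (k + 1)
    have h2 : X * ((k : R) + 1) = ((k : R) + 1) * X := by
      rw [mul_add, add_mul, (Nat.cast_commute k X).eq]; simp
    calc X ^ (k + 1 + 1) * Y = X * (X ^ (k + 1) * Y) := by rw [pow_succ' X (k + 1), mul_assoc]
      _ = (X * Y) * X ^ (k + 1) + (X * ((k : R) + 1)) * X ^ k * (H + k) := by rw [ih]; noncomm_ring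
      _ = Y * X ^ (k + 1 + 1) + (X ^ (k + 1) * (H + 2 * (k + 1 : ℕ)) +
          ((k : R) + 1) * X ^ (k + 1) * (H + k)) := by
        rw [hXY, h2, ← h1, pow_succ' X (k + 1), add_mul, pow_succ' X k]
        noncomm_ring
      _ = _ := by
        have h3 : X ^ (k + 1) * ((k : R)) = k * X ^ (k + 1) := ((Nat.cast_commute k _).eq).symm
        push_cast
        have h4 : (k : R) * H = H * k := (Nat.cast_commute k H).eq
        have h5 : X ^ (k + 1) * (2 : R) = 2 * X ^ (k + 1) :=
          ((Nat.cast_commute 2 (X ^ (k+1))).eq).symm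
        generalize X ^ (k + 1) = P at *
        have e1 : P * (H + 2 * ((k : R) + 1)) = P * H + 2 * (k * P) + 2 * P := by
          rw [mul_add, ← mul_assoc, h5, mul_add, mul_assoc, h3, mul_one]; abel
        have e2 : ((k : R) + 1) * P * (H + k) = k * (P * H) + P * H + k * (k * P) + k * P := by
          rw [mul_add, mul_assoc, mul_assoc, h3]; noncomm_ring
        have e3 : ((k : R) + 1 + 1) * P * (H + ((k : R) + 1)) =
            k * (P * H) + 2 * (P * H) + k * (k * P) + k * P + 2 * (k * P) + 2 * P := by
          rw [mul_add, mul_add, mul_assoc, mul_assoc, h3]; noncomm_ring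
        rw [e1, e2, e3]
        noncomm_ring

/-- Weight vectors of positive weight lie in the image of the raising operator. -/
theorem exists_apply_eq_of_pos_weight {M : Type*} [AddCommGroup M] [Module ℝ M]
    {X Y H : Module.End ℝ M} (hXY : X * Y = Y * X + H) (hHX : H * X = X * H + 2 * X)
    (hHY : H * Y = Y * H - 2 * Y)
    {m : ℝ} (hm : 0 < m) (k : ℕ) : ∀ v : M, (X ^ k) v = 0 → H v = m • v → ∃ A, X A = v := by
  induction k with
  | zero => intro v hv _; exact ⟨0, by simpa using hv.symm⟩
  | succ k ih =>
    intro v hv hHv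
    have h1 := LinearMap.congr_fun (sl2_pow_mul hXY hHX k) v
    have hk : ∀ (j : ℕ) (w : M), (j : Module.End ℝ M) w = (j : ℝ) • w := fun j w => by
      rw [Module.End.natCast_apply, Nat.cast_smul_eq_nsmul]
    have h2 : ∀ w : M, (2 : Module.End ℝ M) w = (2 : ℝ) • w := fun w => hk 2 w
    simp only [Module.End.mul_apply, LinearMap.add_apply, hv, map_zero, hHv, hk, zero_add,
      ← add_smul, map_smul, Module.End.one_apply] at h1
    have h3 : (((k : Module.End ℝ M) + 1)) ((X ^ k) v) = ((k : ℝ) + 1) • (X ^ k) v := by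
      simp [hk, add_smul]
    obtain ⟨A', hA'⟩ := ih (X (Y v) - (((k : ℝ) + 1) * (m + k)) • v) (by
      rw [map_sub, ← Module.End.mul_apply, ← pow_succ, h1, map_smul]
      module) (by
      have e1 := LinearMap.congr_fun hHX (Y v)
      have e2 := LinearMap.congr_fun hHY v
      simp only [Module.End.mul_apply, LinearMap.add_apply, LinearMap.sub_apply, hHv, h2,
        map_smul] at e1 e2
      rw [map_sub, e1, e2, map_smul, hHv, map_sub, map_smul, map_smul]
      module)
    have hne : ((k : ℝ) + 1) * (m + k) ≠ 0 := by positivity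
    refine ⟨(((k : ℝ) + 1) * (m + k))⁻¹ • (Y v - A'), ?_⟩
    rw [map_smul, map_sub, hA', sub_sub_cancel, smul_smul, inv_mul_cancel₀ hne, one_smul]

theorem sum_abs_sub_eq {n : ℕ} (a b : Fin n → ℤ) {R : ℕ} (ha : ∀ i, |a i| ≤ R)
    (hb : ∀ i, |b i| ≤ R) :
    ∑ i, ∑ j, |a i - b j| = ∑ t ∈ Finset.Ico (-(R : ℤ)) R, ∑ i, ∑ j,
      ((if a i ≤ t then 1 else 0) - (if b j ≤ t then 1 else 0)) ^ 2 := by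
  rw [Finset.sum_comm]
  simp only [Finset.sum_comm (s := Finset.Ico (-(R : ℤ)) R)]
  rw [Finset.sum_comm]
  refine Finset.sum_congr rfl fun i _ => Finset.sum_congr rfl fun j _ => ?_
  have h : ∀ x y : ℤ, x ≤ y → |x| ≤ R → |y| ≤ R → |x - y| = ∑ t ∈ Finset.Ico (-(R : ℤ)) R,
      ((if x ≤ t then 1 else 0) - (if y ≤ t then 1 else 0)) ^ 2 := by
    intro x y hxy hx hy
    rw [abs_le] at hx hy
    have : ∀ t ∈ Finset.Ico (-(R : ℤ)) R, ((if x ≤ t then (1 : ℤ) else 0) -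
        (if y ≤ t then 1 else 0)) ^ 2 = if t ∈ Finset.Ico x y then 1 else 0 := by
      intro t _
      simp only [Finset.mem_Ico]
      split_ifs <;> omega
    rw [Finset.sum_congr rfl this, Finset.sum_ite_mem, Finset.inter_eq_right.2
      (Finset.Ico_subset_Ico hx.1 hy.2)]
    simp only [Finset.sum_const, Int.card_Ico]
    rw [abs_of_nonpos (by omega)]; simp; omega
  rcases le_total (a i) (b j) with hij | hij
  · exact h _ _ hij (ha i) (hb j)
  · rw [abs_sub_comm, h _ _ hij (hb j) (ha i)]
    exact Finset.sum_congr rfl fun t _ => by ring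

theorem sum_sum_indicator_sub_sq {n : ℕ} (a b : Fin n → ℤ) (t : ℤ) :
    ∑ i, ∑ j, ((if a i ≤ t then (1 : ℤ) else 0) - (if b j ≤ t then 1 else 0)) ^ 2 =
      n * (∑ i, if a i ≤ t then (1 : ℤ) else 0) + n * (∑ i, if b i ≤ t then (1 : ℤ) else 0) -
        2 * (∑ i, if a i ≤ t then (1 : ℤ) else 0) * (∑ i, if b i ≤ t then (1 : ℤ) else 0) := by
  have h : ∀ i j, ((if a i ≤ t then (1 : ℤ) else 0) - (if b j ≤ t then 1 else 0)) ^ 2 =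
      (if a i ≤ t then (1 : ℤ) else 0) + (if b j ≤ t then 1 else 0) -
        2 * ((if a i ≤ t then (1 : ℤ) else 0) * (if b j ≤ t then 1 else 0)) := by
    intro i j; split_ifs <;> norm_num
  simp only [h, Finset.sum_add_distrib, Finset.sum_sub_distrib, Finset.sum_const, Finset.card_univ,
    Fintype.card_fin, ← Finset.mul_sum, nsmul_eq_mul, ← Finset.sum_mul]
  ring

theorem weight_energy_lt {n : ℕ} (hn : 0 < n) (a b : Fin n → ℤ) :
    (∑ i, ∑ j, |a i - a j|) + (∑ i, ∑ j, |b i - b j|) <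
      2 * (∑ i, ∑ j, max (|a i - b j| - 2) 0) + 4 * (n : ℤ) ^ 2 := by
  obtain ⟨R, hR⟩ : ∃ R : ℕ, (∀ i, |a i| + 1 ≤ R) ∧ ∀ i, |b i| + 1 ≤ R := by
    refine ⟨(∑ i, |a i| + ∑ i, |b i| + 1).toNat, fun i => ?_, fun i => ?_⟩
    · have h1 := Finset.single_le_sum (f := fun i => |a i|) (fun _ _ => abs_nonneg _)
        (Finset.mem_univ i)
      have h2 : 0 ≤ ∑ i, |b i| := Finset.sum_nonneg fun _ _ => abs_nonneg _
      omega
    · have h1 := Finset.single_le_sum (f := fun i => |b i|) (fun _ _ => abs_nonneg _)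
        (Finset.mem_univ i)
      have h2 : 0 ≤ ∑ i, |a i| := Finset.sum_nonneg fun _ _ => abs_nonneg _
      omega
  have ha : ∀ i, |a i| ≤ R := fun i => by have := hR.1 i; omega
  have hb : ∀ i, |b i| ≤ R := fun i => by have := hR.2 i; omega
  let Na : ℤ → ℤ := fun t => ∑ i, if a i ≤ t then (1 : ℤ) else 0
  let Nb : ℤ → ℤ := fun t => ∑ i, if b i ≤ t then (1 : ℤ) else 0
  have key : 2 * (∑ i, ∑ j, |a i - b j|) - ((∑ i, ∑ j, |a i - a j|) + (∑ i, ∑ j, |b i - b j|)) =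
      ∑ t ∈ Finset.Ico (-(R : ℤ)) R, 2 * (Na t - Nb t) ^ 2 := by
    rw [sum_abs_sub_eq a b ha hb, sum_abs_sub_eq a a ha ha, sum_abs_sub_eq b b hb hb,
      Finset.mul_sum, ← Finset.sum_add_distrib, ← Finset.sum_sub_distrib]
    refine Finset.sum_congr rfl fun t _ => ?_
    rw [sum_sum_indicator_sub_sq, sum_sum_indicator_sub_sq, sum_sum_indicator_sub_sq]
    simp only [Na, Nb]; ring
  have hcard : ∑ i : Fin n, ∑ j : Fin n, (2 : ℤ) = 2 * (n : ℤ) ^ 2 := by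
    simp; ring
  have hmax : ∀ i j, |a i - b j| - 2 ≤ max (|a i - b j| - 2) 0 := fun i j => le_max_left _ _
  have hsum : (∑ i, ∑ j, |a i - b j|) - 2 * (n : ℤ) ^ 2 = ∑ i, ∑ j, (|a i - b j| - 2) := by
    rw [← hcard]; simp only [Finset.sum_sub_distrib]
  have hle : ∑ i, ∑ j, (|a i - b j| - 2) ≤ ∑ i, ∑ j, max (|a i - b j| - 2) 0 :=
    Finset.sum_le_sum fun i _ => Finset.sum_le_sum fun j _ => hmax i j
  have hnn : 0 ≤ ∑ t ∈ Finset.Ico (-(R : ℤ)) R, 2 * (Na t - Nb t) ^ 2 :=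
    Finset.sum_nonneg fun _ _ => by positivity
  by_cases hex : ∃ i j, |a i - b j| < 2
  · obtain ⟨i, j, hij⟩ := hex
    have hlt : ∑ i, ∑ j, (|a i - b j| - 2) < ∑ i, ∑ j, max (|a i - b j| - 2) 0 := by
      refine Finset.sum_lt_sum (fun i _ => Finset.sum_le_sum fun j _ => hmax i j)
        ⟨i, Finset.mem_univ _, Finset.sum_lt_sum (fun j _ => hmax i j) ⟨j, Finset.mem_univ _, ?_⟩⟩
      rw [max_eq_right (by omega)]; omega
    linarith
  · push Not at hex
    let i0 : Fin n := ⟨0, hn⟩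
    have hNb : Nb (a i0) = Nb (a i0 - 1) := by
      refine Finset.sum_congr rfl fun j _ => ?_
      have := hex i0 j
      have h0 : a i0 ≠ b j := fun h => by simp [h] at this
      congr 1
      rw [eq_iff_iff]; omega
    have hNa : Na (a i0 - 1) < Na (a i0) := by
      refine Finset.sum_lt_sum (fun j _ => ?_) ⟨i0, Finset.mem_univ _, by simp⟩
      split_ifs <;> omega
    have hex2 : ∃ t ∈ Finset.Ico (-(R : ℤ)) R, 0 < 2 * (Na t - Nb t) ^ 2 := by
      have hr := hR.1 i0
      have hr' := abs_le.1 (show |a i0| ≤ R - 1 by omega)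
      by_cases h : Na (a i0) = Nb (a i0)
      · refine ⟨a i0 - 1, Finset.mem_Ico.2 ⟨by omega, by omega⟩, ?_⟩
        have : Na (a i0 - 1) - Nb (a i0 - 1) ≠ 0 := by omega
        positivity
      · refine ⟨a i0, Finset.mem_Ico.2 ⟨by omega, by omega⟩, ?_⟩
        have : Na (a i0) - Nb (a i0) ≠ 0 := by omega
        positivity
    have hpos : 0 < ∑ t ∈ Finset.Ico (-(R : ℤ)) R, 2 * (Na t - Nb t) ^ 2 :=
      Finset.sum_pos' (fun _ _ => by positivity) hex2
    linarith

end

section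

theorem eq_zero_of_eq_neg_self {M : Type*} [AddCommGroup M] [Module ℝ M] {a : M} (h : a = -a) :
    a = 0 := by
  have : (2 : ℝ) • a = 0 := by rw [two_smul]; nth_rewrite 1 [h]; exact neg_add_cancel a
  exact (smul_eq_zero.1 this).resolve_left two_ne_zero

theorem fromBlocks_diag_of_commute {m : Type*} [Fintype m] [DecidableEq m]
    {P : Matrix (m ⊕ m) (m ⊕ m) ℝ}
    (h : fromBlocks 1 0 0 (-1) * P = P * fromBlocks 1 0 0 (-1)) :
    P = fromBlocks P.toBlocks₁₁ 0 0 P.toBlocks₂₂ := by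
  rw [← fromBlocks_toBlocks P] at h ⊢
  simp only [fromBlocks_multiply, fromBlocks_inj] at h
  simp only [toBlocks_fromBlocks₁₁, toBlocks_fromBlocks₂₂, fromBlocks_inj, true_and, and_true]
  simp only [one_mul, zero_mul, neg_mul, mul_one, mul_zero, mul_neg, zero_add, add_zero,
    true_and] at h
  exact ⟨eq_zero_of_eq_neg_self h.1, eq_zero_of_eq_neg_self h.2.1.symm⟩

theorem fromBlocks_offDiag_of_anticommute {m : Type*} [Fintype m] [DecidableEq m]
    {P : Matrix (m ⊕ m) (m ⊕ m) ℝ}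
    (h : P * fromBlocks 1 0 0 (-1) = -(fromBlocks 1 0 0 (-1) * P)) :
    P = fromBlocks 0 P.toBlocks₁₂ P.toBlocks₂₁ 0 := by
  rw [← fromBlocks_toBlocks P] at h ⊢
  simp only [fromBlocks_multiply, fromBlocks_inj, fromBlocks_neg] at h
  simp only [toBlocks_fromBlocks₁₂, toBlocks_fromBlocks₂₁, fromBlocks_inj, true_and]
  simp only [one_mul, zero_mul, neg_mul, mul_one, mul_zero, mul_neg, zero_add, add_zero,
    neg_neg] at h
  exact ⟨eq_zero_of_eq_neg_self h.1, eq_zero_of_eq_neg_self h.2.2.2.symm⟩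

theorem exists_sum_equiv_of_sum_eq_zero {n : ℕ} {ι : Type} [Fintype ι] (sg : ι → ℤ)
    (hsg : ∀ i, sg i = 1 ∨ sg i = -1) (hcard : Fintype.card ι = n + n) (h0 : ∑ i, sg i = 0) :
    ∃ σ : Fin n ⊕ Fin n ≃ ι, (∀ i, sg (σ (.inl i)) = 1) ∧ ∀ i, sg (σ (.inr i)) = -1 := by
  classical
  have h1 : ∑ i, sg i = Fintype.card {i // sg i = 1} - Fintype.card {i // ¬ sg i = 1} := by
    rw [Fintype.card_subtype, Fintype.card_subtype, Finset.card_filter, Finset.card_filter]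
    push_cast
    rw [← Finset.sum_sub_distrib]
    refine Finset.sum_congr rfl fun i _ => ?_
    rcases hsg i with h | h <;> simp [h]
  have h2 := Fintype.card_subtype_compl fun i => sg i = 1
  have h3 := Fintype.card_subtype_le fun i => sg i = 1
  have e1 : Fintype.card {i // sg i = 1} = n := by omega
  have e2 : Fintype.card {i // ¬ sg i = 1} = n := by omega
  refine ⟨(Equiv.sumCongr (Fintype.equivFinOfCardEq e1).symm
    (Fintype.equivFinOfCardEq e2).symm).trans (Equiv.sumCompl _), fun i => ?_, fun i => ?_⟩
  · simpa using ((Fintype.equivFinOfCardEq e1).symm i).2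
  · simpa using (hsg _).resolve_left ((Fintype.equivFinOfCardEq e2).symm i).2

/-- Every element of the nilpotent cone is conjugate to one whose associated odd matrix belongs to
an `sl₂`-triple with diagonal neutral element of integral weights. -/
theorem exists_conj_sl2_triple {n : ℕ} {x y : Matrix (Fin n) (Fin n) ℝ} (hxy : (x * y) ^ n = 0) :
    ∃ (g₁ g₂ : (Matrix (Fin n) (Fin n) ℝ)ˣ) (wt : Fin n ⊕ Fin n → ℤ)
      (f₁ f₂ : Matrix (Fin n) (Fin n) ℝ) (E F H : Matrix (Fin n ⊕ Fin n) (Fin n ⊕ Fin n) ℝ),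
      E = fromBlocks 0 (g₁.val * x * g₂⁻¹.val) (g₂.val * y * g₁⁻¹.val) 0 ∧
      F = fromBlocks 0 f₁ f₂ 0 ∧ H = diagonal (fun i => (wt i : ℝ)) ∧
      H * E = E * H + 2 * E ∧ H * F = F * H - 2 * F ∧ E * F = F * E + H ∧
      |∑ i, wt (.inl i) - ∑ i, wt (.inr i)| ≤ 2 * n := by
  let e0 : Matrix (Fin n ⊕ Fin n) (Fin n ⊕ Fin n) ℝ := fromBlocks 0 x y 0
  let ε0 : Matrix (Fin n ⊕ Fin n) (Fin n ⊕ Fin n) ℝ := fromBlocks 1 0 0 (-1)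
  have hεε : ε0 * ε0 = 1 := by simp [ε0, fromBlocks_multiply, fromBlocks_one]
  have hεe : ε0 * e0 = -(e0 * ε0) := by
    simp [ε0, e0, fromBlocks_multiply, fromBlocks_neg]
  have hnil : e0 ^ (2 * (n + 1)) = 0 := by
    have h1 : e0 ^ 2 = fromBlocks (x * y) 0 0 (y * x) := by
      simp [e0, pow_two, fromBlocks_multiply]
    have h2 : ∀ k, (fromBlocks (x * y) 0 0 (y * x)) ^ k =
        fromBlocks ((x * y) ^ k) 0 0 ((y * x) ^ k) := fun k => by
      induction k with
      | zero => simp [fromBlocks_one]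
      | succ k ih => simp [pow_succ, ih, fromBlocks_multiply]
    have h3 : ∀ k, (y * x) ^ (k + 1) = y * (x * y) ^ k * x := fun k => by
      induction k with
      | zero => simp
      | succ k ih => rw [pow_succ, ih, pow_succ]; simp only [mul_assoc]
    rw [pow_mul, h1, h2, h3, pow_succ, hxy]
    simp
  let Ψ := toLinAlgEquiv' (R := ℝ) (n := Fin n ⊕ Fin n)
  obtain ⟨h, f, ι, _, b, wt, sg, hhe, hhf, hef, hfε, hhb, hεb, hsg, hbd⟩ :=
    hasGradedTriple_of_isNilpotent (2 * n) (E := Fin n ⊕ Fin n → ℝ) (e := Ψ e0) (ε := Ψ ε0)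
      (by simp; ring) (by rw [← map_mul, hεε, map_one])
      (by rw [← map_mul, ← map_mul, hεe, map_neg]) ⟨2 * (n + 1), by
        rw [← map_pow, hnil, map_zero]⟩
  obtain ⟨hm, rfl⟩ := Ψ.surjective h
  obtain ⟨fm, rfl⟩ := Ψ.surjective f
  have hcard : Fintype.card ι = n + n := by
    rw [← Module.finrank_eq_card_basis b]; simp
  have htr : ∑ i, sg i = 0 := by
    have h1 : LinearMap.trace ℝ _ (Ψ ε0) = 0 := by
      have : LinearMap.trace ℝ _ (toLin' ε0) = 0 := by
        rw [trace_toLin'_eq]; simp [ε0, trace]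
      exact this
    classical
    rw [LinearMap.trace_eq_matrix_trace ℝ b, trace] at h1
    simp only [diag_apply, LinearMap.toMatrix_apply, hεb, map_smul, Module.Basis.repr_self,
      Finsupp.smul_apply, Finsupp.single_eq_same, smul_eq_mul, mul_one] at h1
    exact_mod_cast h1
  obtain ⟨σ, hσ1, hσ2⟩ := exists_sum_equiv_of_sum_eq_zero sg hsg hcard htr
  let b' := b.reindex σ.symm
  let P := (Pi.basisFun ℝ (Fin n ⊕ Fin n)).toMatrix b'
  let Q := b'.toMatrix (Pi.basisFun ℝ (Fin n ⊕ Fin n))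
  have hPQ : P * Q = 1 := Module.Basis.toMatrix_mul_toMatrix_flip _ _
  have hQP : Q * P = 1 := Module.Basis.toMatrix_mul_toMatrix_flip _ _
  have hcol : ∀ (A : Matrix (Fin n ⊕ Fin n) (Fin n ⊕ Fin n) ℝ) (c : Fin n ⊕ Fin n → ℝ),
      (∀ s, Ψ A (b (σ s)) = c s • b (σ s)) → A * P = P * diagonal c := by
    intro A c hA
    ext i j
    have h1 := congr_fun (hA j) i
    simp only [Ψ, toLinAlgEquiv'_apply, mulVec, dotProduct, Pi.smul_apply, smul_eq_mul] at h1
    rw [mul_diagonal, mul_apply]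
    simp only [P, b', Module.Basis.toMatrix_apply, Pi.basisFun_repr, Module.Basis.reindex_apply,
      Equiv.symm_symm]
    rw [h1, mul_comm]
  have hεP : ε0 * P = P * ε0 := by
    have : ε0 = diagonal (fun s => (sg (σ s) : ℝ)) := by
      ext (i | i) (j | j) <;> simp [ε0, diagonal_apply, one_apply, hσ1, hσ2, apply_ite]
    rw [hcol ε0 _ fun s => hεb _, ← this]
  have hεQ : ε0 * Q = Q * ε0 := by
    have : Q * (ε0 * P) * Q = Q * (P * ε0) * Q := by rw [hεP]
    rw [mul_assoc, mul_assoc ε0, hPQ, mul_one, ← mul_assoc Q, hQP, one_mul] at this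
    exact this.symm
  have hP := fromBlocks_diag_of_commute hεP
  have hQ := fromBlocks_diag_of_commute hεQ
  rw [hP, hQ, fromBlocks_multiply, ← fromBlocks_one, fromBlocks_inj] at hPQ hQP
  have hPQ1 : P.toBlocks₁₁ * Q.toBlocks₁₁ = 1 := by simpa using hPQ.1
  have hPQ2 : P.toBlocks₂₂ * Q.toBlocks₂₂ = 1 := by simpa using hPQ.2.2.2
  have hQP1 : Q.toBlocks₁₁ * P.toBlocks₁₁ = 1 := by simpa using hQP.1
  have hQP2 : Q.toBlocks₂₂ * P.toBlocks₂₂ = 1 := by simpa using hQP.2.2.2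
  have hPQ : P * Q = 1 := Module.Basis.toMatrix_mul_toMatrix_flip _ _
  have hQP : Q * P = 1 := Module.Basis.toMatrix_mul_toMatrix_flip _ _
  have hhP : hm * P = P * diagonal (fun s => (wt (σ s) : ℝ)) := hcol _ _ fun s => hhb _
  have hH : Q * hm * P = diagonal (fun s => (wt (σ s) : ℝ)) := by
    rw [mul_assoc, hhP, ← mul_assoc, hQP, one_mul]
  have hconj : ∀ A B : Matrix (Fin n ⊕ Fin n) (Fin n ⊕ Fin n) ℝ,
      (Q * A * P) * (Q * B * P) = Q * (A * B) * P := fun A B => by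
    calc _ = Q * A * (P * Q) * B * P := by simp only [mul_assoc]
      _ = _ := by rw [hPQ, mul_one]; simp only [mul_assoc]
  have hfm : fm * ε0 = -(ε0 * fm) := Ψ.injective (by rw [map_neg, map_mul, map_mul, hfε])
  have hhe' : hm * e0 = e0 * hm + 2 * e0 := Ψ.injective (by
    rw [map_add, map_mul, map_mul, map_mul, map_ofNat, ← sub_eq_iff_eq_add', hhe, two_smul,
      two_mul])
  have hhf' : hm * fm = fm * hm - 2 * fm := Ψ.injective (by
    rw [map_sub, map_mul, map_mul, map_mul, map_ofNat, two_mul, ← two_smul ℕ, sub_eq_add_neg, ← hhf]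
    abel)
  have hef' : e0 * fm = fm * e0 + hm := Ψ.injective (by
    rw [map_add, map_mul, map_mul, ← hef]; abel)
  have hQfP : (Q * fm * P) * ε0 = -(ε0 * (Q * fm * P)) := by
    rw [mul_assoc, ← hεP, ← mul_assoc, mul_assoc Q, hfm, ← mul_assoc, ← mul_assoc, hεQ]
    simp only [mul_neg, neg_mul, mul_assoc]
  have hdist : ∀ A : Matrix (Fin n ⊕ Fin n) (Fin n ⊕ Fin n) ℝ,
      Q * (2 * A) * P = 2 * (Q * A * P) := fun A => by
    rw [two_mul, two_mul, mul_add, add_mul]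
  refine ⟨⟨Q.toBlocks₁₁, P.toBlocks₁₁, hQP1, hPQ1⟩, ⟨Q.toBlocks₂₂, P.toBlocks₂₂, hQP2, hPQ2⟩,
    fun s => wt (σ s), _, _, Q * e0 * P, Q * fm * P, Q * hm * P, ?_,
    fromBlocks_offDiag_of_anticommute hQfP, hH, ?_, ?_, ?_, ?_⟩
  · simp only [Units.inv_mk]
    conv_lhs => rw [hP, hQ]
    simp [e0, fromBlocks_multiply]
  · rw [hconj, hconj, hhe', mul_add, add_mul, hdist]
  · rw [hconj, hconj, hhf', mul_sub, sub_mul, hdist]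
  · rw [hconj, hconj, hef', mul_add, add_mul]
  · rw [← σ.sum_comp, Fintype.sum_sum_type] at hbd
    simp only [hσ1, hσ2, hcard, one_mul, neg_mul, Finset.sum_neg_distrib, ← sub_eq_add_neg] at hbd
    push_cast at hbd
    linarith
end

section

/-- A basis of the target of a linear map, assembled from images of basis vectors of the source
and from basis vectors of the target. -/
theorem exists_basis_range_compl {S : Type} [Fintype S] {K V : Type*} [AddCommGroup K] [Module ℝ K]
    [AddCommGroup V] [Module ℝ V] (cK : Module.Basis S ℝ K) (cV : Module.Basis S ℝ V)
    (A : K →ₗ[ℝ] V) :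
    ∃ (I J : Type) (_ : Fintype I) (_ : Fintype J) (i : I → S) (j : J → S)
      (b : Module.Basis (I ⊕ J) ℝ V), Function.Injective i ∧ (∀ a, b (.inl a) = A (cK (i a))) ∧
      (∀ a, b (.inr a) = cV (j a)) ∧ (∀ a, cV (j a) ∉ LinearMap.range A) ∧
      Module.finrank ℝ (LinearMap.range A) ≤ Fintype.card I := by
  classical
  obtain ⟨I, i, hi, hIsp, hI⟩ := exists_linearIndependent' ℝ (fun s => A (cK s))
  obtain ⟨J, j, hj, hJsp, hJ⟩ := exists_linearIndependent' ℝ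
    (fun s => (LinearMap.range A).mkQ (cV s))
  have : Fintype I := Fintype.ofInjective i hi
  have : Fintype J := Fintype.ofInjective j hj
  have hrange : Submodule.span ℝ (Set.range ((fun s => A (cK s)) ∘ i)) = LinearMap.range A := by
    rw [hIsp, show (fun s => A (cK s)) = A ∘ cK from rfl, Set.range_comp, Submodule.span_image,
      cK.span_eq, Submodule.map_top]
  have hdisj : ∀ w ∈ Submodule.span ℝ (Set.range (cV ∘ j)), w ∈ LinearMap.range A → w = 0 := by
    intro w hw hwA
    obtain ⟨g, rfl⟩ := (Submodule.mem_span_range_iff_exists_fun ℝ).1 hw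
    have h1 : ∑ a, g a • (LinearMap.range A).mkQ (cV (j a)) = 0 := by
      have := (Submodule.Quotient.mk_eq_zero (LinearMap.range A)).2 hwA
      rw [← Submodule.mkQ_apply, map_sum] at this
      simpa only [map_smul, Function.comp_apply] using this
    have h2 := Fintype.linearIndependent_iff.1 hJ g h1
    simp [h2]
  have hlin : LinearIndependent ℝ (Sum.elim ((fun s => A (cK s)) ∘ i) (cV ∘ j)) := by
    refine hI.sum_type (LinearIndependent.of_comp (LinearMap.range A).mkQ hJ) ?_
    rw [hrange, Submodule.disjoint_def]
    exact fun x hx hx' => hdisj x hx' hx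
  have hspan : ⊤ ≤ Submodule.span ℝ (Set.range (Sum.elim ((fun s => A (cK s)) ∘ i) (cV ∘ j))) := by
    intro v _
    have h1 : (LinearMap.range A).mkQ v ∈
        Submodule.span ℝ (Set.range ((fun s => (LinearMap.range A).mkQ (cV s)) ∘ j)) := by
      rw [hJsp, show (fun s => (LinearMap.range A).mkQ (cV s)) = (LinearMap.range A).mkQ ∘ cV
        from rfl, Set.range_comp, Submodule.span_image, cV.span_eq]
      exact Submodule.mem_map_of_mem trivial
    rw [show (fun s => (LinearMap.range A).mkQ (cV s)) ∘ j = (LinearMap.range A).mkQ ∘ (cV ∘ j)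
      from rfl, Set.range_comp, Submodule.span_image] at h1
    obtain ⟨w, hw, hwv⟩ := h1
    have h2 : v - w ∈ LinearMap.range A := by
      rw [← (LinearMap.range A).ker_mkQ, LinearMap.mem_ker, map_sub, hwv, sub_self]
    rw [Set.Sum.elim_range, Submodule.span_union, hrange]
    rw [← sub_add_cancel v w]
    exact Submodule.add_mem_sup h2 hw
  refine ⟨I, J, inferInstance, inferInstance, i, j, Module.Basis.mk hlin hspan, hi,
    fun a => by simp, fun a => by simp, fun a ha => ?_, ?_⟩
  · have h1 := hJ.ne_zero a
    refine h1 ?_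
    simpa using ha
  · rw [← hrange]; exact finrank_range_le_card _

/-- The trace identity comparing weights of an adapted basis with the ambient weights. -/
theorem sum_weights_of_adapted_basis {S I J : Type} [Fintype S] [Fintype I] [Fintype J]
    {V : Type*} [AddCommGroup V] [Module ℝ V] (c : Module.Basis S ℝ V)
    (b : Module.Basis (I ⊕ J) ℝ V) (wt : S → ℤ) (D : V →ₗ[ℝ] V)
    (hD : ∀ s, D (c s) = (wt s : ℝ) • c s) (μ : I ⊕ J → ℤ) (hb : ∀ a, D (b a) = (μ a : ℝ) • b a)
    (φ : ℤ → ℤ) : ∑ s, φ (wt s) = ∑ a, φ (μ a) := by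
  classical
  let Dφ : V →ₗ[ℝ] V := c.constr ℝ (fun s => (φ (wt s) : ℝ) • c s)
  have hDφ : ∀ s, Dφ (c s) = (φ (wt s) : ℝ) • c s := fun s => c.constr_basis ℝ _ s
  have hrepr : ∀ (m : ℤ) v, D v = (m : ℝ) • v → Dφ v = (φ m : ℝ) • v := by
    intro m v hv
    have h1 : ∀ s, (wt s : ℝ) * c.repr v s = m * c.repr v s := by
      intro s
      have h2 : D v = ∑ t, c.repr v t • ((wt t : ℝ) • c t) := by
        conv_lhs => rw [← c.sum_repr v]
        simp only [map_sum, map_smul, hD]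
      have h3 := congr_arg (fun w => c.repr w s) (h2.symm.trans hv)
      simpa [Finsupp.single_apply, mul_comm] using h3
    have h4 : Dφ v = ∑ t, c.repr v t • ((φ (wt t) : ℝ) • c t) := by
      conv_lhs => rw [← c.sum_repr v]
      simp only [map_sum, map_smul, hDφ]
    rw [h4]
    conv_rhs => rw [← c.sum_repr v]
    rw [Finset.smul_sum]
    refine Finset.sum_congr rfl fun s _ => ?_
    rcases eq_or_ne (c.repr v s) 0 with h0 | h0
    · simp [h0]
    · have : wt s = m := by exact_mod_cast mul_right_cancel₀ h0 (h1 s)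
      rw [this, smul_comm]
  have htr : ∀ {ι : Type} [Fintype ι] (e : Module.Basis ι ℝ V) (ν : ι → ℤ),
      (∀ a, Dφ (e a) = (ν a : ℝ) • e a) → LinearMap.trace ℝ V Dφ = ((∑ a, ν a : ℤ) : ℝ) := by
    intro ι _ e ν he
    rw [LinearMap.trace_eq_matrix_trace ℝ e, trace]
    simp [LinearMap.toMatrix_apply, he]
  have h1 := htr c _ hDφ
  rw [htr b (fun a => φ (μ a)) fun a => hrepr _ _ (hb a)] at h1
  exact_mod_cast h1.symm

end

section

/-- Pairs of square matrices. -/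
abbrev MatPair (n : ℕ) := Matrix (Fin n) (Fin n) ℝ × Matrix (Fin n) (Fin n) ℝ

/-- The infinitesimal action of `𝔤𝔩ₙ × 𝔤𝔩ₙ` on pairs of matrices. -/
noncomputable def infAct (n : ℕ) : MatPair n →ₗ[ℝ] MatPair n →ₗ[ℝ] MatPair n :=
  LinearMap.mk₂ ℝ (fun A p => (A.1 * p.1 - p.1 * A.2, A.2 * p.2 - p.2 * A.1))
    (fun A B p => by ext <;> simp [add_mul, mul_add] <;> ring)
    (fun c A p => by ext <;> simp [mul_sub])
    (fun A p q => by ext <;> simp [add_mul, mul_add] <;> ring)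
    (fun c A p => by ext <;> simp [mul_sub])

theorem infAct_apply {n : ℕ} (A p : MatPair n) :
    infAct n A p = (A.1 * p.1 - p.1 * A.2, A.2 * p.2 - p.2 * A.1) := rfl

/-- Data of a weight basis of the space of pairs of matrices adapted to the orbit of `e`. -/
structure AdaptedBasis {n : ℕ} (e : MatPair n) (I J : Type) [Fintype I] [Fintype J] where
  h : MatPair n
  r : ℤ
  κ : I → MatPair n
  b : Module.Basis (I ⊕ J) ℝ (MatPair n)
  β : I → ℤ
  w : J → ℤ
  b_inl : ∀ i, b (.inl i) = infAct n (κ i) e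
  h_mul_κ : ∀ i, h * κ i = κ i * h + (β i : ℝ) • κ i
  infAct_h_inr : ∀ j, infAct n h (b (.inr j)) = (w j + 2 : ℝ) • b (.inr j)
  infAct_h_e : infAct n h e = (2 : ℝ) • e
  w_neg : ∀ j, w j < 0
  sum_β : -(2 * (n : ℤ) ^ 2) < ∑ i, β i
  finrank_le : Module.finrank ℝ (LinearMap.range ((infAct n).flip e)) ≤ Fintype.card I
  trace_fst : h.1.trace = r
  trace_snd : h.2.trace = -r
  abs_r : |r| ≤ n

theorem exists_infAct_eq_of_pos_weight {n : ℕ} {e : MatPair n} {wt : Fin n ⊕ Fin n → ℤ}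
    {E F : Matrix (Fin n ⊕ Fin n) (Fin n ⊕ Fin n) ℝ} (hE : E = fromBlocks 0 e.1 e.2 0)
    (hHE : diagonal (fun i => (wt i : ℝ)) * E = E * diagonal (fun i => (wt i : ℝ)) + 2 * E)
    (hHF : diagonal (fun i => (wt i : ℝ)) * F = F * diagonal (fun i => (wt i : ℝ)) - 2 * F)
    (hEF : E * F = F * E + diagonal (fun i => (wt i : ℝ))) (v : MatPair n) (m : ℤ) (hm : 0 < m)
    (hv : infAct n (diagonal fun i => (wt (.inl i) : ℝ), diagonal fun i => (wt (.inr i) : ℝ)) v =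
      (m : ℝ) • v) : ∃ A, infAct n A e = v := by
  set H := diagonal (fun i => (wt i : ℝ)) with hH
  let ad := LinearMap.mul ℝ (Matrix (Fin n ⊕ Fin n) (Fin n ⊕ Fin n) ℝ) -
    (LinearMap.mul ℝ (Matrix (Fin n ⊕ Fin n) (Fin n ⊕ Fin n) ℝ)).flip
  have had_apply : ∀ A B, ad A B = A * B - B * A := fun A B => rfl
  have had : ∀ A B C, A * B - B * A = C → ad A * ad B - ad B * ad A = ad C := fun A B C h => by
    refine LinearMap.ext fun P => ?_
    simp only [← h, LinearMap.sub_apply, Module.End.mul_apply, had_apply]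
    noncomm_ring
  have had2 : ∀ A, ad (2 * A) = 2 * ad A := fun A => by
    rw [two_mul, two_mul, map_add]
  have h1 : ad E * ad F = ad F * ad E + ad H := by
    rw [← had E F H (by rw [hEF]; abel)]; abel
  have h2 : ad H * ad E = ad E * ad H + 2 * ad E := by
    rw [← had2, ← had H E (2 * E) (by rw [hHE]; abel)]; abel
  have h3 : ad H * ad F = ad F * ad H - 2 * ad F := by
    rw [← had2, ← had F H (2 * F) (by rw [hHF]; abel)]; abel
  let P := fromBlocks 0 v.1 v.2 0
  have hHb : H = fromBlocks (diagonal fun i => (wt (.inl i) : ℝ)) 0 0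
      (diagonal fun i => (wt (.inr i) : ℝ)) := by
    rw [hH, fromBlocks_diagonal]; congr 1; ext (i | i) <;> rfl
  have hP : ad H P = (m : ℝ) • P := by
    rw [infAct_apply, Prod.ext_iff] at hv
    simp only [Prod.smul_fst, Prod.smul_snd] at hv
    rw [had_apply, hHb]
    simp only [P, fromBlocks_multiply, fromBlocks_smul, ← hv.1, ← hv.2, sub_eq_add_neg,
      fromBlocks_neg, fromBlocks_add]
    simp
  have hweight : ∀ k : ℕ, ad H ((ad E ^ k) P) = ((m : ℝ) + 2 * k) • (ad E ^ k) P := by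
    intro k
    have := LinearMap.congr_fun (sl2_mul_pow h2 k) P
    rw [Module.End.mul_apply] at this
    rw [this, Module.End.mul_apply, LinearMap.add_apply, map_add, hP, map_smul, add_smul]
    congr 1
    rw [show (2 * (k : Module.End ℝ (Matrix (Fin n ⊕ Fin n) (Fin n ⊕ Fin n) ℝ))) =
      ((2 * k : ℕ) : Module.End ℝ _) by push_cast; rfl, Module.End.natCast_apply,
      ← Nat.cast_smul_eq_nsmul ℝ, map_smul]
    push_cast; rfl
  obtain ⟨k, hk⟩ : ∃ k : ℕ, ∀ i j, wt i - wt j < 2 * k := by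
    refine ⟨(∑ i, ∑ j, |wt i - wt j|).toNat + 1, fun i j => ?_⟩
    have e1 := Finset.single_le_sum (f := fun i => ∑ j, |wt i - wt j|)
      (fun _ _ => Finset.sum_nonneg fun _ _ => abs_nonneg _) (Finset.mem_univ i)
    have e2 := Finset.single_le_sum (f := fun j => |wt i - wt j|)
      (fun _ _ => abs_nonneg _) (Finset.mem_univ j)
    have e3 := le_abs_self (wt i - wt j)
    omega
  have hnil : (ad E ^ k) P = 0 := by
    ext i j
    have h5 := congr_fun (congr_fun (hweight k) i) j
    rw [had_apply, hH, Matrix.sub_apply, diagonal_mul, mul_diagonal, Matrix.smul_apply,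
      smul_eq_mul] at h5
    have h6 : ((m : ℝ) + 2 * k - wt i + wt j) * ((ad E ^ k) P) i j = 0 := by linarith
    refine (mul_eq_zero.1 h6).resolve_left fun h7 => ?_
    have h8 : m + 2 * k - wt i + wt j = 0 := by exact_mod_cast h7
    have := hk i j
    omega
  obtain ⟨A, hA⟩ := exists_apply_eq_of_pos_weight (m := (m : ℝ)) h1 h2 h3
    (by exact_mod_cast hm) k P hnil hP
  rw [had_apply, hE, ← fromBlocks_toBlocks A, fromBlocks_multiply,
    fromBlocks_multiply, sub_eq_add_neg, fromBlocks_neg, fromBlocks_add, fromBlocks_inj] at hA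
  refine ⟨(-A.toBlocks₁₁, -A.toBlocks₂₂), ?_⟩
  rw [infAct_apply]
  refine Prod.ext ?_ ?_
  · rw [← hA.2.1]; simp; abel
  · rw [← hA.2.2.1]; simp; abel

/-- The standard basis of pairs of matrices. -/
noncomputable def pairBasis (n : ℕ) :
    Module.Basis ((Fin n × Fin n) ⊕ (Fin n × Fin n)) ℝ (MatPair n) :=
  (Matrix.stdBasis ℝ (Fin n) (Fin n)).prod (Matrix.stdBasis ℝ (Fin n) (Fin n))

theorem pairBasis_inl {n : ℕ} (s : Fin n × Fin n) :
    pairBasis n (.inl s) = (single s.1 s.2 1, 0) := by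
  rw [pairBasis, Module.Basis.prod_apply]; simp [stdBasis_eq_single _ s.1 s.2]

theorem pairBasis_inr {n : ℕ} (s : Fin n × Fin n) :
    pairBasis n (.inr s) = (0, single s.1 s.2 1) := by
  rw [pairBasis, Module.Basis.prod_apply]; simp [stdBasis_eq_single _ s.1 s.2]

theorem diagonal_mul_single_sub {n : ℕ} (a b : Fin n → ℝ) (i j : Fin n) :
    diagonal a * single i j (1 : ℝ) - single i j 1 * diagonal b = (a i - b j) • single i j 1 := by
  ext k l
  rw [Matrix.sub_apply, diagonal_mul, mul_diagonal, Matrix.smul_apply, single_apply]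
  split_ifs with h
  · rw [h.1, h.2]; simp
  · simp

theorem sum_max_sub_two {n : ℕ} (a b : Fin n → ℤ) :
    ∑ s : (Fin n × Fin n) ⊕ (Fin n × Fin n), max (Sum.elim (fun s => a s.1 - b s.2)
      (fun s => b s.1 - a s.2) s - 2) 0 = ∑ i, ∑ j, max (|a i - b j| - 2) 0 := by
  rw [Fintype.sum_sum_type, Fintype.sum_prod_type, Fintype.sum_prod_type_right]
  simp only [Sum.elim_inl, Sum.elim_inr]
  rw [← Finset.sum_add_distrib]
  refine Finset.sum_congr rfl fun i _ => ?_
  rw [← Finset.sum_add_distrib]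
  refine Finset.sum_congr rfl fun j _ => ?_
  grind

theorem sum_max_neg {n : ℕ} (a : Fin n → ℤ) :
    2 * ∑ s : Fin n × Fin n, max (-(a s.1 - a s.2)) 0 = ∑ i, ∑ j, |a i - a j| := by
  have h : ∑ s : Fin n × Fin n, max (-(a s.1 - a s.2)) 0 = ∑ i, ∑ j, max (-(a j - a i)) 0 := by
    rw [Fintype.sum_prod_type_right]
  rw [two_mul]
  nth_rewrite 1 [h]
  rw [Fintype.sum_prod_type, ← Finset.sum_add_distrib]
  refine Finset.sum_congr rfl fun i _ => ?_
  rw [← Finset.sum_add_distrib]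
  refine Finset.sum_congr rfl fun j _ => ?_
  grind

/-- An element of an `sl₂`-triple in normal form admits an adapted basis. -/
theorem exists_adaptedBasis {n : ℕ} (hn : 0 < n) {e : MatPair n} {wt : Fin n ⊕ Fin n → ℤ}
    {E F H : Matrix (Fin n ⊕ Fin n) (Fin n ⊕ Fin n) ℝ} (hE : E = fromBlocks 0 e.1 e.2 0)
    (hH : H = diagonal (fun i => (wt i : ℝ)))
    (hHE : H * E = E * H + 2 * E) (hHF : H * F = F * H - 2 * F) (hEF : E * F = F * E + H)
    (hbd : |∑ i, wt (.inl i) - ∑ i, wt (.inr i)| ≤ 2 * n) :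
    ∃ (I J : Type) (_ : Fintype I) (_ : Fintype J), Nonempty (AdaptedBasis e I J) := by
  have hHb : H = fromBlocks (diagonal fun i => (wt (.inl i) : ℝ)) 0 0
      (diagonal fun i => (wt (.inr i) : ℝ)) := by
    rw [hH, fromBlocks_diagonal]; congr 1; ext (i | i) <;> rfl
  have htr : ∑ i, wt (.inl i) + ∑ i, wt (.inr i) = 0 := by
    have h1 : H.trace = 0 := by
      have : H = E * F - F * E := by rw [hEF]; abel
      rw [this, trace_sub, trace_mul_comm, sub_self]
    rw [hH, trace, Fintype.sum_sum_type] at h1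
    simp only [diag_apply, diagonal_apply_eq] at h1
    exact_mod_cast h1
  let h : MatPair n := (diagonal fun i => (wt (.inl i) : ℝ), diagonal fun i => (wt (.inr i) : ℝ))
  have hhe : infAct n h e = (2 : ℝ) • e := by
    have h1 : H * E - E * H = 2 * E := by rw [hHE]; abel
    rw [two_mul, hE, hHb, fromBlocks_multiply, fromBlocks_multiply, sub_eq_add_neg, fromBlocks_neg,
      fromBlocks_add, fromBlocks_add, fromBlocks_inj] at h1
    rw [infAct_apply, two_smul]
    refine Prod.ext ?_ ?_
    · simpa [sub_eq_add_neg] using h1.2.1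
    · simpa [sub_eq_add_neg] using h1.2.2.1
  let wK : (Fin n × Fin n) ⊕ (Fin n × Fin n) → ℤ := Sum.elim
    (fun s => wt (.inl s.1) - wt (.inl s.2)) (fun s => wt (.inr s.1) - wt (.inr s.2))
  let wV : (Fin n × Fin n) ⊕ (Fin n × Fin n) → ℤ := Sum.elim
    (fun s => wt (.inl s.1) - wt (.inr s.2)) (fun s => wt (.inr s.1) - wt (.inl s.2))
  have hwV : ∀ s, infAct n h (pairBasis n s) = (wV s : ℝ) • pairBasis n s := by
    rintro (s | s)
    · rw [pairBasis_inl, infAct_apply]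
      simp [h, wV, diagonal_mul_single_sub]
    · rw [pairBasis_inr, infAct_apply]
      simp [h, wV, diagonal_mul_single_sub]
  have hwK : ∀ s, h * pairBasis n s = pairBasis n s * h + (wK s : ℝ) • pairBasis n s := by
    intro s
    rw [← sub_eq_iff_eq_add']
    rcases s with s | s
    · rw [pairBasis_inl]
      simp [h, wK, diagonal_mul_single_sub]
    · rw [pairBasis_inr]
      simp [h, wK, diagonal_mul_single_sub]
  have hbr : ∀ (A : MatPair n) (m : ℝ), h * A = A * h + m • A →
      infAct n h (infAct n A e) = (m + 2) • infAct n A e := by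
    intro A m hA
    have h1 : infAct n h (infAct n A e) =
        infAct n (h * A - A * h) e + infAct n A (infAct n h e) := by
      simp only [infAct_apply, Prod.fst_sub, Prod.snd_sub, Prod.fst_mul, Prod.snd_mul]
      refine Prod.ext ?_ ?_ <;> simp only [Prod.mk_add_mk] <;> noncomm_ring
    rw [h1, hA, hhe, add_sub_cancel_left, map_smul, map_smul, add_smul]; rfl
  obtain ⟨I, J, _, _, i, j, b, hi, hbI, hbJ, hJ, hfr⟩ :=
    exists_basis_range_compl (pairBasis n) (pairBasis n) ((infAct n).flip e)
  have hwJ : ∀ a, wV (j a) ≤ 0 := by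
    intro a
    by_contra! hlt
    obtain ⟨A, hA⟩ := exists_infAct_eq_of_pos_weight hE (hH ▸ hHE) (hH ▸ hHF) (hH ▸ hEF)
      (pairBasis n (j a)) (wV (j a)) hlt (hwV _)
    exact hJ a ⟨A, hA⟩
  have hbI' : ∀ a, b (.inl a) = infAct n (pairBasis n (i a)) e := hbI
  refine ⟨I, J, inferInstance, inferInstance, ⟨{
    h := h
    r := ∑ i, wt (.inl i)
    κ := fun a => pairBasis n (i a)
    b := b
    β := fun a => wK (i a)
    w := fun a => wV (j a) - 2
    b_inl := hbI'
    h_mul_κ := fun a => hwK _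
    infAct_h_inr := fun a => by rw [hbJ, hwV]; push_cast; rw [sub_add_cancel]
    infAct_h_e := hhe
    w_neg := fun a => by have := hwJ a; omega
    sum_β := ?_
    finrank_le := hfr
    trace_fst := by simp [h, trace]
    trace_snd := by
      have : (∑ i, (wt (.inl i) : ℝ)) + ∑ i, (wt (.inr i) : ℝ) = 0 := by exact_mod_cast htr
      simp only [h, trace, diag_apply, diagonal_apply_eq]
      push_cast; linarith
    abs_r := by
      rw [abs_le] at hbd ⊢
      constructor <;> linarith }⟩⟩
  have hsum := sum_weights_of_adapted_basis (pairBasis n) b wV (infAct n h) hwV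
    (Sum.elim (fun a => wK (i a) + 2) (fun a => wV (j a))) (by
      rintro (a | a)
      · rw [hbI', hbr _ _ (hwK _)]; simp
      · rw [hbJ, hwV]; simp) (fun m => max (m - 2) 0)
  replace hsum := (sum_max_sub_two (fun i => wt (.inl i)) fun i => wt (.inr i)).symm.trans hsum
  rw [Fintype.sum_sum_type] at hsum
  simp only [Sum.elim_inl, Sum.elim_inr, add_sub_cancel_right] at hsum
  have hz : ∑ a, max (wV (j a) - 2) 0 = 0 := Finset.sum_eq_zero fun a _ => by
    have := hwJ a; omega
  rw [hz, add_zero] at hsum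
  have hneg : ∑ a, max (-(wK (i a))) 0 ≤ ∑ s, max (-(wK s)) 0 := by
    classical
    rw [← Finset.sum_image (f := fun s => max (-(wK s)) 0) (s := Finset.univ)
      fun x _ y _ hxy => hi hxy]
    exact Finset.sum_le_sum_of_subset_of_nonneg (Finset.subset_univ _)
      fun _ _ _ => le_max_right _ _
  have hK : 2 * ∑ s, max (-(wK s)) 0 = (∑ i, ∑ j, |wt (.inl i) - wt (.inl j)|) +
      ∑ i, ∑ j, |wt (.inr i) - wt (.inr j)| := by
    rw [← sum_max_neg (fun i => wt (.inl i)), ← sum_max_neg (fun i => wt (.inr i)),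
      Fintype.sum_sum_type, mul_add]
    rfl
  have hdec : ∑ a, wK (i a) = ∑ a, max (wK (i a)) 0 - ∑ a, max (-(wK (i a))) 0 := by
    rw [← Finset.sum_sub_distrib]
    exact Finset.sum_congr rfl fun a _ => by omega
  have hlt := weight_energy_lt hn (fun i => wt (.inl i)) (fun i => wt (.inr i))
  rw [hdec]
  linarith

end

section

theorem exists_contDiff_eventuallyEq {V W : Type*} [NormedAddCommGroup V] [NormedSpace ℝ V]
    [FiniteDimensional ℝ V] [NormedAddCommGroup W] [NormedSpace ℝ W] {f : V → W} {e : V}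
    (hf : ContDiffAt ℝ ω f e) : ∃ g, ContDiff ℝ ∞ g ∧ g =ᶠ[𝓝 e] f := by
  obtain ⟨r, hr, hball⟩ := Metric.eventually_nhds_iff_ball.1 (hf.eventually (by simp))
  let φ : ContDiffBump e := ⟨r / 3, r / 2, by positivity, by linarith⟩
  refine ⟨fun x => φ x • f x, contDiff_iff_contDiffAt.2 fun x => ?_, ?_⟩
  · by_cases hx : x ∈ Metric.ball e r
    · exact φ.contDiffAt.smul ((hball x hx).of_le le_top)
    · have : x ∉ tsupport φ := fun h => hx (by
        rw [φ.tsupport_eq] at h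
        exact Metric.closedBall_subset_ball (show r / 2 < r by linarith) h)
      refine (contDiffAt_const (c := (0 : W))).congr_of_eventuallyEq ?_
      filter_upwards [notMem_tsupport_iff_eventuallyEq.1 this] with y hy
      rw [hy]; simp
  · filter_upwards [φ.eventuallyEq_one] with y hy
    rw [hy]; simp

/-- Smooth implicit functions, extended to the whole space. -/
theorem exists_contDiff_implicit {V W : Type*} [NormedAddCommGroup V] [NormedSpace ℝ V]
    [FiniteDimensional ℝ V] [NormedAddCommGroup W] [NormedSpace ℝ W] [FiniteDimensional ℝ W]
    {F : V × W → V} (hF : ContDiff ℝ ω F) {e : V} (he : F (e, 0) = 0)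
    (hbij : Function.Bijective fun w : W => fderiv ℝ F (e, 0) (0, w)) :
    ∃ u : V → W, ContDiff ℝ ∞ u ∧ u e = 0 ∧ ∀ᶠ x in 𝓝 e, F (x, u x) = 0 ∧
      ∀ X w, fderiv ℝ F (x, u x) (X, w) = 0 → fderiv ℝ u x X = w := by
  have : CompleteSpace V := FiniteDimensional.complete ℝ V
  have : CompleteSpace W := FiniteDimensional.complete ℝ W
  let G : V × W → V × V := fun p => (p.1, F p)
  have hG : ContDiff ℝ ω G := contDiff_fst.prodMk hF
  have hdF : ∀ p, HasFDerivAt F (fderiv ℝ F p) p := fun p =>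
    (hF.differentiable (by simp)).differentiableAt.hasFDerivAt
  let L : V × W →L[ℝ] V × V := (ContinuousLinearMap.fst ℝ V W).prod (fderiv ℝ F (e, 0))
  have hsplit : ∀ p X w, fderiv ℝ F p (X, w) = fderiv ℝ F p (X, 0) + fderiv ℝ F p (0, w) :=
    fun p X w => by rw [← map_add]; simp
  have hLbij : Function.Bijective L.toLinearMap := by
    constructor
    · rw [← LinearMap.ker_eq_bot, LinearMap.ker_eq_bot']
      rintro ⟨X, w⟩ h
      have h1 : X = 0 := congr_arg Prod.fst h
      have h2 : fderiv ℝ F (e, 0) (X, w) = 0 := congr_arg Prod.snd h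
      rw [h1] at h2 ⊢
      rw [hbij.1 (a₁ := w) (a₂ := 0) (by
        change fderiv ℝ F (e, 0) (0, w) = fderiv ℝ F (e, 0) (0, 0)
        rw [h2]; exact (map_zero (fderiv ℝ F (e, 0))).symm)]
      rfl
    · rintro ⟨X, Y⟩
      obtain ⟨w, hw⟩ := hbij.2 (Y - fderiv ℝ F (e, 0) (X, 0))
      refine ⟨(X, w), Prod.ext rfl ?_⟩
      change fderiv ℝ F (e, 0) (X, w) = Y
      rw [hsplit, show fderiv ℝ F (e, 0) (0, w) = _ from hw]; abel
  let Le : (V × W) ≃L[ℝ] (V × V) :=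
    (LinearEquiv.ofBijective L.toLinearMap hLbij).toContinuousLinearEquiv
  have hGd : HasFDerivAt G (Le : V × W →L[ℝ] V × V) (e, 0) := hasFDerivAt_fst.prodMk (hdF (e, 0))
  have hGs := hG.contDiffAt.hasStrictFDerivAt' hGd (by simp)
  let ψ := hG.contDiffAt.localInverse hGd (by simp)
  have hGe : G (e, 0) = (e, 0) := Prod.ext rfl he
  have hψ : ContDiffAt ℝ ω ψ (e, 0) := by
    have := hG.contDiffAt.to_localInverse hGd (by simp)
    rwa [hGe] at this
  have hψe : ψ (e, 0) = (e, 0) := by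
    have := hG.contDiffAt.localInverse_apply_image hGd (by simp)
    rwa [hGe] at this
  have hright : ∀ᶠ y in 𝓝 ((e, 0) : V × V), G (ψ y) = y := by
    have := hGs.eventually_right_inverse
    rwa [hGe] at this
  have hι : ContDiff ℝ ω fun x : V => (x, (0 : V)) := contDiff_id.prodMk contDiff_const
  obtain ⟨u, hu, huψ⟩ := exists_contDiff_eventuallyEq (f := fun x => (ψ (x, 0)).2) (e := e)
    (contDiff_snd.contDiffAt.comp e (hψ.comp (f := fun x : V => (x, (0 : V))) e hι.contDiffAt))
  have hue : u e = 0 := by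
    rw [huψ.self_of_nhds]
    change (ψ (e, 0)).2 = 0
    rw [hψe]
  have hFu : ∀ᶠ x in 𝓝 e, F (x, u x) = 0 := by
    filter_upwards [huψ, (hι.continuous.tendsto' e _ rfl).eventually hright] with x hx hx2
    have h1 : (ψ (x, 0)).1 = x := congr_arg Prod.fst hx2
    have h2 : F (ψ (x, 0)) = 0 := congr_arg Prod.snd hx2
    rw [hx]
    nth_rewrite 1 [← h1]
    exact h2
  let M : V → W →L[ℝ] V := fun x => (fderiv ℝ F (x, u x)).comp (ContinuousLinearMap.inr ℝ V W)
  have hM : Continuous M := by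
    have h1 : Continuous (fderiv ℝ F) := hF.continuous_fderiv (by simp)
    exact (h1.comp (continuous_id.prodMk hu.continuous)).clm_comp continuous_const
  have hMe : Function.Bijective (M e).toLinearMap := by
    have : (M e : W → V) = fun w : W => fderiv ℝ F (e, 0) (0, w) := by ext w; simp [M, hue]
    change Function.Bijective (M e : W → V)
    rwa [this]
  let Me : W ≃L[ℝ] V := (LinearEquiv.ofBijective (M e).toLinearMap hMe).toContinuousLinearEquiv
  have hMev : ∀ᶠ x in 𝓝 e, ∃ A : W ≃L[ℝ] V, (A : W →L[ℝ] V) = M x := by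
    have h1 : (Me : W →L[ℝ] V) = M e := by ext; rfl
    have h2 := ContinuousLinearEquiv.nhds Me
    rw [h1] at h2
    exact hM.continuousAt.eventually h2
  refine ⟨u, hu, hue, ?_⟩
  filter_upwards [hFu, hFu.eventually_nhds, hMev] with x hx hx' ⟨A, hA⟩
  refine ⟨hx, fun X w hXw => ?_⟩
  have hud : HasFDerivAt u (fderiv ℝ u x) x :=
    (hu.differentiable (by simp)).differentiableAt.hasFDerivAt
  have h1 := (hdF (x, u x)).comp x ((hasFDerivAt_id x).prodMk hud)
  have h2 : HasFDerivAt (fun y => F (y, u y)) (0 : V →L[ℝ] V) x :=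
    (hasFDerivAt_const (0 : V) x).congr_of_eventuallyEq hx'
  have h3 : fderiv ℝ F (x, u x) (X, fderiv ℝ u x X) = 0 :=
    congr_arg (fun B : V →L[ℝ] V => B X) (h1.unique h2)
  have h4 : A (fderiv ℝ u x X - w) = 0 := by
    have : A (fderiv ℝ u x X - w) = M x (fderiv ℝ u x X - w) := by rw [← hA]; rfl
    rw [this]
    change fderiv ℝ F (x, u x) (0, fderiv ℝ u x X - w) = 0
    have h5 : ((0 : V), fderiv ℝ u x X - w) = (X, fderiv ℝ u x X) - (X, w) := by simp
    rw [h5, map_sub, h3, hXw, sub_zero]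
  exact sub_eq_zero.1 (A.map_eq_zero_iff.1 h4)

end

section

/-- The norm topology on matrices. -/
@[reducible] noncomputable def matrixNormTopology (n : ℕ) :
    TopologicalSpace (Matrix (Fin n) (Fin n) ℝ) :=
  UniformSpace.toTopologicalSpace (self := PseudoMetricSpace.toUniformSpace)

attribute [local instance] matrixNormTopology

/-- Multiplication of pairs of matrices. -/
noncomputable def pairMul (n : ℕ) : MatPair n →L[ℝ] MatPair n →L[ℝ] MatPair n :=
  (LinearMap.mul ℝ (MatPair n)).toContinuousBilinearMap

@[simp] theorem pairMul_apply {n : ℕ} (a b : MatPair n) : pairMul n a b = a * b := rfl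

/-- Exchange of the components of a pair of matrices. -/
noncomputable def pairSwap (n : ℕ) : MatPair n →L[ℝ] MatPair n :=
  (ContinuousLinearMap.snd ℝ _ _).prod (ContinuousLinearMap.fst ℝ _ _)

theorem pairSwap_mul {n : ℕ} (a b : MatPair n) :
    pairSwap n (a * b) = pairSwap n a * pairSwap n b := rfl

theorem pairSwap_one {n : ℕ} : pairSwap n 1 = 1 := rfl

theorem infAct_eq {n : ℕ} (a p : MatPair n) : infAct n a p = a * p - p * pairSwap n a := rfl

theorem pair_mul_eq_one_comm {n : ℕ} {a b : MatPair n} : a * b = 1 ↔ b * a = 1 := by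
  simp only [Prod.ext_iff, Prod.fst_mul, Prod.snd_mul, Prod.fst_one, Prod.snd_one,
    mul_eq_one_comm (a := a.1), mul_eq_one_comm (a := a.2)]

/-- Smooth division by a pair of matrices which is the identity at `e`. -/
theorem exists_contDiff_mul_eq {n : ℕ} {e : MatPair n} {g : MatPair n → MatPair n}
    (hg : ContDiff ℝ ∞ g) (hge : g e = 1) {κ : MatPair n → MatPair n} (hκ : ContDiff ℝ ∞ κ) :
    ∃ G : MatPair n → MatPair n, ContDiff ℝ ∞ G ∧ ∀ᶠ x in 𝓝 e, G x * g x = κ x := by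
  obtain ⟨inv, hinv, hinv_eq⟩ := exists_contDiff_eventuallyEq
    (contDiffAt_map_inverse (n := ω) (ContinuousLinearEquiv.refl ℝ (MatPair n)))
  let R : MatPair n → MatPair n →L[ℝ] MatPair n := fun x => (pairMul n).flip (g x)
  have hR : ContDiff ℝ ∞ R := (pairMul n).flip.contDiff.comp hg
  have hRe : R e = (ContinuousLinearEquiv.refl ℝ (MatPair n) : MatPair n →L[ℝ] MatPair n) := by
    refine ContinuousLinearMap.ext fun a => ?_
    change a * g e = a
    rw [hge, mul_one]
  refine ⟨fun x => inv (R x) (κ x), (hinv.comp hR).clm_apply hκ, ?_⟩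
  have hcont : Filter.Tendsto R (𝓝 e) (𝓝
      (ContinuousLinearEquiv.refl ℝ (MatPair n) : MatPair n →L[ℝ] MatPair n)) :=
    hR.continuous.tendsto' _ _ hRe
  filter_upwards [hcont.eventually hinv_eq, hcont.eventually (ContinuousLinearEquiv.nhds _)]
    with x hx ⟨A, hA⟩
  change R x (inv (R x) (κ x)) = κ x
  rw [hx, ← hA, ContinuousLinearMap.inverse_equiv]
  exact A.apply_symm_apply _

variable {n : ℕ} {e : MatPair n} {I J : Type} [Fintype I] [Fintype J]

/-- The linear vector field `x ↦ h • x - 2 x`. -/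
noncomputable def AdaptedBasis.field (D : AdaptedBasis e I J) : MatPair n →L[ℝ] MatPair n :=
  LinearMap.toContinuousLinearMap (infAct n D.h - (2 : ℝ) • LinearMap.id)

theorem AdaptedBasis.field_apply (D : AdaptedBasis e I J) (x : MatPair n) :
    D.field x = infAct n D.h x - (2 : ℝ) • x := rfl

/-- Coordinates on the Lie algebra. -/
noncomputable def AdaptedBasis.lieMap (D : AdaptedBasis e I J) : (I ⊕ J → ℝ) →L[ℝ] MatPair n :=
  LinearMap.toContinuousLinearMap
    (Fintype.linearCombination ℝ (Sum.elim D.κ fun _ => (0 : MatPair n)))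

theorem AdaptedBasis.lieMap_apply (D : AdaptedBasis e I J) (u : I ⊕ J → ℝ) :
    D.lieMap u = ∑ i, u (.inl i) • D.κ i := by
  simp [lieMap, Fintype.linearCombination_apply]

/-- Coordinates on the transversal slice. -/
noncomputable def AdaptedBasis.sliceMap (D : AdaptedBasis e I J) : (I ⊕ J → ℝ) →L[ℝ] MatPair n :=
  LinearMap.toContinuousLinearMap
    (Fintype.linearCombination ℝ (Sum.elim (fun _ => (0 : MatPair n)) fun j => D.b (.inr j)))

theorem AdaptedBasis.sliceMap_apply (D : AdaptedBasis e I J) (u : I ⊕ J → ℝ) :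
    D.sliceMap u = ∑ j, u (.inr j) • D.b (.inr j) := by
  simp [sliceMap, Fintype.linearCombination_apply]

/-- Equation of the slice coordinates. -/
noncomputable def AdaptedBasis.implicitMap (D : AdaptedBasis e I J)
    (p : MatPair n × (I ⊕ J → ℝ)) : MatPair n :=
  (1 + D.lieMap p.2) * (e + D.sliceMap p.2) - p.1 * pairSwap n (1 + D.lieMap p.2)

theorem AdaptedBasis.contDiff_implicitMap (D : AdaptedBasis e I J) :
    ContDiff ℝ ω D.implicitMap := by
  have h1 : ContDiff ℝ ω fun p : MatPair n × (I ⊕ J → ℝ) => 1 + D.lieMap p.2 :=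
    contDiff_const.add (D.lieMap.contDiff.comp contDiff_snd)
  have h2 : ContDiff ℝ ω fun p : MatPair n × (I ⊕ J → ℝ) => e + D.sliceMap p.2 :=
    contDiff_const.add (D.sliceMap.contDiff.comp contDiff_snd)
  exact (((pairMul n).contDiff.comp h1).clm_apply h2).sub
    (((pairMul n).contDiff.comp contDiff_fst).clm_apply ((pairSwap n).contDiff.comp h1))

theorem AdaptedBasis.fderiv_implicitMap (D : AdaptedBasis e I J) (x X : MatPair n)
    (u w : I ⊕ J → ℝ) : fderiv ℝ D.implicitMap (x, u) (X, w) =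
      D.lieMap w * (e + D.sliceMap u) + (1 + D.lieMap u) * D.sliceMap w
        - X * pairSwap n (1 + D.lieMap u) - x * pairSwap n (D.lieMap w) := by
  have h1 : HasFDerivAt (fun p : MatPair n × (I ⊕ J → ℝ) => 1 + D.lieMap p.2)
      (D.lieMap.comp (ContinuousLinearMap.snd ℝ _ _)) (x, u) :=
    (D.lieMap.hasFDerivAt.comp _ hasFDerivAt_snd).const_add 1
  have h2 : HasFDerivAt (fun p : MatPair n × (I ⊕ J → ℝ) => e + D.sliceMap p.2)
      (D.sliceMap.comp (ContinuousLinearMap.snd ℝ _ _)) (x, u) :=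
    (D.sliceMap.hasFDerivAt.comp _ hasFDerivAt_snd).const_add e
  have h3 := (((pairMul n).hasFDerivAt.comp _ h1).clm_apply h2).sub
    (((pairMul n).hasFDerivAt.comp _ hasFDerivAt_fst).clm_apply
      ((pairSwap n).hasFDerivAt.comp _ h1))
  have h4 : HasFDerivAt D.implicitMap _ (x, u) := h3
  rw [h4.fderiv]
  simp [-map_add]
  abel

end

section
attribute [local instance] matrixNormTopology

variable {n : ℕ} {e : MatPair n} {I J : Type} [Fintype I] [Fintype J]

theorem AdaptedBasis.exists_implicit (D : AdaptedBasis e I J) :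
    ∃ u : MatPair n → (I ⊕ J → ℝ), ContDiff ℝ ∞ u ∧ u e = 0 ∧
      ∀ᶠ x in 𝓝 e, (1 + D.lieMap (u x)) * (e + D.sliceMap (u x)) =
          x * pairSwap n (1 + D.lieMap (u x)) ∧
        ∀ X w, D.lieMap w * (e + D.sliceMap (u x)) + (1 + D.lieMap (u x)) * D.sliceMap w
          - X * pairSwap n (1 + D.lieMap (u x)) - x * pairSwap n (D.lieMap w) = 0 →
          fderiv ℝ u x X = w := by
  obtain ⟨u, hu, hue, h⟩ := exists_contDiff_implicit (e := e) D.contDiff_implicitMap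
    (by simp [AdaptedBasis.implicitMap, pairSwap_one]) (by
      have : (fun w => fderiv ℝ D.implicitMap (e, 0) (0, w)) = D.b.equivFun.symm := by
        funext w
        have h : infAct n (D.lieMap w) e = ∑ i, w (.inl i) • D.b (.inl i) := by
          simp only [D.lieMap_apply, map_sum, LinearMap.sum_apply, map_smul, LinearMap.smul_apply,
            D.b_inl]
        rw [D.fderiv_implicitMap, Module.Basis.equivFun_symm_apply, Fintype.sum_sum_type, ← h,
          ← D.sliceMap_apply, infAct_eq]
        simp only [map_zero, add_zero, one_mul, zero_mul, sub_zero]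
        abel
      rw [this]
      exact D.b.equivFun.symm.bijective)
  refine ⟨u, hu, hue, h.mono fun x hx => ⟨sub_eq_zero.1 hx.1, fun X w hw => hx.2 X w ?_⟩⟩
  rw [D.fderiv_implicitMap, hw]

theorem AdaptedBasis.infAct_h_slice (D : AdaptedBasis e I J) (u : I ⊕ J → ℝ) :
    infAct n D.h (e + D.sliceMap u) - (2 : ℝ) • (e + D.sliceMap u) =
      ∑ j, ((D.w j : ℝ) * u (.inr j)) • D.b (.inr j) := by
  rw [D.sliceMap_apply, map_add, D.infAct_h_e, map_sum, smul_add, Finset.smul_sum,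
    add_sub_add_left_eq_sub, ← Finset.sum_sub_distrib]
  refine Finset.sum_congr rfl fun j _ => ?_
  rw [map_smul, D.infAct_h_inr, smul_smul, smul_smul, ← sub_smul]
  congr 1; ring

theorem AdaptedBasis.h_mul_lieMap (D : AdaptedBasis e I J) (u : I ⊕ J → ℝ) :
    D.h * D.lieMap u = D.lieMap u * D.h + ∑ i, ((D.β i : ℝ) * u (.inl i)) • D.κ i := by
  rw [D.lieMap_apply, Finset.mul_sum, Finset.sum_mul, ← Finset.sum_add_distrib]
  refine Finset.sum_congr rfl fun i _ => ?_
  rw [mul_smul_comm, D.h_mul_κ, smul_mul_assoc, smul_add, smul_smul, mul_comm (u _)]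

/-- Near `e` there is a chart adapted to the orbit of `e`; near `e` every point is conjugate to a
point of the transversal slice. -/
theorem AdaptedBasis.exists_chart (D : AdaptedBasis e I J) {P : MatPair n → Prop}
    (hP : ∀ᶠ z in 𝓝 e, P z) :
    ∃ (U : Set (MatPair n)) (𝒞 : VanishingChart I J (MatPair n) U e D.field
        (fun i => (D.β i : ℝ)) (fun j => (D.w j : ℝ))) (G : I → MatPair n → MatPair n),
      (∀ i, ContDiff ℝ ∞ (G i)) ∧ (∀ i x, 𝒞.d i x = infAct n (G i x) x) ∧
      ∀ x ∈ U, ∃ g k z : MatPair n, g * k = 1 ∧ z = k * x * pairSwap n g ∧ P z ∧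
        infAct n D.h z - (2 : ℝ) • z = ∑ j, ((D.w j : ℝ) * 𝒞.v j x) • D.b (.inr j) := by
  classical
  obtain ⟨u, hu, hue, hux⟩ := D.exists_implicit
  have hui : ∀ i, ContDiff ℝ ∞ fun x => u x i := contDiff_pi.1 hu
  have hdu : ∀ x X s, fderiv ℝ (fun x => u x s) x X = fderiv ℝ u x X s := fun x X s => by
    have h := (hu.differentiable (by simp)).differentiableAt (x := x)
    exact congr_arg (fun L : MatPair n →L[ℝ] ℝ => L X)
      ((hasFDerivAt_pi'.1 h.hasFDerivAt s).fderiv)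
  let g : MatPair n → MatPair n := fun x => 1 + D.lieMap (u x)
  have hg : ContDiff ℝ ∞ g := contDiff_const.add (D.lieMap.contDiff.comp hu)
  have hge : g e = 1 := by simp [g, hue]
  have hsg : ContDiff ℝ ∞ fun x => pairSwap n (g x) := (pairSwap n).contDiff.comp hg
  have hsge : pairSwap n (g e) = 1 := by rw [hge]; rfl
  obtain ⟨k, -, hk⟩ := exists_contDiff_mul_eq hg hge (contDiff_const (c := (1 : MatPair n)))
  choose G hG hGx using fun i => exists_contDiff_mul_eq hg hge (contDiff_const (c := D.κ i))
  choose Y hY hYx using fun j => exists_contDiff_mul_eq hsg hsge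
    (((pairMul n).contDiff.comp hg).clm_apply (contDiff_const (c := D.b (.inr j))))
  have hz : Continuous fun x => e + D.sliceMap (u x) :=
    continuous_const.add (D.sliceMap.continuous.comp hu.continuous)
  have hPz := (hz.tendsto' e e (by simp [hue])).eventually hP
  obtain ⟨U, hU, hUo, heU⟩ := eventually_nhds_iff.1
    (hux.and (hk.and ((Filter.eventually_all.2 hGx).and ((Filter.eventually_all.2 hYx).and hPz))))
  have hinfG : ∀ x ∈ U, ∀ i, infAct n (G i x) x * pairSwap n (g x) =
      D.κ i * (e + D.sliceMap (u x)) - x * pairSwap n (D.κ i) := fun x hx i => by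
    obtain ⟨⟨h1, -⟩, -, h3, -⟩ := hU x hx
    rw [infAct_eq, sub_mul, mul_assoc, ← h1, ← mul_assoc, h3 i, mul_assoc, ← pairSwap_mul, h3 i]
  let W : MatPair n → I ⊕ J → ℝ := fun x =>
    Sum.elim (fun i => (D.β i : ℝ) * u x (.inl i)) fun j => (D.w j : ℝ) * u x (.inr j)
  have hlW : ∀ x, D.lieMap (W x) = ∑ i, ((D.β i : ℝ) * u x (.inl i)) • D.κ i :=
    fun x => D.lieMap_apply _
  have hsW : ∀ x, D.sliceMap (W x) = ∑ j, ((D.w j : ℝ) * u x (.inr j)) • D.b (.inr j) :=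
    fun x => D.sliceMap_apply _
  have hfield : ∀ x ∈ U, D.field x * pairSwap n (g x) =
      D.lieMap (W x) * (e + D.sliceMap (u x)) + g x * D.sliceMap (W x) -
        x * pairSwap n (D.lieMap (W x)) := fun x hx => by
    obtain ⟨⟨h1, -⟩, -⟩ := hU x hx
    rw [hlW, hsW, ← D.infAct_h_slice, D.field_apply, infAct_eq, infAct_eq]
    have h2 : ∑ i, ((D.β i : ℝ) * u x (.inl i)) • D.κ i = D.h * g x - g x * D.h := by
      simp only [g, mul_add, add_mul, one_mul, mul_one, D.h_mul_lieMap]; abel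
    rw [h2, map_sub, pairSwap_mul, pairSwap_mul]
    change g x * (e + D.sliceMap (u x)) = x * pairSwap n (g x) at h1
    generalize e + D.sliceMap (u x) = z at h1 ⊢
    have h3 : (x * pairSwap n D.h) * pairSwap n (g x) = x * (pairSwap n D.h * pairSwap n (g x)) :=
      mul_assoc _ _ _
    simp only [sub_mul, mul_sub, smul_mul_assoc, mul_smul_comm, ← mul_assoc, h1]
    simp only [mul_assoc, h1]
    abel
  have hinj : ∀ x ∈ U, ∀ a b : MatPair n, a * pairSwap n (g x) = b * pairSwap n (g x) → a = b :=
    fun x hx a b hab => by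
      have h1 : pairSwap n (g x) * pairSwap n (k x) = 1 := by
        rw [← pairSwap_mul, pair_mul_eq_one_comm.1 (hU x hx).2.1, pairSwap_one]
      rw [← mul_one a, ← mul_one b, ← h1, ← mul_assoc, hab, mul_assoc]
  have hdG : ∀ x ∈ U, ∀ i, fderiv ℝ u x (infAct n (G i x) x) = Pi.single (.inl i) 1 :=
    fun x hx i => (hU x hx).1.2 _ _ (by
      change _ - _ * pairSwap n (g x) - _ = _
      rw [hinfG x hx i, D.lieMap_apply (Pi.single _ _), D.sliceMap_apply (Pi.single _ _)]
      simp [Pi.single_apply])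
  have hdB : ∀ x ∈ U, fderiv ℝ u x (D.field x) = W x := fun x hx => (hU x hx).1.2 _ _ (by
    change _ - _ * pairSwap n (g x) - _ = _
    rw [hfield x hx]
    simp only [g]
    abel)
  let 𝒞 : VanishingChart I J (MatPair n) U e D.field
      (fun i => (D.β i : ℝ)) (fun j => (D.w j : ℝ)) :=
    { q := fun i x => u x (.inl i)
      v := fun j x => u x (.inr j)
      d := fun i x => infAct n (G i x) x
      Y := Y
      contDiff_q := fun i => hui _
      contDiff_v := fun j => hui _
      contDiff_Y := hY
      isOpen := hUo
      mem := heU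
      fderiv_v_B := fun j x hx => by rw [hdu, hdB x hx]; rfl
      fderiv_v_d := fun i j x hx => by rw [hdu, hdG x hx]; simp
      fderiv_q_d := fun i x hx => by rw [hdu, hdG x hx]; simp
      B_eq := fun x hx => hinj x hx _ _ (by
        obtain ⟨-, -, -, h4, -⟩ := hU x hx
        rw [hfield x hx, hlW, hsW, add_mul _ _ (pairSwap n (g x))]
        simp only [smul_mul_assoc, hinfG x hx, h4, map_sum, map_smul,
          Finset.mul_sum _ _ x, Finset.mul_sum _ _ (g x), Finset.sum_mul, mul_smul_comm, smul_sub,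
          Finset.sum_sub_distrib]
        change _ + ∑ j, (_ * _) • (g x * D.b (.inr j)) - _ = _ + ∑ j, _ • (g x * D.b (.inr j))
        abel)
      q_e := fun i => by rw [hue]; rfl }
  refine ⟨U, 𝒞, G, hG, fun i x => rfl, fun x hx => ⟨g x, k x, e + D.sliceMap (u x),
    pair_mul_eq_one_comm.1 (hU x hx).2.1, ?_, (hU x hx).2.2.2.2, D.infAct_h_slice _⟩⟩
  have h1 : g x * (e + D.sliceMap (u x)) = x * pairSwap n (g x) := (hU x hx).1.1
  rw [mul_assoc, ← h1, ← mul_assoc, (hU x hx).2.1, one_mul]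

end

section
attribute [local instance] matrixNormTopology

variable {n : ℕ}

/-- The action of a pair of invertible matrices on pairs of matrices. -/
noncomputable def pairAct (g h : (Matrix (Fin n) (Fin n) ℝ)ˣ) : MatPair n ≃L[ℝ] MatPair n :=
  LinearEquiv.toContinuousLinearEquiv
    { toFun := fun p => (g.val * p.1 * h⁻¹.val, h.val * p.2 * g⁻¹.val)
      map_add' := fun p q => by simp [mul_add, add_mul]
      map_smul' := fun c p => by simp
      invFun := fun p => (g⁻¹.val * p.1 * h.val, h⁻¹.val * p.2 * g.val)
      left_inv := fun p => by
        refine Prod.ext ?_ ?_ <;>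
          simp only [mul_assoc, Units.inv_mul, mul_one, Units.inv_mul_cancel_left]
      right_inv := fun p => by
        refine Prod.ext ?_ ?_ <;>
          simp only [mul_assoc, Units.mul_inv, mul_one, Units.mul_inv_cancel_left] }

theorem pairAct_apply (g h : (Matrix (Fin n) (Fin n) ℝ)ˣ) (p : MatPair n) :
    pairAct g h p = (g.val * p.1 * h⁻¹.val, h.val * p.2 * g⁻¹.val) := rfl

theorem pairAct_inv_apply (g h : (Matrix (Fin n) (Fin n) ℝ)ˣ) (p : MatPair n) :
    pairAct g⁻¹ h⁻¹ (pairAct g h p) = p := (pairAct g h).symm_apply_apply p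

theorem infAct_pairAct (g h : (Matrix (Fin n) (Fin n) ℝ)ˣ) (A p : MatPair n) :
    infAct n A (pairAct g h p) =
      pairAct g h (infAct n (g⁻¹.val * A.1 * g.val, h⁻¹.val * A.2 * h.val) p) := by
  simp only [infAct_apply, pairAct_apply]
  refine Prod.ext ?_ ?_ <;>
    simp only [mul_sub, sub_mul, mul_assoc, Units.mul_inv_cancel_left, Units.mul_inv, mul_one]

theorem finrank_range_infAct_pairAct_le (g h : (Matrix (Fin n) (Fin n) ℝ)ˣ) (p : MatPair n) :
    Module.finrank ℝ (LinearMap.range ((infAct n).flip (pairAct g h p))) ≤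
      Module.finrank ℝ (LinearMap.range ((infAct n).flip p)) := by
  refine (Submodule.finrank_mono ?_).trans
    (Submodule.finrank_map_le (pairAct g h).toLinearEquiv.toLinearMap _)
  rintro _ ⟨A, rfl⟩
  exact ⟨_, ⟨_, rfl⟩, (infAct_pairAct g h A p).symm⟩

theorem finrank_range_infAct_pairAct (g h : (Matrix (Fin n) (Fin n) ℝ)ˣ) (p : MatPair n) :
    Module.finrank ℝ (LinearMap.range ((infAct n).flip (pairAct g h p))) =
      Module.finrank ℝ (LinearMap.range ((infAct n).flip p)) := by
  refine (finrank_range_infAct_pairAct_le g h p).antisymm ?_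
  have := finrank_range_infAct_pairAct_le g⁻¹ h⁻¹ (pairAct g h p)
  rwa [pairAct_inv_apply] at this

/-- A nilpotent pair is conjugate to one which has an adapted basis. -/
theorem exists_pairAct_adaptedBasis (hn : 0 < n) {p : MatPair n} (hp : p ∈ nilpotentCone n) :
    ∃ (g h : (Matrix (Fin n) (Fin n) ℝ)ˣ) (I J : Type) (_ : Fintype I) (_ : Fintype J),
      Nonempty (AdaptedBasis (pairAct g h p) I J) := by
  obtain ⟨g, h, wt, f₁, f₂, E, F, H, hE, -, hH, hHE, hHF, hEF, hbd⟩ :=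
    exists_conj_sl2_triple (x := p.1) (y := p.2) hp
  exact ⟨g, h, exists_adaptedBasis hn hE hH hHE hHF hEF hbd⟩

theorem two_smul_mem_range_infAct (hn : 0 < n) {p : MatPair n} (hp : p ∈ nilpotentCone n) :
    (2 : ℝ) • p ∈ LinearMap.range ((infAct n).flip p) := by
  obtain ⟨g, h, I, J, _, _, ⟨D⟩⟩ := exists_pairAct_adaptedBasis hn hp
  have h1 := D.infAct_h_e
  rw [infAct_pairAct, ← map_smul] at h1
  exact ⟨_, (pairAct g h).injective h1⟩

variable {e : MatPair n} {I J : Type} [Fintype I] [Fintype J]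

theorem AdaptedBasis.eventually_linearIndependent (D : AdaptedBasis e I J) :
    ∀ᶠ z in 𝓝 e, LinearIndependent ℝ
      (Sum.elim (fun i => infAct n (D.κ i) z) fun j => D.b (.inr j)) := by
  have h1 : Continuous fun z : MatPair n =>
      (Sum.elim (fun i => infAct n (D.κ i) z) fun j => D.b (.inr j) : I ⊕ J → MatPair n) := by
    refine continuous_pi fun s => ?_
    rcases s with i | j
    · exact (LinearMap.toContinuousLinearMap (infAct n (D.κ i))).continuous
    · exact continuous_const
  refine h1.continuousAt.eventually (isOpen_setOfPred_linearIndependent.mem_nhds ?_)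
  have h2 : (Sum.elim (fun i => infAct n (D.κ i) e) fun j => D.b (.inr j)) = D.b := by
    funext s
    rcases s with i | j
    · exact (D.b_inl i).symm
    · rfl
  change LinearIndependent ℝ
    (Sum.elim (fun i => infAct n (D.κ i) e) fun j => D.b (.inr j))
  rw [h2]
  exact D.b.linearIndependent

/-- The slice meets the set of nilpotent pairs of orbit dimension at most that of `e` only
at `e`. -/
theorem AdaptedBasis.eq_zero_of_mem_slice (D : AdaptedBasis e I J) {z : MatPair n} {v : J → ℝ}
    (hz : LinearIndependent ℝ (Sum.elim (fun i => infAct n (D.κ i) z) fun j => D.b (.inr j)))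
    (h2z : (2 : ℝ) • z ∈ LinearMap.range ((infAct n).flip z))
    (hdim : Module.finrank ℝ (LinearMap.range ((infAct n).flip z)) ≤
      Module.finrank ℝ (LinearMap.range ((infAct n).flip e)))
    (hv : infAct n D.h z - (2 : ℝ) • z = ∑ j, ((D.w j : ℝ) * v j) • D.b (.inr j)) (j : J) :
    v j = 0 := by
  obtain ⟨h1, h2, h3⟩ := linearIndependent_sum.1 hz
  rw [Sum.elim_comp_inl] at h1 h3
  rw [Sum.elim_comp_inr] at h2 h3
  have hspan : Submodule.span ℝ (Set.range fun i => infAct n (D.κ i) z) =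
      LinearMap.range ((infAct n).flip z) := by
    refine Submodule.eq_of_le_of_finrank_le (Submodule.span_le.2 ?_) ?_
    · rintro _ ⟨i, rfl⟩
      exact ⟨D.κ i, rfl⟩
    · rw [finrank_span_eq_card h1]
      exact hdim.trans D.finrank_le
  have hmem : infAct n D.h z - (2 : ℝ) • z ∈ LinearMap.range ((infAct n).flip z) :=
    sub_mem ⟨D.h, rfl⟩ h2z
  have h0 : ∑ j, ((D.w j : ℝ) * v j) • D.b (.inr j) = 0 := by
    refine Submodule.disjoint_def.1 h3 _ ?_ ?_
    · rw [← hv, hspan]; exact hmem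
    · exact sum_mem fun j _ => Submodule.smul_mem _ _ (Submodule.subset_span ⟨j, rfl⟩)
  have h4 := Fintype.linearIndependent_iff.1 h2 _ h0 j
  have h5 : (D.w j : ℝ) ≠ 0 := Int.cast_ne_zero.2 (D.w_neg j).ne
  exact (mul_eq_zero.1 h4).resolve_left h5

/-- Near a point `e` of maximal orbit dimension in an invariant subset `Z` of the nilpotent cone
there is an adapted chart whose equations vanish on `Z`. -/
theorem AdaptedBasis.exists_chart_of_maximal (hn : 0 < n) (D : AdaptedBasis e I J)
    {Z : Set (MatPair n)} (hZ : ∀ g h, ∀ p ∈ Z, pairAct g h p ∈ Z) (hZN : Z ⊆ nilpotentCone n)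
    (hmax : ∀ z ∈ Z, Module.finrank ℝ (LinearMap.range ((infAct n).flip z)) ≤
      Module.finrank ℝ (LinearMap.range ((infAct n).flip e))) :
    ∃ (U : Set (MatPair n)) (𝒞 : VanishingChart I J (MatPair n) U e D.field
        (fun i => (D.β i : ℝ)) (fun j => (D.w j : ℝ))) (G : I → MatPair n → MatPair n),
      (∀ i, ContDiff ℝ ∞ (G i)) ∧ (∀ i x, 𝒞.d i x = infAct n (G i x) x) ∧
      ∀ j, ∀ x ∈ Z ∩ U, 𝒞.v j x = 0 := by
  obtain ⟨U, 𝒞, G, hG, hd, hU⟩ := D.exists_chart D.eventually_linearIndependent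
  refine ⟨U, 𝒞, G, hG, hd, fun j x ⟨hxZ, hxU⟩ => ?_⟩
  obtain ⟨g, k, z, hgk, rfl, hz, hzv⟩ := hU x hxU
  let k₁ : (Matrix (Fin n) (Fin n) ℝ)ˣ :=
    ⟨k.1, g.1, congr_arg Prod.fst (pair_mul_eq_one_comm.1 hgk), congr_arg Prod.fst hgk⟩
  let k₂ : (Matrix (Fin n) (Fin n) ℝ)ˣ :=
    ⟨k.2, g.2, congr_arg Prod.snd (pair_mul_eq_one_comm.1 hgk), congr_arg Prod.snd hgk⟩
  have hz' : k * x * pairSwap n g = pairAct k₁ k₂ x := rfl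
  rw [hz'] at hz hzv
  have hmem := hZ k₁ k₂ x hxZ
  exact D.eq_zero_of_mem_slice hz (two_smul_mem_range_infAct hn (hZN hmem)) (hmax _ hmem) hzv j

end

section
attribute [local instance] matrixNormTopology

variable {n : ℕ}

theorem one_add_smul_mul_one_add_smul {R : Type*} [Ring R] [Algebra ℝ R] {p : R} (hp : p * p = p)
    {a b : ℝ} (hab : a * b = 1) : (1 + (a - 1) • p) * (1 + (b - 1) • p) = 1 := by
  simp only [mul_add, add_mul, one_mul, mul_one, smul_mul_smul_comm, hp]
  rw [add_assoc, add_eq_left, ← add_smul, ← add_smul]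
  convert zero_smul ℝ p using 2
  linear_combination hab

/-- The one-parameter group generated by an idempotent. -/
noncomputable def expUnit (p : Matrix (Fin n) (Fin n) ℝ) (hp : p * p = p) (t : ℝ) :
    (Matrix (Fin n) (Fin n) ℝ)ˣ where
  val := 1 + (Real.exp t - 1) • p
  inv := 1 + (Real.exp (-t) - 1) • p
  val_inv := one_add_smul_mul_one_add_smul hp (by rw [← Real.exp_add]; simp)
  inv_val := one_add_smul_mul_one_add_smul hp (by rw [← Real.exp_add]; simp)

/-- The orbit map of the one-parameter group generated by an idempotent pair. -/
noncomputable def idemFlow (P : MatPair n) (s : ℝ × MatPair n) : MatPair n :=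
  (1 + (Real.exp s.1 - 1) • P) * s.2 * (1 + (Real.exp (-s.1) - 1) • pairSwap n P)

theorem contDiff_idemFlow (P : MatPair n) : ContDiff ℝ ∞ (idemFlow P) := by
  have h1 : ContDiff ℝ ∞ fun s : ℝ × MatPair n => 1 + (Real.exp s.1 - 1) • P :=
    contDiff_const.add (((Real.contDiff_exp.comp contDiff_fst).sub contDiff_const).smul
      contDiff_const)
  have h2 : ContDiff ℝ ∞ fun s : ℝ × MatPair n => 1 + (Real.exp (-s.1) - 1) • pairSwap n P :=
    contDiff_const.add (((Real.contDiff_exp.comp contDiff_fst.neg).sub contDiff_const).smul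
      contDiff_const)
  exact ((pairMul n).contDiff.comp (((pairMul n).contDiff.comp h1).clm_apply
    contDiff_snd)).clm_apply h2

theorem fderiv_idemFlow (P x : MatPair n) :
    fderiv ℝ (idemFlow P) (0, x) (1, 0) = infAct n P x := by
  have h0 : HasDerivAt (fun t : ℝ => ((t, x) : ℝ × MatPair n)) (1, 0) 0 :=
    (hasDerivAt_id (0 : ℝ)).prodMk (hasDerivAt_const (0 : ℝ) x)
  have h1 := (((contDiff_idemFlow P).differentiable (by simp)).differentiableAt
    (x := ((0 : ℝ), x))).hasFDerivAt.comp_hasDerivAt 0 h0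
  have h2 : HasDerivAt (fun t : ℝ => 1 + (Real.exp t - 1) • P) P 0 := by
    simpa using (((Real.hasDerivAt_exp 0).sub_const 1).smul_const P).const_add 1
  have h3 : HasDerivAt (fun t : ℝ => 1 + (Real.exp (-t) - 1) • pairSwap n P)
      (-pairSwap n P) 0 := by
    have h4 : HasDerivAt (fun t : ℝ => Real.exp (-t)) (-1) 0 := by
      simpa using (hasDerivAt_neg (0 : ℝ)).exp
    simpa using ((h4.sub_const 1).smul_const (pairSwap n P)).const_add 1
  have h5 := ((pairMul n).flip x).hasFDerivAt.comp_hasDerivAt 0 h2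
  have h6 := ((pairMul n).hasFDerivAt.comp_hasDerivAt 0 h5).clm_apply h3
  have h7 : HasDerivAt (fun t : ℝ => idemFlow P (t, x)) _ 0 := h6
  have h8 := h1.unique h7
  rw [h8]
  simp [infAct_eq, sub_eq_add_neg]

theorem idemFlow_eq_pairAct {P : MatPair n} (h₁ : P.1 * P.1 = P.1) (h₂ : P.2 * P.2 = P.2) (t : ℝ)
    (x : MatPair n) : idemFlow P (t, x) = pairAct (expUnit P.1 h₁ t) (expUnit P.2 h₂ t) x := rfl

/-- The functional `T` transforms under the action of `GLₙ × GLₙ` by the character `η ∘ det`. -/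
def IsEquivariant (η : ℝˣ →* ℂˣ) (T : (MatPair n → ℂ) →ₗ[ℂ] ℂ) : Prop :=
  ∀ (g h : (Matrix (Fin n) (Fin n) ℝ)ˣ) (f : MatPair n → ℂ), IsTestFun Set.univ f →
    T (fun x => f (pairAct g h x)) = ((η (Units.map Matrix.detMonoidHom g) : ℂ))⁻¹ *
      (η (Units.map Matrix.detMonoidHom h) : ℂ) * T f

theorem IsEquivariant.hasDerivAt {η : ℝˣ →* ℂˣ} {T : (MatPair n → ℂ) →ₗ[ℂ] ℂ}
    (hT : IsEquivariant η T) {L : ℕ} (hL : HasOrderLE T L) {P : MatPair n}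
    (h₁ : P.1 * P.1 = P.1) (h₂ : P.2 * P.2 = P.2) {f : MatPair n → ℂ}
    (hf : IsTestFun Set.univ f) :
    HasDerivAt (fun t => ((η (Units.map Matrix.detMonoidHom (expUnit P.1 h₁ t)) : ℂ))⁻¹ *
      (η (Units.map Matrix.detMonoidHom (expUnit P.2 h₂ t)) : ℂ) * T f)
      (T fun x => fderiv ℝ f x (infAct n P x)) 0 := by
  have hc := contDiff_idemFlow P
  have hK : IsCompact (idemFlow P '' (Set.Icc (-1) 1 ×ˢ tsupport f)) :=
    (isCompact_Icc.prod hf.compact).image hc.continuous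
  have h := hL.hasDerivAt (Ψ := fun s => f (idemFlow P s)) (hf.smooth.comp hc) hK
    (fun t ht x hx => by
      by_contra hne
      refine hx ⟨(-t, idemFlow P (t, x)), ⟨⟨?_, ?_⟩, subset_tsupport f hne⟩, ?_⟩
      · exact neg_le_neg (abs_le.1 ht).2
      · exact neg_le.1 (abs_le.1 ht).1
      · rw [idemFlow_eq_pairAct h₁ h₂, idemFlow_eq_pairAct h₁ h₂]
        have h3 : ∀ (p : Matrix (Fin n) (Fin n) ℝ) (hp : p * p = p),
            expUnit p hp (-t) = (expUnit p hp t)⁻¹ := fun p hp => Units.ext rfl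
        rw [h3, h3, pairAct_inv_apply])
  refine (h.congr_deriv ?_).congr_of_eventuallyEq (Filter.Eventually.of_forall fun t => ?_)
  · congr 1
    funext x
    have h4 : (fun s => f (idemFlow P s)) = f ∘ idemFlow P := rfl
    have h5 : idemFlow P (0, x) = x := by simp [idemFlow]
    rw [h4, fderiv_comp _ (hf.smooth.differentiable (by simp)).differentiableAt
      (hc.differentiable (by simp)).differentiableAt, ContinuousLinearMap.comp_apply,
      fderiv_idemFlow, h5]
  · exact (hT _ _ f hf).symm

end

section
attribute [local instance] matrixNormTopology

variable {n : ℕ}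

/-- The exponential of a real number as a unit. -/
noncomputable def realExpUnit (t : ℝ) : ℝˣ := Units.mk0 (Real.exp t) (Real.exp_ne_zero t)

theorem realExpUnit_add (s t : ℝ) : realExpUnit (s + t) = realExpUnit s * realExpUnit t :=
  Units.ext (Real.exp_add s t)

theorem realExpUnit_zero : realExpUnit 0 = 1 := Units.ext Real.exp_zero

theorem det_expUnit_zero (hp : (0 : Matrix (Fin n) (Fin n) ℝ) * 0 = 0) (t : ℝ) :
    Units.map Matrix.detMonoidHom (expUnit 0 hp t) = 1 :=
  Units.ext (by simp [expUnit])

theorem vecMulVec_mul_self {u v : Fin n → ℝ} (huv : v ⬝ᵥ u = 1) :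
    vecMulVec u v * vecMulVec u v = vecMulVec u v := by
  rw [vecMulVec_mul_vecMulVec, huv, one_smul]

theorem det_expUnit_vecMulVec {u v : Fin n → ℝ} (huv : v ⬝ᵥ u = 1) (t : ℝ) :
    Units.map Matrix.detMonoidHom (expUnit (vecMulVec u v) (vecMulVec_mul_self huv) t) =
      realExpUnit t := by
  refine Units.ext ?_
  change det (1 + (Real.exp t - 1) • vecMulVec u v) = Real.exp t
  rw [← smul_vecMulVec, vecMulVec_eq Unit, det_one_add_replicateCol_mul_replicateRow,
    dotProduct_smul, huv]
  simp

/-- Two linear functionals on matrices which agree on rank one idempotents agree. -/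
theorem eq_of_eq_vecMulVec {φ ψ : Matrix (Fin n) (Fin n) ℝ →ₗ[ℝ] ℂ}
    (h : ∀ u v : Fin n → ℝ, v ⬝ᵥ u = 1 → φ (vecMulVec u v) = ψ (vecMulVec u v)) : φ = ψ := by
  have hs : ∀ i j, vecMulVec (Pi.single i (1 : ℝ)) (Pi.single j 1) =
      (single i j 1 : Matrix (Fin n) (Fin n) ℝ) :=
    fun i j => (single_eq_single_vecMulVec_single i j).symm
  refine (Matrix.stdBasis ℝ (Fin n) (Fin n)).ext fun s => ?_
  rw [stdBasis_eq_single _ s.1 s.2]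
  have h1 := h (Pi.single s.1 1) (Pi.single s.1 1) (by simp)
  by_cases hij : s.1 = s.2
  · rw [← hij, ← hs]; exact h1
  · have h2 := h (Pi.single s.1 1) (Pi.single s.1 1 + Pi.single s.2 1) (by simp [hij])
    rw [vecMulVec_add, map_add, map_add, h1, hs s.1 s.2] at h2
    exact add_left_cancel h2

theorem eq_exp_of_hasDerivAt {φ : ℝ → ℂ} (h0 : φ 0 = 1) (hadd : ∀ s t, φ (s + t) = φ s * φ t)
    {a : ℂ} (ha : HasDerivAt φ a 0) (t : ℝ) : φ t = Complex.exp (a * t) := by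
  have hd : ∀ t, HasDerivAt φ (φ t * a) t := fun t => by
    have h1 : HasDerivAt (fun u => φ (u - t)) a t := by
      have := HasDerivAt.comp_sub_const (f := φ) t t (by rwa [sub_self])
      exact this
    refine (h1.const_mul (φ t)).congr_of_eventuallyEq (Filter.Eventually.of_forall fun u => ?_)
    change φ u = φ t * φ (u - t)
    rw [← hadd]; congr 1; ring
  have he : ∀ t : ℝ, HasDerivAt (fun u : ℝ => Complex.exp (-(a * u)))
      (Complex.exp (-(a * t)) * -a) t := fun t => by
    have h1 : HasDerivAt (fun u : ℝ => -(a * (u : ℂ))) (-a) t := by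
      simpa using ((Complex.ofRealCLM.hasDerivAt (x := t)).const_mul a).fun_neg
    exact h1.cexp
  have hconst : ∀ t, φ t * Complex.exp (-(a * t)) = φ 0 * Complex.exp (-(a * (0 : ℝ))) := fun t =>
    is_const_of_deriv_eq_zero (f := fun t : ℝ => φ t * Complex.exp (-(a * t)))
      (fun t => ((hd t).mul (he t)).differentiableAt) (fun t => by
        have := ((hd t).mul (he t)).deriv
        refine this.trans ?_
        ring) t 0
  have h2 := hconst t
  rw [h0] at h2
  simp only [Complex.ofReal_zero, mul_zero, neg_zero, Complex.exp_zero, mul_one] at h2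
  rw [Complex.exp_neg, mul_inv_eq_one₀ (Complex.exp_ne_zero _)] at h2
  exact h2

/-- A nonzero equivariant functional of finite order forces `η` to be an exponential on positive
reals, and is quasi-invariant under the Lie algebra. -/
theorem IsEquivariant.exists_exponent (hn : 0 < n) {η : ℝˣ →* ℂˣ} {T : (MatPair n → ℂ) →ₗ[ℂ] ℂ}
    (hT : IsEquivariant η T) {L : ℕ} (hL : HasOrderLE T L) {f₀ : MatPair n → ℂ}
    (hf₀ : IsTestFun Set.univ f₀) (hne : T f₀ ≠ 0) :
    ∃ s : ℂ, (∀ t : ℝ, (η (realExpUnit t) : ℂ) = Complex.exp (s * t)) ∧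
      ∀ (A : MatPair n) (f : MatPair n → ℂ), IsTestFun Set.univ f →
        T (fun x => fderiv ℝ f x (infAct n A x)) =
          s * ((A.2.trace : ℂ) - (A.1.trace : ℂ)) * T f := by
  have h00 : (0 : Matrix (Fin n) (Fin n) ℝ) * 0 = 0 := mul_zero 0
  have h2 : ∀ (u v : Fin n → ℝ), v ⬝ᵥ u = 1 → ∀ f, IsTestFun Set.univ f →
      HasDerivAt (fun t => (η (realExpUnit t) : ℂ) * T f)
        (T fun x => fderiv ℝ f x (infAct n (0, vecMulVec u v) x)) 0 := fun u v huv f hf => by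
    have := hT.hasDerivAt hL (P := (0, vecMulVec u v)) h00 (vecMulVec_mul_self huv) hf
    simpa only [det_expUnit_zero, det_expUnit_vecMulVec huv, map_one, Units.val_one, inv_one,
      one_mul] using this
  have h1 : ∀ (u v : Fin n → ℝ), v ⬝ᵥ u = 1 → ∀ f, IsTestFun Set.univ f →
      HasDerivAt (fun t => ((η (realExpUnit t) : ℂ))⁻¹ * T f)
        (T fun x => fderiv ℝ f x (infAct n (vecMulVec u v, 0) x)) 0 := fun u v huv f hf => by
    have := hT.hasDerivAt hL (P := (vecMulVec u v, 0)) (vecMulVec_mul_self huv) h00 hf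
    simpa only [det_expUnit_zero, det_expUnit_vecMulVec huv, map_one, Units.val_one,
      mul_one] using this
  obtain ⟨s, hs⟩ : ∃ s, HasDerivAt (fun t => (η (realExpUnit t) : ℂ)) s 0 := by
    have h3 := (h2 (Pi.single ⟨0, hn⟩ 1) (Pi.single ⟨0, hn⟩ 1) (by simp) f₀ hf₀).mul_const (T f₀)⁻¹
    simp only [mul_assoc, mul_inv_cancel₀ hne, mul_one] at h3
    exact ⟨_, h3⟩
  have hexp : ∀ t : ℝ, (η (realExpUnit t) : ℂ) = Complex.exp (s * t) :=
    eq_exp_of_hasDerivAt (φ := fun t => (η (realExpUnit t) : ℂ)) (by simp [realExpUnit_zero])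
      (fun a b => by simp [realExpUnit_add]) hs
  have hs' : HasDerivAt (fun t => ((η (realExpUnit t) : ℂ))⁻¹) (-s) 0 := by
    have := hs.fun_inv (Units.ne_zero _)
    simpa [realExpUnit_zero] using this
  refine ⟨s, hexp, fun A f hf => ?_⟩
  have hsm : ∀ x, DifferentiableAt ℝ f x := fun x => hf.smooth.differentiable (by simp) x
  let X : MatPair n →ₗ[ℝ] ℂ :=
    { toFun := fun A => T fun x => fderiv ℝ f x (infAct n A x)
      map_add' := fun A B => by
        rw [← map_add]; congr 1; funext x
        rw [map_add, LinearMap.add_apply, map_add]; rfl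
      map_smul' := fun c A => by
        have : (fun x => fderiv ℝ f x (infAct n (c • A) x)) =
            (c : ℂ) • fun x => fderiv ℝ f x (infAct n A x) := by
          funext x
          rw [map_smul, LinearMap.smul_apply, map_smul, Pi.smul_apply, Complex.coe_smul]
        rw [this, map_smul]
        exact Complex.coe_smul c _ }
  let τ : Matrix (Fin n) (Fin n) ℝ →ₗ[ℝ] ℂ :=
    Complex.ofRealCLM.toLinearMap.comp (Matrix.traceLinearMap (Fin n) ℝ ℝ)
  have hτ : ∀ u v : Fin n → ℝ, v ⬝ᵥ u = 1 → τ (vecMulVec u v) = 1 := fun u v huv => by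
    change ((trace (vecMulVec u v) : ℝ) : ℂ) = 1
    rw [trace_vecMulVec, dotProduct_comm, huv, Complex.ofReal_one]
  have e1 : X.comp (LinearMap.inl ℝ _ _) = (LinearMap.mulLeft ℝ (-s * T f)).comp τ :=
    eq_of_eq_vecMulVec fun u v huv => by
      rw [LinearMap.comp_apply, LinearMap.comp_apply, hτ u v huv, LinearMap.mulLeft_apply, mul_one]
      exact (h1 u v huv f hf).unique (hs'.mul_const _)
  have e2 : X.comp (LinearMap.inr ℝ _ _) = (LinearMap.mulLeft ℝ (s * T f)).comp τ :=
    eq_of_eq_vecMulVec fun u v huv => by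
      rw [LinearMap.comp_apply, LinearMap.comp_apply, hτ u v huv, LinearMap.mulLeft_apply, mul_one]
      exact (h2 u v huv f hf).unique (hs.mul_const _)
  have e3 : X A = X (A.1, 0) + X (0, A.2) := by rw [← map_add]; simp
  have e4 : X (A.1, 0) = -s * T f * A.1.trace := LinearMap.congr_fun e1 A.1
  have e5 : X (0, A.2) = s * T f * A.2.trace := LinearMap.congr_fun e2 A.2
  change X A = _
  rw [e3, e4, e5]
  ring

end

section
attribute [local instance] matrixNormTopology

variable {n : ℕ}

theorem isClosed_nilpotentCone (n : ℕ) : IsClosed (nilpotentCone n) := by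
  have h : ∀ k : ℕ, Continuous fun p : MatPair n => (p.1 * p.2) ^ k := fun k => by
    induction k with
    | zero => simpa using continuous_const
    | succ k ih =>
      simp only [pow_succ]
      exact Continuous.matrix_mul ih (Continuous.matrix_mul continuous_fst continuous_snd)
  exact isClosed_eq (h n) (continuous_const (y := (0 : Matrix (Fin n) (Fin n) ℝ)))

theorem contDiff_infAct_apply (A : MatPair n) : ContDiff ℝ ∞ fun x => infAct n A x :=
  (LinearMap.toContinuousLinearMap (infAct n A)).contDiff

/-- Quasi-invariance along constant Lie algebra elements implies quasi-invariance along vector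
fields tangent to the orbits with smooth coefficients. -/
theorem exists_contDiff_apply_infAct {T : (MatPair n → ℂ) →ₗ[ℂ] ℂ} {χ : MatPair n → ℂ}
    (hχ : ∀ A f, IsTestFun Set.univ f → T (fun x => fderiv ℝ f x (infAct n A x)) = χ A * T f)
    {G : MatPair n → MatPair n} (hG : ContDiff ℝ ∞ G) :
    ∃ a : MatPair n → ℂ, ContDiff ℝ ∞ a ∧ ∀ f, IsTestFun Set.univ f →
      T (fun x => fderiv ℝ f x (infAct n (G x) x)) = T fun x => a x * f x := by
  let c := pairBasis n
  let g : (Fin n × Fin n) ⊕ (Fin n × Fin n) → MatPair n → ℝ := fun s x => c.coord s (G x)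
  have hg : ∀ s, ContDiff ℝ ∞ (g s) := fun s =>
    (LinearMap.toContinuousLinearMap (c.coord s)).contDiff.comp hG
  have hgC : ∀ s, ContDiff ℝ ∞ fun x => (g s x : ℂ) := fun s =>
    Complex.ofRealCLM.contDiff.comp (hg s)
  have hXg : ∀ s, ContDiff ℝ ∞ fun x => ((fderiv ℝ (g s) x (infAct n (c s) x) : ℝ) : ℂ) := fun s =>
    Complex.ofRealCLM.contDiff.comp
      (((hg s).fderiv_right (by simp)).clm_apply (contDiff_infAct_apply (c s)))
  refine ⟨fun x => ∑ s, (χ (c s) * g s x - (fderiv ℝ (g s) x (infAct n (c s) x) : ℝ)),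
    ContDiff.sum fun s _ => (contDiff_const.mul (hgC s)).sub (hXg s), fun f hf => ?_⟩
  have e1 : (fun x => fderiv ℝ f x (infAct n (G x) x)) =
      ∑ s, ((fun x => fderiv ℝ (fun y => (g s y : ℂ) * f y) x (infAct n (c s) x)) -
        fun x => ((fderiv ℝ (g s) x (infAct n (c s) x) : ℝ) : ℂ) * f x) := by
    funext x
    rw [Finset.sum_apply]
    conv_lhs => rw [← c.sum_repr (G x), map_sum, LinearMap.sum_apply, map_sum]
    refine Finset.sum_congr rfl fun s _ => ?_
    rw [Pi.sub_apply, fderiv_ofReal_mul (hg s) hf.smooth, map_smul, LinearMap.smul_apply, map_smul,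
      add_sub_cancel_left, Complex.real_smul]
    rfl
  have e2 : (fun x => (∑ s, (χ (c s) * g s x - (fderiv ℝ (g s) x (infAct n (c s) x) : ℝ))) * f x) =
      ∑ s, (χ (c s) • (fun x => (g s x : ℂ) * f x) -
        fun x => ((fderiv ℝ (g s) x (infAct n (c s) x) : ℝ) : ℂ) * f x) := by
    funext x
    rw [Finset.sum_apply, Finset.sum_mul]
    refine Finset.sum_congr rfl fun s _ => ?_
    simp only [Pi.sub_apply, Pi.smul_apply, smul_eq_mul]
    ring
  rw [e1, e2, map_sum, map_sum]
  refine Finset.sum_congr rfl fun s _ => ?_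
  rw [map_sub, map_sub, map_smul, hχ _ _ (hf.mul_left (hgC s)), smul_eq_mul]

theorem IsTestFun.comp_pairAct {U : Set (MatPair n)} {f : MatPair n → ℂ} (hf : IsTestFun U f)
    (g h : (Matrix (Fin n) (Fin n) ℝ)ˣ) :
    IsTestFun (pairAct g h ⁻¹' U) fun x => f (pairAct g h x) := by
  refine ⟨hf.smooth.comp (pairAct g h).contDiff,
    hf.compact.comp_homeomorph (pairAct g h).toHomeomorph, ?_⟩
  exact (tsupport_comp_subset_preimage f (pairAct g h).continuous).trans
    (Set.preimage_mono hf.supp)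

theorem IsEquivariant.pairAct_mem_distSupport {η : ℝˣ →* ℂˣ} {T : (MatPair n → ℂ) →ₗ[ℂ] ℂ}
    (hT : IsEquivariant η T) (g h : (Matrix (Fin n) (Fin n) ℝ)ˣ) {p : MatPair n}
    (hp : p ∈ distSupport T) : pairAct g h p ∈ distSupport T := by
  intro U hU hpU hv
  refine hp (pairAct g h ⁻¹' U) (hU.preimage (pairAct g h).continuous) hpU fun f hf => ?_
  have h1 := hf.comp_pairAct g⁻¹ h⁻¹
  have h2 : pairAct g⁻¹ h⁻¹ ⁻¹' (pairAct g h ⁻¹' U) = U := by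
    ext x
    have : pairAct g h (pairAct g⁻¹ h⁻¹ x) = x := by
      simpa using pairAct_inv_apply g⁻¹ h⁻¹ x
    simp [this]
  rw [h2] at h1
  have h3 := hT g⁻¹ h⁻¹ f (hf.mono (Set.subset_univ _))
  rw [hv _ h1] at h3
  refine (mul_eq_zero.1 h3.symm).resolve_left (mul_ne_zero (inv_ne_zero ?_) ?_) <;>
    exact Units.ne_zero _

/-- For a good character the exponent avoids the critical values. -/
theorem IsGoodChar.two_mul_ne {η : ℝˣ →* ℂˣ} (hη : IsGoodChar n η) (hn : 0 < n) {s : ℂ}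
    (hs : ∀ t, (η (realExpUnit t) : ℂ) = Complex.exp (s * t)) {r M : ℤ} (hr : |r| ≤ n)
    (hM : 0 < M) : 2 * (r : ℂ) * s ≠ M := by
  intro h
  have hr0 : r ≠ 0 := by
    rintro rfl
    rw [Int.cast_zero, mul_zero, zero_mul] at h
    exact hM.ne (by exact_mod_cast h)
  have hsq : ∀ t : ℝˣ, (η t : ℂ) ^ (2 * r) = ((|(t : ℝ)| ^ M : ℝ) : ℂ) := by
    intro t
    have ht : 0 < |(t : ℝ)| := abs_pos.2 t.ne_zero
    have h1 : t ^ 2 = realExpUnit (2 * Real.log |(t : ℝ)|) := Units.ext (by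
      change (t : ℝ) ^ 2 = Real.exp _
      rw [two_mul, Real.exp_add, Real.exp_log ht, ← sq, sq_abs])
    have h2 : (η t : ℂ) ^ 2 = Complex.exp (s * ((2 * Real.log |(t : ℝ)| : ℝ) : ℂ)) := by
      rw [← hs, ← h1, map_pow, Units.val_pow_eq_pow_val]
    rw [_root_.zpow_mul, zpow_ofNat, h2, ← Complex.exp_int_mul]
    have h3 : (r : ℂ) * (s * ((2 * Real.log |(t : ℝ)| : ℝ) : ℂ)) =
        (M : ℂ) * (Real.log |(t : ℝ)| : ℝ) := by
      rw [← h]; push_cast; ring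
    rw [h3, Complex.exp_int_mul, ← Complex.ofReal_exp, Real.exp_log ht, Complex.ofReal_zpow]
  have key : ∀ m : ℕ, 1 ≤ m → m ≤ 2 * n ^ 2 → ∀ j : ℕ, M = m + 2 * j → False := by
    intro m h1 h2 j hj
    refine hη r hr0 hr m h1 h2 ⟨2 * j, fun t => ?_⟩
    have ht : |(t : ℝ)| ≠ 0 := (abs_pos.2 t.ne_zero).ne'
    change (η t : ℂ) ^ (2 * r) * ((|(t : ℝ)| ^ (-(m : ℤ)) : ℝ) : ℂ) = _
    rw [hsq, ← Complex.ofReal_mul, ← zpow_add₀ ht, ← Complex.ofReal_pow]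
    congr 1
    rw [show M + -(m : ℤ) = ((2 * j : ℕ) : ℤ) by rw [hj]; push_cast; ring, zpow_natCast]
    rw [pow_mul, pow_mul, sq_abs]
  have hn2 : 1 ≤ n ^ 2 := Nat.one_le_pow _ _ hn
  rcases Int.even_or_odd M with hev | hod
  · obtain ⟨k, hk⟩ := hev
    exact key 2 (by norm_num) (by omega) (k - 1).toNat (by omega)
  · obtain ⟨k, hk⟩ := hod
    exact key 1 le_rfl (by omega) k.toNat (by omega)

/-- An equivariant functional for a good character supported in the nilpotent cone which is
homogeneous of a critical degree vanishes. -/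
theorem IsEquivariant.eq_zero_of_euler (hn : 0 < n) {η : ℝˣ →* ℂˣ} (hη : IsGoodChar n η)
    {T : (MatPair n → ℂ) →ₗ[ℂ] ℂ} (hT : IsEquivariant η T) {L : ℕ} (hL : HasOrderLE T L)
    (hN : VanishesOn T (nilpotentCone n)ᶜ) {b : ℕ}
    (hE : ∀ f, IsTestFun Set.univ f →
      T (fun x => fderiv ℝ f x x) = (-((n : ℂ) ^ 2) - b) * T f) :
    VanishesOn T Set.univ := by
  intro f₀ hf₀
  by_contra hne
  obtain ⟨s, hs, hχ⟩ := hT.exists_exponent hn hL hf₀ hne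
  have hZN : distSupport T ⊆ nilpotentCone n := fun p hp => by
    by_contra hpN
    exact hp _ (isClosed_nilpotentCone n).isOpen_compl hpN hN
  have hZ : (distSupport T).Nonempty := by
    by_contra hemp
    rw [Set.not_nonempty_iff_eq_empty] at hemp
    have := vanishesOn_compl_distSupport T
    rw [hemp, Set.compl_empty] at this
    exact hne (this f₀ hf₀)
  obtain ⟨p, hp, hmax⟩ : ∃ p ∈ distSupport T, ∀ z ∈ distSupport T,
      Module.finrank ℝ (LinearMap.range ((infAct n).flip z)) ≤
        Module.finrank ℝ (LinearMap.range ((infAct n).flip p)) := by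
    let ν : MatPair n → ℕ := fun z => Module.finrank ℝ (LinearMap.range ((infAct n).flip z))
    have hbdd : BddAbove (ν '' distSupport T) := ⟨Module.finrank ℝ (MatPair n), by
      rintro _ ⟨z, -, rfl⟩
      exact Submodule.finrank_le _⟩
    obtain ⟨p, hp, hpmax⟩ := Nat.sSup_mem (hZ.image ν) hbdd
    exact ⟨p, hp, fun z hz => (le_csSup hbdd ⟨z, hz, rfl⟩).trans hpmax.ge⟩
  obtain ⟨g, h, I, J, _, _, ⟨D⟩⟩ := exists_pairAct_adaptedBasis hn (hZN hp)
  have he := hT.pairAct_mem_distSupport g h hp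
  obtain ⟨U, 𝒞, G, hG, hd, hv⟩ := D.exists_chart_of_maximal hn
    (fun g h p hp => hT.pairAct_mem_distSupport g h hp) hZN
    (fun z hz => by rw [finrank_range_infAct_pairAct]; exact hmax z hz)
  choose a ha haT using fun i => exists_contDiff_apply_infAct hχ (hG i)
  obtain ⟨U', hU', heU', hvan⟩ := 𝒞.exists_vanishesOn ha _ T
    (s * ((D.h.2.trace : ℂ) - (D.h.1.trace : ℂ)) - 2 * (-((n : ℂ) ^ 2) - b)) (fun _ => L + 1)
    (fun f hf => by
      have hf' := hf.mono (Set.subset_univ _)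
      have e : (fun x => fderiv ℝ f x (D.field x)) =
          (fun x => fderiv ℝ f x (infAct n D.h x)) - (2 : ℂ) • fun x => fderiv ℝ f x x := by
        funext x
        rw [D.field_apply, map_sub, map_smul]
        simp [Complex.real_smul]
      rw [e, map_sub, map_smul, hχ _ _ hf', hE _ hf', smul_eq_mul]
      ring)
    (fun i f hf => by
      simp only [hd]
      exact haT i f (hf.mono (Set.subset_univ _)))
    (fun j f hf => hL.pow_mul_eq_zero (vanishesOn_compl_distSupport T) (𝒞.contDiff_v j) (hv j) hf)
    (fun α h0 => by
      rw [D.trace_fst, D.trace_snd] at h0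
      refine hη.two_mul_ne hn hs D.abs_r (M := 2 * n ^ 2 + 2 * b - ∑ j, (α j : ℤ) * D.w j +
        ∑ i, D.β i) ?_ ?_
      · have h1 : ∑ j, (α j : ℤ) * D.w j ≤ 0 := Finset.sum_nonpos fun j _ =>
          mul_nonpos_of_nonneg_of_nonpos (Int.natCast_nonneg _) (D.w_neg j).le
        have h2 := D.sum_β
        have h3 : (0 : ℤ) ≤ b := Int.natCast_nonneg b
        linarith
      · push_cast at h0 ⊢
        linear_combination -h0) rfl
  exact he U' hU' heU' hvan

end

section

/-- In a Weyl algebra, `∑ p q` and `∑ a b` form an `sl₂`-triple with the shifted Euler operator. -/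
theorem weyl_commutator {R κ : Type*} [Ring R] [Fintype κ] [DecidableEq κ] {a b p q : κ → R}
    (hbp : ∀ s t, p s * b t = b t * p s) (hqa : ∀ s t, q s * a t = a t * q s)
    (hpa : ∀ s t, p s * a t = a t * p s + if s = t then 1 else 0)
    (hqb : ∀ s t, q s * b t = b t * q s + if s = t then 1 else 0) :
    (∑ s, p s * q s) * (∑ s, a s * b s) = (∑ s, a s * b s) * (∑ s, p s * q s) +
      (∑ s, (a s * p s + b s * q s) + (Fintype.card κ : R)) := by
  have h : ∀ s t, p s * q s * (a t * b t) = a t * b t * (p s * q s) +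
      if s = t then a s * p s + b s * q s + 1 else 0 := fun s t => by
    have h1 : p s * q s * (a t * b t) = p s * a t * (q s * b t) := by
      rw [mul_assoc, ← mul_assoc (q s), hqa, mul_assoc, ← mul_assoc]
    rw [h1, hpa, hqb]
    split_ifs with hst
    · subst hst
      have h2 : a s * p s * (b s * q s) = a s * b s * (p s * q s) := by
        rw [mul_assoc, ← mul_assoc (p s), hbp, mul_assoc, ← mul_assoc]
      rw [add_mul, mul_add, one_mul, mul_one, h2]
      abel
    · rw [add_zero, add_zero, add_zero, mul_assoc, ← mul_assoc (p s), hbp, mul_assoc, ← mul_assoc]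
  rw [Finset.sum_mul_sum, Finset.sum_mul_sum, Finset.sum_comm]
  have h3 : (Fintype.card κ : R) = ∑ _s : κ, (1 : R) := by simp
  rw [h3, ← Finset.sum_add_distrib, ← Finset.sum_add_distrib]
  refine Finset.sum_congr rfl fun t _ => ?_
  rw [Finset.sum_congr rfl fun s _ => h s t, Finset.sum_add_distrib]
  simp

theorem weyl_euler_commutator {R κ : Type*} [Ring R] [Fintype κ] [DecidableEq κ] {a b p q : κ → R}
    (hba : ∀ s t, b s * a t = a t * b s)
    (hbp : ∀ s t, p s * b t = b t * p s) (hqa : ∀ s t, q s * a t = a t * q s)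
    (hpa : ∀ s t, p s * a t = a t * p s + if s = t then 1 else 0)
    (hqb : ∀ s t, q s * b t = b t * q s + if s = t then 1 else 0)
    (haa : ∀ s t, a s * a t = a t * a s) (hbb : ∀ s t, b s * b t = b t * b s) :
    (∑ s, (a s * p s + b s * q s)) * (∑ s, a s * b s) =
      (∑ s, a s * b s) * (∑ s, (a s * p s + b s * q s)) + 2 * ∑ s, a s * b s := by
  have h : ∀ s t, (a s * p s + b s * q s) * (a t * b t) = a t * b t * (a s * p s + b s * q s) +
      if s = t then 2 * (a s * b s) else 0 := fun s t => by
    have h1 : a s * p s * (a t * b t) = a t * b t * (a s * p s) +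
        if s = t then a s * b s else 0 := by
      rw [mul_assoc, ← mul_assoc (p s), hpa, add_mul, mul_add, mul_assoc, hbp, ← mul_assoc (a t),
        ← mul_assoc, ← mul_assoc (a s), haa, mul_assoc (a t), mul_assoc (a t), ← hba t s]
      split_ifs with hst
      · subst hst; simp [mul_assoc]
      · simp [mul_assoc]
    have h2 : b s * q s * (a t * b t) = a t * b t * (b s * q s) +
        if s = t then a s * b s else 0 := by
      rw [mul_assoc, ← mul_assoc (q s), hqa, mul_assoc, hqb, mul_add, mul_add, ← mul_assoc (b s),
        ← mul_assoc (b s), hba, mul_assoc (a t), ← mul_assoc (b s), hbb]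
      split_ifs with hst
      · subst hst; simp [mul_assoc]
      · simp [mul_assoc]
    rw [add_mul, h1, h2, mul_add]
    split_ifs
    · rw [two_mul]; abel
    · simp
  rw [Finset.sum_mul_sum, Finset.sum_mul_sum, Finset.sum_comm, Finset.mul_sum,
    ← Finset.sum_add_distrib]
  refine Finset.sum_congr rfl fun t _ => ?_
  rw [Finset.sum_congr rfl fun s _ => h s t, Finset.sum_add_distrib]
  simp

variable {V : Type*} [NormedAddCommGroup V] [NormedSpace ℝ V]

/-- Multiplication of Schwartz functions by a real linear functional. -/
noncomputable def linMul (ℓ : V →L[ℝ] ℝ) : 𝓢(V, ℂ) →L[ℂ] 𝓢(V, ℂ) :=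
  smulLeftCLM ℂ fun x => (ℓ x : ℂ)

/-- The derivative of Schwartz functions in a fixed direction. -/
noncomputable def dirDeriv (v : V) : 𝓢(V, ℂ) →L[ℂ] 𝓢(V, ℂ) :=
  LineDeriv.lineDerivOpCLM ℂ 𝓢(V, ℂ) v

theorem hasTemperateGrowth_ofReal_clm (ℓ : V →L[ℝ] ℝ) :
    (fun x => (ℓ x : ℂ)).HasTemperateGrowth :=
  (Complex.ofRealCLM.comp ℓ).hasTemperateGrowth

@[simp] theorem linMul_apply (ℓ : V →L[ℝ] ℝ) (φ : 𝓢(V, ℂ)) (x : V) :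
    linMul ℓ φ x = ℓ x * φ x :=
  smulLeftCLM_apply_apply (hasTemperateGrowth_ofReal_clm ℓ) φ x

theorem dirDeriv_apply (v : V) (φ : 𝓢(V, ℂ)) (x : V) : dirDeriv v φ x = fderiv ℝ φ x v := rfl

theorem linMul_mul_comm (ℓ ℓ' : V →L[ℝ] ℝ) : linMul ℓ * linMul ℓ' = linMul ℓ' * linMul ℓ := by
  ext φ x
  change linMul ℓ (linMul ℓ' φ) x = linMul ℓ' (linMul ℓ φ) x
  simp only [linMul_apply]
  ring

theorem dirDeriv_mul_linMul (v : V) (ℓ : V →L[ℝ] ℝ) :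
    dirDeriv v * linMul ℓ = linMul ℓ * dirDeriv v + (ℓ v : ℂ) • 1 := by
  ext φ x
  change dirDeriv v (linMul ℓ φ) x = linMul ℓ (dirDeriv v φ) x + (ℓ v : ℂ) • φ x
  have h : (linMul ℓ φ : V → ℂ) = fun y => (ℓ y : ℂ) * φ y := funext (linMul_apply ℓ φ)
  rw [dirDeriv_apply, h, fderiv_ofReal_mul ℓ.contDiff (φ.smooth _), linMul_apply, dirDeriv_apply]
  simp [add_comm]

theorem dirDeriv_dirDeriv_apply (v w : V) (φ : 𝓢(V, ℂ)) (x : V) :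
    dirDeriv v (dirDeriv w φ) x = fderiv ℝ (fderiv ℝ φ) x v w := by
  have h1 : (dirDeriv w φ : V → ℂ) = fun y => fderiv ℝ φ y w := funext (dirDeriv_apply w φ)
  have h2 : ContDiff ℝ 1 (fderiv ℝ φ) := (φ.smooth 2).fderiv_right (by norm_num)
  rw [dirDeriv_apply, h1, fderiv_clm_apply (h2.differentiable (by simp)).differentiableAt
    (differentiableAt_const w)]
  simp

end

section
attribute [local instance] matrixNormTopology

variable {n : ℕ}

/-- The coordinate `p ↦ p.1 i j`. -/
noncomputable def fstCoord (s : Fin n × Fin n) : MatPair n →L[ℝ] ℝ :=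
  LinearMap.toContinuousLinearMap
    ((Matrix.entryLinearMap ℝ ℝ s.1 s.2).comp (LinearMap.fst ℝ _ _))

/-- The coordinate `p ↦ p.2 j i`. -/
noncomputable def sndCoord (s : Fin n × Fin n) : MatPair n →L[ℝ] ℝ :=
  LinearMap.toContinuousLinearMap
    ((Matrix.entryLinearMap ℝ ℝ s.2 s.1).comp (LinearMap.snd ℝ _ _))

theorem fstCoord_apply (s : Fin n × Fin n) (p : MatPair n) : fstCoord s p = p.1 s.1 s.2 := rfl

theorem sndCoord_apply (s : Fin n × Fin n) (p : MatPair n) : sndCoord s p = p.2 s.2 s.1 := rfl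

/-- The basis vector dual to `fstCoord`. -/
def fstVec (s : Fin n × Fin n) : MatPair n := (single s.1 s.2 1, 0)

/-- The basis vector dual to `sndCoord`. -/
def sndVec (s : Fin n × Fin n) : MatPair n := (0, single s.2 s.1 1)

variable (n) in
/-- Multiplication by `tr (x y)`. -/
noncomputable def traceMul : 𝓢(MatPair n, ℂ) →L[ℂ] 𝓢(MatPair n, ℂ) :=
  ∑ s, linMul (fstCoord s) * linMul (sndCoord s)

variable (n) in
/-- The constant coefficient differential operator dual to `tr (x y)`. -/
noncomputable def traceLaplacian : 𝓢(MatPair n, ℂ) →L[ℂ] 𝓢(MatPair n, ℂ) :=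
  ∑ s, dirDeriv (fstVec s) * dirDeriv (sndVec s)

variable (n) in
/-- The Euler operator. -/
noncomputable def eulerOp : 𝓢(MatPair n, ℂ) →L[ℂ] 𝓢(MatPair n, ℂ) :=
  ∑ s, (linMul (fstCoord s) * dirDeriv (fstVec s) + linMul (sndCoord s) * dirDeriv (sndVec s))

theorem traceMul_apply (φ : 𝓢(MatPair n, ℂ)) (p : MatPair n) :
    traceMul n φ p = ((p.1 * p.2).trace : ℝ) * φ p := by
  rw [traceMul, _root_.sum_apply, _root_.sum_apply]
  have h : ∀ s, (linMul (fstCoord s) * linMul (sndCoord s)) φ p =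
      ((p.1 s.1 s.2 * p.2 s.2 s.1 : ℝ) : ℂ) * φ p := fun s => by
    change linMul (fstCoord s) (linMul (sndCoord s) φ) p = _
    rw [linMul_apply, linMul_apply, fstCoord_apply, sndCoord_apply]
    push_cast; ring
  simp only [h]
  rw [← Finset.sum_mul, ← Complex.ofReal_sum, Fintype.sum_prod_type]
  rfl

theorem sum_coord_smul (p : MatPair n) :
    ∑ s, (fstCoord s p • fstVec s + sndCoord s p • sndVec s) = p := by
  refine Prod.ext ?_ ?_
  · rw [Prod.fst_sum]
    conv_rhs => rw [matrix_eq_sum_single p.1]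
    rw [Fintype.sum_prod_type]
    simp [fstVec, sndVec, fstCoord_apply]
  · rw [Prod.snd_sum]
    conv_rhs => rw [matrix_eq_sum_single p.2, Finset.sum_comm]
    rw [Fintype.sum_prod_type]
    simp [fstVec, sndVec, sndCoord_apply]

theorem eulerOp_apply (φ : 𝓢(MatPair n, ℂ)) (p : MatPair n) :
    eulerOp n φ p = fderiv ℝ φ p p := by
  have h := congrArg (fderiv ℝ φ p) (sum_coord_smul p)
  rw [map_sum] at h
  rw [← h, eulerOp, _root_.sum_apply, _root_.sum_apply]
  refine Finset.sum_congr rfl fun s _ => ?_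
  change linMul (fstCoord s) (dirDeriv (fstVec s) φ) p +
    linMul (sndCoord s) (dirDeriv (sndVec s) φ) p = _
  rw [map_add, map_smul, map_smul, linMul_apply, linMul_apply, Complex.real_smul,
    Complex.real_smul]
  rfl

theorem traceLaplacian_apply (φ : 𝓢(MatPair n, ℂ)) (p : MatPair n) :
    traceLaplacian n φ p = ∑ s, fderiv ℝ (fderiv ℝ φ) p (fstVec s) (sndVec s) := by
  rw [traceLaplacian, _root_.sum_apply, _root_.sum_apply]
  exact Finset.sum_congr rfl fun s _ => dirDeriv_dirDeriv_apply _ _ _ _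

theorem linMul_coord_relations :
    (∀ s t : Fin n × Fin n, dirDeriv (fstVec s) * linMul (sndCoord t) =
      linMul (sndCoord t) * dirDeriv (fstVec s)) ∧
    (∀ s t : Fin n × Fin n, dirDeriv (sndVec s) * linMul (fstCoord t) =
      linMul (fstCoord t) * dirDeriv (sndVec s)) ∧
    (∀ s t : Fin n × Fin n, dirDeriv (fstVec s) * linMul (fstCoord t) =
      linMul (fstCoord t) * dirDeriv (fstVec s) + if s = t then 1 else 0) ∧
    (∀ s t : Fin n × Fin n, dirDeriv (sndVec s) * linMul (sndCoord t) =
      linMul (sndCoord t) * dirDeriv (sndVec s) + if s = t then 1 else 0) := by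
  refine ⟨fun s t => ?_, fun s t => ?_, fun s t => ?_, fun s t => ?_⟩ <;>
    rw [dirDeriv_mul_linMul]
  · simp [fstVec, sndCoord_apply]
  · simp [sndVec, fstCoord_apply]
  · simp only [fstVec, fstCoord_apply, single_apply, ← Prod.ext_iff]
    split_ifs <;> simp
  · have : (s.2 = t.2 ∧ s.1 = t.1) ↔ s = t := by rw [Prod.ext_iff, and_comm]
    simp only [sndVec, sndCoord_apply, single_apply, this]
    split_ifs <;> simp

theorem traceLaplacian_mul_traceMul :
    traceLaplacian n * traceMul n = traceMul n * traceLaplacian n +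
      (eulerOp n + ((n ^ 2 : ℕ) : 𝓢(MatPair n, ℂ) →L[ℂ] 𝓢(MatPair n, ℂ))) := by
  obtain ⟨h1, h2, h3, h4⟩ := linMul_coord_relations (n := n)
  have h := weyl_commutator h1 h2 h3 h4
  rwa [Fintype.card_prod, Fintype.card_fin, ← sq] at h

theorem eulerOp_mul_traceMul :
    eulerOp n * traceMul n = traceMul n * eulerOp n + 2 * traceMul n := by
  obtain ⟨h1, h2, h3, h4⟩ := linMul_coord_relations (n := n)
  exact weyl_euler_commutator (fun _ _ => linMul_mul_comm _ _) h1 h2 h3 h4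
    (fun _ _ => linMul_mul_comm _ _) (fun _ _ => linMul_mul_comm _ _)

end

section
attribute [local instance] matrixNormTopology

variable {n : ℕ}

theorem trace_eq_zero_of_mem_nilpotentCone {p : MatPair n} (hp : p ∈ nilpotentCone n) :
    (p.1 * p.2).trace = 0 :=
  (Matrix.isNilpotent_trace_of_isNilpotent ⟨n, hp⟩).eq_zero

theorem contDiff_trace_mul : ContDiff ℝ ∞ fun p : MatPair n => (p.1 * p.2).trace := by
  have h : (fun p : MatPair n => (p.1 * p.2).trace) =
      fun p => ∑ s : Fin n × Fin n, fstCoord s p * sndCoord s p := by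
    funext p
    rw [Fintype.sum_prod_type]
    rfl
  rw [h]
  exact ContDiff.sum fun s _ => (fstCoord s).contDiff.mul (sndCoord s).contDiff

/-- The action of a pair of invertible matrices on Schwartz functions. -/
noncomputable def pairComp (g h : (Matrix (Fin n) (Fin n) ℝ)ˣ) :
    𝓢(MatPair n, ℂ) →L[ℂ] 𝓢(MatPair n, ℂ) :=
  compCLMOfContinuousLinearEquiv ℂ (pairAct g h)

theorem pairComp_apply (g h : (Matrix (Fin n) (Fin n) ℝ)ˣ) (φ : 𝓢(MatPair n, ℂ)) (p : MatPair n) :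
    pairComp g h φ p = φ (pairAct g h p) := rfl

theorem traceMul_pairComp (g h : (Matrix (Fin n) (Fin n) ℝ)ˣ) (φ : 𝓢(MatPair n, ℂ)) :
    traceMul n (pairComp g h φ) = pairComp g h (traceMul n φ) := by
  ext p
  rw [traceMul_apply, pairComp_apply, pairComp_apply, traceMul_apply, pairAct_apply]
  congr 2
  have h1 : g.val * p.1 * h⁻¹.val * (h.val * p.2 * g⁻¹.val) = g.val * (p.1 * p.2) * g⁻¹.val := by
    simp only [mul_assoc, Units.inv_mul_cancel_left]
  rw [h1, trace_units_conj]

/-- The canonical tensor dual to `tr (x y)` is invariant under `pairAct`. -/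
theorem sum_bilin_pairAct (B : MatPair n →ₗ[ℝ] MatPair n →ₗ[ℝ] ℂ)
    (g h : (Matrix (Fin n) (Fin n) ℝ)ˣ) :
    ∑ s, B (pairAct g h (fstVec s)) (pairAct g h (sndVec s)) = ∑ s, B (fstVec s) (sndVec s) := by
  have h1 : ∀ s : Fin n × Fin n, pairAct g h (fstVec s) =
      ∑ t : Fin n × Fin n, (g.val t.1 s.1 * h⁻¹.val s.2 t.2) • fstVec t := fun s => by
    refine Prod.ext ?_ ?_
    · rw [Prod.fst_sum, pairAct_apply]
      change g.val * single s.1 s.2 1 * h⁻¹.val = _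
      ext i j
      rw [Matrix.sum_apply, Fintype.sum_prod_type]
      simp [fstVec, Matrix.mul_apply, single_apply, ite_and]
    · rw [Prod.snd_sum, pairAct_apply]
      simp [fstVec]
  have h2 : ∀ t : Fin n × Fin n, ∑ s : Fin n × Fin n,
      (g.val t.1 s.1 * h⁻¹.val s.2 t.2) • pairAct g h (sndVec s) = sndVec t := fun t => by
    have h3 : ∑ s : Fin n × Fin n, (g.val t.1 s.1 * h⁻¹.val s.2 t.2) • sndVec s =
        (pairAct g⁻¹ h⁻¹ (sndVec t) : MatPair n) := by
      refine Prod.ext ?_ ?_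
      · rw [Prod.fst_sum, pairAct_apply]
        simp [sndVec]
      · rw [Prod.snd_sum, pairAct_apply]
        change _ = h⁻¹.val * single t.2 t.1 1 * g.val
        ext i j
        rw [Matrix.sum_apply, Fintype.sum_prod_type]
        simp [sndVec, Matrix.mul_apply, single_apply, ite_and, mul_comm]
    have h4 := pairAct_inv_apply g⁻¹ h⁻¹ (sndVec t)
    rw [inv_inv, inv_inv, ← h3, map_sum] at h4
    simpa only [map_smul] using h4
  calc ∑ s, B (pairAct g h (fstVec s)) (pairAct g h (sndVec s))
      = ∑ s : Fin n × Fin n, ∑ t : Fin n × Fin n,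
          B (fstVec t) ((g.val t.1 s.1 * h⁻¹.val s.2 t.2) • pairAct g h (sndVec s)) := by
        refine Finset.sum_congr rfl fun s _ => ?_
        rw [h1, map_sum, LinearMap.sum_apply]
        refine Finset.sum_congr rfl fun t _ => ?_
        rw [map_smul, LinearMap.smul_apply, map_smul]
    _ = _ := by
        rw [Finset.sum_comm]
        refine Finset.sum_congr rfl fun t _ => ?_
        rw [← map_sum, h2]

theorem dirDeriv_pairComp (g h : (Matrix (Fin n) (Fin n) ℝ)ˣ) (v : MatPair n)
    (φ : 𝓢(MatPair n, ℂ)) :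
    dirDeriv v (pairComp g h φ) = pairComp g h (dirDeriv (pairAct g h v) φ) :=
  lineDerivOp_compCLMOfContinuousLinearEquiv ℂ v (pairAct g h) φ

theorem traceLaplacian_pairComp (g h : (Matrix (Fin n) (Fin n) ℝ)ˣ) (φ : 𝓢(MatPair n, ℂ)) :
    traceLaplacian n (pairComp g h φ) = pairComp g h (traceLaplacian n φ) := by
  ext p
  rw [pairComp_apply, traceLaplacian_apply φ]
  let B : MatPair n →ₗ[ℝ] MatPair n →ₗ[ℝ] ℂ := LinearMap.mk₂ ℝ
    (fun v w => fderiv ℝ (fderiv ℝ φ) (pairAct g h p) v w) (fun _ _ _ => by simp)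
    (fun _ _ _ => by simp) (fun _ _ _ => by simp) (fun _ _ _ => by simp)
  refine Eq.trans ?_ (sum_bilin_pairAct B g h)
  rw [traceLaplacian, _root_.sum_apply, _root_.sum_apply]
  refine Finset.sum_congr rfl fun s _ => ?_
  change dirDeriv (fstVec s) (dirDeriv (sndVec s) (pairComp g h φ)) p = _
  rw [dirDeriv_pairComp, dirDeriv_pairComp, pairComp_apply, dirDeriv_dirDeriv_apply]
  rfl

theorem tsupport_traceMul_subset (φ : 𝓢(MatPair n, ℂ)) : tsupport (traceMul n φ) ⊆ tsupport φ := by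
  have h : (traceMul n φ : MatPair n → ℂ) =
    (fun p : MatPair n => (((p.1 * p.2).trace : ℝ) : ℂ)) * φ := funext (traceMul_apply φ)
  rw [h]
  exact tsupport_mul_subset_right

theorem tsupport_traceLaplacian_subset (φ : 𝓢(MatPair n, ℂ)) :
    tsupport (traceLaplacian n φ) ⊆ tsupport φ := by
  refine closure_minimal (fun p hp => ?_) (isClosed_tsupport _)
  by_contra hn
  refine hp ?_
  have h1 : p ∉ tsupport (fderiv ℝ φ) := fun h => hn (tsupport_fderiv_subset ℝ h)
  rw [traceLaplacian_apply, fderiv_of_notMem_tsupport (𝕜 := ℝ) h1]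
  simp

/-- Tempered distributions supported in the nilpotent cone. -/
def IsConeSupported (T : 𝓢(MatPair n, ℂ) →L[ℂ] ℂ) : Prop :=
  ∀ φ : 𝓢(MatPair n, ℂ), HasCompactSupport φ → Disjoint (tsupport φ) (nilpotentCone n) → T φ = 0

theorem IsConeSupported.comp {T : 𝓢(MatPair n, ℂ) →L[ℂ] ℂ} (hT : IsConeSupported T)
    {A : 𝓢(MatPair n, ℂ) →L[ℂ] 𝓢(MatPair n, ℂ)} (hA : ∀ φ, tsupport (A φ) ⊆ tsupport φ) :
    IsConeSupported (T.comp A) := fun φ hφ hd =>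
  hT _ (hφ.of_isClosed_subset (isClosed_tsupport _) (hA φ)) (hd.mono_left (hA φ))

theorem IsConeSupported.vanishesOn {T : 𝓢(MatPair n, ℂ) →L[ℂ] ℂ} (hT : IsConeSupported T)
    {S : (MatPair n → ℂ) →ₗ[ℂ] ℂ} (hS : ∀ φ : 𝓢(MatPair n, ℂ), S φ = T φ) :
    VanishesOn S (nilpotentCone n)ᶜ := fun f hf => by
  have h := hS (hf.compact.toSchwartzMap hf.smooth)
  rw [coe_toSchwartzMap] at h
  rw [h]
  refine hT _ hf.compact ?_
  exact Set.disjoint_left.2 fun x hx => hf.supp hx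

theorem IsConeSupported.exists_comp_traceMul_pow_eq_zero {T : 𝓢(MatPair n, ℂ) →L[ℂ] ℂ}
    (hT : IsConeSupported T) : ∃ K : ℕ, T.comp (traceMul n ^ K) = 0 := by
  obtain ⟨S, hS⟩ := exists_linear_extension T
  obtain ⟨L, hL⟩ := exists_hasOrderLE T S hS
  refine ⟨L + 1, eq_zero_of_forall_hasCompactSupport _ fun φ hφ => ?_⟩
  have h1 : ∀ k : ℕ, ((traceMul n ^ k) φ : MatPair n → ℂ) =
      fun p => (((p.1 * p.2).trace : ℝ) : ℂ) ^ k * φ p := fun k => by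
    induction k with
    | zero => funext p; simp
    | succ k ih =>
      funext p
      rw [pow_succ', pow_succ']
      change traceMul n ((traceMul n ^ k) φ) p = _
      rw [traceMul_apply, ih, mul_assoc]
  rw [ContinuousLinearMap.comp_apply, ← hS, h1]
  exact hL.pow_mul_eq_zero (U := Set.univ) (hT.vanishesOn hS) contDiff_trace_mul
    (fun p hp => trace_eq_zero_of_mem_nilpotentCone hp.1) ⟨φ.smooth _, hφ, Set.subset_univ _⟩

/-- Tempered distributions supported in the nilpotent cone which transform by `η ∘ det`. -/
structure IsConeEquivariant (η : ℝˣ →* ℂˣ) (T : 𝓢(MatPair n, ℂ) →L[ℂ] ℂ) : Prop where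
  map_pairComp : ∀ g h φ, T (pairComp g h φ) = ((η (Units.map Matrix.detMonoidHom g) : ℂ))⁻¹ *
    (η (Units.map Matrix.detMonoidHom h) : ℂ) * T φ
  supported : IsConeSupported T

theorem IsConeEquivariant.comp_pow {η : ℝˣ →* ℂˣ} {T : 𝓢(MatPair n, ℂ) →L[ℂ] ℂ}
    (hT : IsConeEquivariant η T) {A : 𝓢(MatPair n, ℂ) →L[ℂ] 𝓢(MatPair n, ℂ)}
    (hA : ∀ φ, tsupport (A φ) ⊆ tsupport φ)
    (hAc : ∀ g h φ, A (pairComp g h φ) = pairComp g h (A φ)) (k : ℕ) :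
    IsConeEquivariant η (T.comp (A ^ k)) := by
  induction k with
  | zero => exact hT
  | succ k ih =>
    have e : T.comp (A ^ (k + 1)) = (T.comp (A ^ k)).comp A := by
      rw [pow_succ]; rfl
    rw [e]
    refine ⟨fun g h φ => ?_, ih.supported.comp hA⟩
    rw [ContinuousLinearMap.comp_apply, hAc, ih.map_pairComp]
    rfl

theorem IsConeEquivariant.eq_zero_of_euler (hn : 0 < n) {η : ℝˣ →* ℂˣ} (hη : IsGoodChar n η)
    {T : 𝓢(MatPair n, ℂ) →L[ℂ] ℂ} (hT : IsConeEquivariant η T) {b : ℕ}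
    (hE : ∀ φ, T (eulerOp n φ) = (-((n : ℂ) ^ 2) - b) * T φ) : T = 0 := by
  obtain ⟨S, hS⟩ := exists_linear_extension T
  obtain ⟨L, hL⟩ := exists_hasOrderLE T S hS
  have hS' : IsEquivariant η S := fun g h f hf => by
    have h1 := hT.map_pairComp g h (hf.compact.toSchwartzMap hf.smooth)
    rw [← hS, ← hS] at h1
    exact h1
  have hvan : VanishesOn S Set.univ := hS'.eq_zero_of_euler hn hη hL (hT.supported.vanishesOn hS)
    fun f hf => by
      have h1 := hE (hf.compact.toSchwartzMap hf.smooth)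
      rw [← hS, ← hS] at h1
      rw [coe_toSchwartzMap] at h1
      rw [← h1]
      congr 1
      exact (funext (eulerOp_apply (hf.compact.toSchwartzMap hf.smooth))).symm
  refine eq_zero_of_forall_hasCompactSupport T fun φ hφ => ?_
  rw [← hS]
  exact hvan φ ⟨φ.smooth _, hφ, Set.subset_univ _⟩

theorem exists_comp_pow_ne_zero {T : 𝓢(MatPair n, ℂ) →L[ℂ] ℂ} (hT : T ≠ 0)
    {A : 𝓢(MatPair n, ℂ) →L[ℂ] 𝓢(MatPair n, ℂ)} (hA : ∃ K : ℕ, T.comp (A ^ K) = 0) :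
    ∃ a : ℕ, T.comp (A ^ a) ≠ 0 ∧ T.comp (A ^ (a + 1)) = 0 := by
  classical
  have h0 : Nat.find hA ≠ 0 := fun h => hT (by
    have := Nat.find_spec hA
    rwa [h] at this)
  obtain ⟨a, ha⟩ := Nat.exists_eq_succ_of_ne_zero h0
  exact ⟨a, Nat.find_min hA (by omega), by
    have := Nat.find_spec hA
    rwa [ha] at this⟩

theorem natCast_clm_apply {V : Type*} [AddCommGroup V] [TopologicalSpace V]
    [IsTopologicalAddGroup V] [Module ℂ V] [ContinuousConstSMul ℂ V] (m : ℕ) (v : V) :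
    (m : V →L[ℂ] V) v = (m : ℂ) • v := by
  induction m with
  | zero => simp
  | succ m ih => rw [Nat.cast_succ, _root_.add_apply, ih, Nat.cast_succ, add_smul, one_smul]; rfl

theorem IsConeEquivariant.eq_zero (hn : 0 < n) {η : ℝˣ →* ℂˣ} (hη : IsGoodChar n η)
    {T : 𝓢(MatPair n, ℂ) →L[ℂ] ℂ} (hT : IsConeEquivariant η T)
    (hΔ : ∃ K : ℕ, T.comp (traceLaplacian n ^ K) = 0) : T = 0 := by
  by_contra hne
  obtain ⟨a, ha, ha'⟩ := exists_comp_pow_ne_zero hne hΔ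
  have hT₁ := hT.comp_pow tsupport_traceLaplacian_subset traceLaplacian_pairComp a
  obtain ⟨b, hb, hb'⟩ :=
    exists_comp_pow_ne_zero ha hT₁.supported.exists_comp_traceMul_pow_eq_zero
  refine hb ((hT₁.comp_pow tsupport_traceMul_subset traceMul_pairComp b).eq_zero_of_euler hn hη
    (b := b) fun φ => ?_)
  set T₁ := T.comp (traceLaplacian n ^ a)
  have hΔ₁ : ∀ φ, T₁ (traceLaplacian n φ) = 0 := fun φ => by
    have := DFunLike.congr_fun ha' φ
    rw [pow_succ] at this
    exact this
  have hQ₁ : ∀ φ, T₁ ((traceMul n ^ (b + 1)) φ) = 0 := fun φ => DFunLike.congr_fun hb' φ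
  have key := sl2_pow_mul (X := traceMul n) (Y := -traceLaplacian n)
    (H := eulerOp n + ((n ^ 2 : ℕ) : 𝓢(MatPair n, ℂ) →L[ℂ] 𝓢(MatPair n, ℂ)))
    (by rw [mul_neg, neg_mul, traceLaplacian_mul_traceMul]; abel)
    (by rw [add_mul, mul_add, eulerOp_mul_traceMul, (Nat.cast_commute _ _).eq]; abel) b
  have h1 := congrArg T₁ (DFunLike.congr_fun key φ)
  have e1 : (traceMul n ^ (b + 1) * -traceLaplacian n) φ =
      (traceMul n ^ (b + 1)) (-(traceLaplacian n φ)) := rfl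
  have e2 : ((-traceLaplacian n * traceMul n ^ (b + 1) +
      ((b : 𝓢(MatPair n, ℂ) →L[ℂ] 𝓢(MatPair n, ℂ)) + 1) * traceMul n ^ b *
        (eulerOp n + ((n ^ 2 : ℕ) : 𝓢(MatPair n, ℂ) →L[ℂ] 𝓢(MatPair n, ℂ)) + b)) φ) =
      -(traceLaplacian n ((traceMul n ^ (b + 1)) φ)) +
        ((b : ℂ) + 1) • (traceMul n ^ b) (eulerOp n φ + ((n ^ 2 : ℕ) : ℂ) • φ + (b : ℂ) • φ) := by
    rw [← natCast_clm_apply (n ^ 2), ← natCast_clm_apply b φ, add_smul, one_smul,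
      ← natCast_clm_apply]
    rfl
  rw [e1, hQ₁, e2, map_add, map_neg, hΔ₁, map_smul, neg_zero, zero_add, map_add, map_add, map_add,
    map_add, map_smul, map_smul, map_smul, map_smul] at h1
  have h2 := (smul_eq_zero.1 h1.symm).resolve_left (Nat.cast_add_one_ne_zero b)
  rw [smul_eq_mul, smul_eq_mul] at h2
  rw [Nat.cast_pow] at h2
  change T₁ ((traceMul n ^ b) (eulerOp n φ)) = _ * T₁ ((traceMul n ^ b) φ)
  linear_combination h2

end

section

variable {V W : Type*} [NormedAddCommGroup V] [NormedSpace ℝ V] [NormedAddCommGroup W]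
  [InnerProductSpace ℝ W] [FiniteDimensional ℝ W] [MeasurableSpace W] [BorelSpace W]

/-- The inverse Fourier transform for the pairing `⟪ι q, ι (σ p)⟫`, up to normalization. -/
noncomputable def fourierAlong (ι : V ≃L[ℝ] W) (σ : V ≃L[ℝ] V) : 𝓢(V, ℂ) →L[ℂ] 𝓢(V, ℂ) :=
  (compCLMOfContinuousLinearEquiv ℂ (σ.trans ι)).comp
    ((FourierTransform.fourierInvCLM ℂ 𝓢(W, ℂ)).comp (compCLMOfContinuousLinearEquiv ℂ ι.symm))

theorem fourierAlong_surjective (ι : V ≃L[ℝ] W) (σ : V ≃L[ℝ] V) :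
    Function.Surjective (fourierAlong ι σ) := fun φ => by
  refine ⟨compCLMOfContinuousLinearEquiv ℂ ι (FourierTransform.fourier
    (compCLMOfContinuousLinearEquiv ℂ (σ.trans ι).symm φ)), ?_⟩
  have h1 : ∀ ψ : 𝓢(W, ℂ), compCLMOfContinuousLinearEquiv ℂ ι.symm
      (compCLMOfContinuousLinearEquiv ℂ ι ψ) = ψ := fun ψ => by ext; simp
  have h2 : compCLMOfContinuousLinearEquiv ℂ (σ.trans ι)
      (compCLMOfContinuousLinearEquiv ℂ (σ.trans ι).symm φ) = φ := by ext; simp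
  rw [fourierAlong, ContinuousLinearMap.comp_apply, ContinuousLinearMap.comp_apply, h1,
    FourierTransform.fourierInvCLM_apply, FourierTransform.fourierInv_fourier_eq, h2]

theorem exists_fourierAlong_apply [FiniteDimensional ℝ V] [MeasurableSpace V] [BorelSpace V]
    (μ : Measure V) [μ.IsAddHaarMeasure] (ι : V ≃L[ℝ] W) (σ : V ≃L[ℝ] V) :
    ∃ c : ℂ, c ≠ 0 ∧ ∀ φ p, fourierAlong ι σ φ p =
      c * ∫ q, φ q * Complex.exp (2 * Real.pi * Complex.I * (inner ℝ (ι q) (ι (σ p)) : ℝ)) ∂μ := by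
  obtain ⟨c, hc0, hc⟩ : ∃ c : NNReal, c ≠ 0 ∧ (volume : Measure W) = c • μ.map ι :=
    ⟨_, (Measure.addHaarScalarFactor_pos_of_isAddHaarMeasure _ _).ne',
      Measure.isAddLeftInvariant_eq_smul _ _⟩
  have hι : MeasurableEmbedding ι := ι.toHomeomorph.measurableEmbedding
  refine ⟨((c : ℝ) : ℂ), by exact_mod_cast hc0, fun φ p => ?_⟩
  change FourierTransformInv.fourierInv (compCLMOfContinuousLinearEquiv ℂ ι.symm φ) (ι (σ p)) = _
  rw [fourierInv_coe, Real.fourierInv_eq', hc, integral_smul_nnreal_measure,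
    hι.integral_map, NNReal.smul_def, Complex.real_smul]
  congr 1
  refine integral_congr_ae (.of_forall fun q => ?_)
  simp only [compCLMOfContinuousLinearEquiv_apply, smul_eq_mul, Function.comp_apply,
    ContinuousLinearEquiv.symm_apply_apply]
  rw [mul_comm]
  congr 2
  push_cast
  ring

theorem dirDeriv_fourierAlong (ι : V ≃L[ℝ] W) (σ : V ≃L[ℝ] V) (v : V) {ℓ : V →L[ℝ] ℝ}
    (hℓ : ∀ q, ℓ q = inner ℝ (ι q) (ι (σ v))) (φ : 𝓢(V, ℂ)) :
    dirDeriv v (fourierAlong ι σ φ) =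
      fourierAlong ι σ ((2 * Real.pi * Complex.I) • linMul ℓ φ) := by
  change LineDeriv.lineDerivOp v (compCLMOfContinuousLinearEquiv ℂ (σ.trans ι)
    (FourierTransformInv.fourierInv (compCLMOfContinuousLinearEquiv ℂ ι.symm φ))) = _
  rw [lineDerivOp_compCLMOfContinuousLinearEquiv, SchwartzMap.lineDerivOp_fourierInv_eq]
  refine congrArg (fun ψ => compCLMOfContinuousLinearEquiv ℂ (σ.trans ι)
    (FourierTransformInv.fourierInv ψ)) ?_
  ext w
  have hg : (fun x : W => inner ℝ x ((σ.trans ι) v)).HasTemperateGrowth := by fun_prop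
  rw [map_smul, _root_.smul_apply, _root_.smul_apply, smulLeftCLM_apply_apply hg,
    compCLMOfContinuousLinearEquiv_apply, Complex.real_smul]
  change _ = _ • linMul ℓ φ (ι.symm w)
  rw [linMul_apply, hℓ, ContinuousLinearEquiv.apply_symm_apply]
  rfl

end

section
attribute [local instance] matrixNormTopology

variable {n : ℕ}

variable (n) in
/-- Euclidean coordinates on pairs of matrices. -/
noncomputable def pairCoords :
    MatPair n ≃L[ℝ] EuclideanSpace ℝ ((Fin n × Fin n) ⊕ (Fin n × Fin n)) :=
  LinearEquiv.toContinuousLinearEquiv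
    { toFun := fun p => WithLp.toLp 2 (Sum.elim (fstCoord · p) (sndCoord · p))
      map_add' := fun p q => by ext (s | s) <;> simp
      map_smul' := fun c p => by ext (s | s) <;> simp
      invFun := fun w =>
        (Matrix.of fun i j => w (.inl (i, j)), Matrix.of fun i j => w (.inr (j, i)))
      left_inv := fun _ => rfl
      right_inv := fun w => by ext (s | s) <;> rfl }

variable (n) in
/-- The swap `(x, y) ↦ (yᵀ, xᵀ)`. -/
noncomputable def transposeSwap : MatPair n ≃L[ℝ] MatPair n :=
  LinearEquiv.toContinuousLinearEquiv
    { toFun := fun p => (p.2ᵀ, p.1ᵀ)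
      map_add' := fun _ _ => rfl
      map_smul' := fun _ _ => rfl
      invFun := fun p => (p.2ᵀ, p.1ᵀ)
      left_inv := fun _ => rfl
      right_inv := fun _ => rfl }

theorem inner_pairCoords (p q : MatPair n) :
    inner ℝ (pairCoords n q) (pairCoords n (transposeSwap n p)) =
      (p.1 * q.2).trace + (p.2 * q.1).trace := by
  rw [PiLp.inner_apply, Fintype.sum_sum_type, Matrix.trace_mul_comm p.2, add_comm]
  simp only [Fintype.sum_prod_type]
  refine congrArg₂ (· + ·) (Finset.sum_congr rfl fun i _ => Finset.sum_congr rfl fun j _ => ?_)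
    (Finset.sum_congr rfl fun i _ => Finset.sum_congr rfl fun j _ => ?_)
  · rfl
  · exact mul_comm _ _

variable (n) in
/-- The Fourier transform on pairs of matrices, up to normalization. -/
noncomputable def pairFourier : 𝓢(MatPair n, ℂ) →L[ℂ] 𝓢(MatPair n, ℂ) :=
  fourierAlong (pairCoords n) (transposeSwap n)

theorem isAddHaarMeasure_volume_pi_pi :
    (volume : Measure (Fin n → Fin n → ℝ)).IsAddHaarMeasure :=
  haveI : (volume : Measure (Fin n → ℝ)).IsAddHaarMeasure := inferInstance
  Measure.pi.isAddHaarMeasure _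

theorem exists_pairFourier_apply :
    ∃ c : ℂ, c ≠ 0 ∧ ∀ (φ : 𝓢(MatPair n, ℂ)) p, pairFourier n φ p =
      c * ∫ q : MatPair n, φ q * Complex.exp (2 * Real.pi * Complex.I *
        (((p.1 * q.2).trace + (p.2 * q.1).trace : ℝ) : ℂ)) := by
  have := isAddHaarMeasure_volume_pi_pi (n := n)
  have : (volume : Measure ((Fin n → Fin n → ℝ) × (Fin n → Fin n → ℝ))).IsAddHaarMeasure :=
    Measure.prod.instIsAddHaarMeasure volume volume
  obtain ⟨c, hc, h⟩ := (exists_fourierAlong_apply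
    (volume : Measure ((Fin n → Fin n → ℝ) × (Fin n → Fin n → ℝ))) :
    ∀ (ι : _ ≃L[ℝ] EuclideanSpace ℝ ((Fin n × Fin n) ⊕ (Fin n × Fin n))) σ, _)
    (pairCoords n) (transposeSwap n)
  refine ⟨c, hc, fun φ p => (h φ p).trans ?_⟩
  simp only [← inner_pairCoords]
  rfl

theorem dirDeriv_fstVec_pairFourier (s : Fin n × Fin n) (φ : 𝓢(MatPair n, ℂ)) :
    dirDeriv (fstVec s) (pairFourier n φ) =
      pairFourier n ((2 * Real.pi * Complex.I) • linMul (sndCoord s) φ) :=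
  dirDeriv_fourierAlong _ _ _ (fun q => by
    rw [inner_pairCoords, fstVec, zero_mul, Matrix.trace_zero, add_zero, sndCoord_apply,
      Matrix.trace_single_mul, one_smul]) φ

theorem dirDeriv_sndVec_pairFourier (s : Fin n × Fin n) (φ : 𝓢(MatPair n, ℂ)) :
    dirDeriv (sndVec s) (pairFourier n φ) =
      pairFourier n ((2 * Real.pi * Complex.I) • linMul (fstCoord s) φ) :=
  dirDeriv_fourierAlong _ _ _ (fun q => by
    rw [inner_pairCoords, sndVec, zero_mul, Matrix.trace_zero, zero_add, fstCoord_apply,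
      Matrix.trace_single_mul, one_smul]) φ

theorem traceLaplacian_pairFourier (φ : 𝓢(MatPair n, ℂ)) :
    traceLaplacian n (pairFourier n φ) =
      ((2 * Real.pi * Complex.I) ^ 2 : ℂ) • pairFourier n (traceMul n φ) := by
  rw [traceLaplacian, traceMul, _root_.sum_apply, _root_.sum_apply, map_sum, Finset.smul_sum]
  refine Finset.sum_congr rfl fun s _ => ?_
  change dirDeriv (fstVec s) (dirDeriv (sndVec s) (pairFourier n φ)) = _
  rw [dirDeriv_sndVec_pairFourier, dirDeriv_fstVec_pairFourier, map_smul, map_smul, map_smul,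
    smul_smul, ← sq, linMul_mul_comm]
  rfl

theorem traceLaplacian_pow_pairFourier (φ : 𝓢(MatPair n, ℂ)) (k : ℕ) :
    (traceLaplacian n ^ k) (pairFourier n φ) =
      (((2 * Real.pi * Complex.I) ^ 2) ^ k : ℂ) • pairFourier n ((traceMul n ^ k) φ) := by
  induction k with
  | zero => rw [pow_zero, pow_zero, pow_zero, one_smul]; rfl
  | succ k ih =>
    rw [pow_succ' (traceLaplacian n), pow_succ' (traceMul n)]
    change traceLaplacian n ((traceLaplacian n ^ k) _) =
      _ • pairFourier n (traceMul n ((traceMul n ^ k) φ))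
    rw [ih, map_smul, traceLaplacian_pairFourier, smul_smul, ← pow_succ]

theorem exists_comp_traceLaplacian_pow_eq_zero {T : 𝓢(MatPair n, ℂ) →L[ℂ] ℂ}
    (hT : IsConeSupported (T.comp (pairFourier n))) :
    ∃ K : ℕ, T.comp (traceLaplacian n ^ K) = 0 := by
  obtain ⟨K, hK⟩ := hT.exists_comp_traceMul_pow_eq_zero
  refine ⟨K, ContinuousLinearMap.ext fun ψ => ?_⟩
  obtain ⟨φ, rfl⟩ := fourierAlong_surjective (pairCoords n) (transposeSwap n) ψ
  change T ((traceLaplacian n ^ K) (pairFourier n φ)) = 0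
  rw [traceLaplacian_pow_pairFourier, map_smul]
  have h : T (pairFourier n ((traceMul n ^ K) φ)) = 0 := DFunLike.congr_fun hK φ
  rw [h, smul_zero]

end

end

theorem equivariant_tempered_distribution_supported_in_nilpotent_cone_vanishes
    (n : ℕ) (hn : 0 < n) (η : ℝˣ →* ℂˣ)
    (hη : Continuous fun t : ℝˣ => (η t : ℂ))
    (hgood : IsGoodChar n η)
    (T : 𝓢(Matrix (Fin n) (Fin n) ℝ × Matrix (Fin n) (Fin n) ℝ, ℂ) →L[ℂ] ℂ)
    (hequiv : ∀ (g h : (Matrix (Fin n) (Fin n) ℝ)ˣ)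
      (φ ψ : 𝓢(Matrix (Fin n) (Fin n) ℝ × Matrix (Fin n) (Fin n) ℝ, ℂ)),
      (∀ p : Matrix (Fin n) (Fin n) ℝ × Matrix (Fin n) (Fin n) ℝ,
        ψ p = φ ((g : Matrix (Fin n) (Fin n) ℝ) * p.1 * (↑h⁻¹ : Matrix (Fin n) (Fin n) ℝ),
          (h : Matrix (Fin n) (Fin n) ℝ) * p.2 * (↑g⁻¹ : Matrix (Fin n) (Fin n) ℝ))) →
      T ψ = ((η (Units.map Matrix.detMonoidHom g) : ℂ))⁻¹ *
        (η (Units.map Matrix.detMonoidHom h) : ℂ) * T φ)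
    (hsupp : ∀ φ : 𝓢(Matrix (Fin n) (Fin n) ℝ × Matrix (Fin n) (Fin n) ℝ, ℂ),
      HasCompactSupport ⇑φ → Disjoint (tsupport ⇑φ) (nilpotentCone n) → T φ = 0)
    (hsuppF : ∀ φ : 𝓢(Matrix (Fin n) (Fin n) ℝ × Matrix (Fin n) (Fin n) ℝ, ℂ),
      HasCompactSupport ⇑φ → Disjoint (tsupport ⇑φ) (nilpotentCone n) →
      ∀ ψ : 𝓢(Matrix (Fin n) (Fin n) ℝ × Matrix (Fin n) (Fin n) ℝ, ℂ),
      (∀ p : Matrix (Fin n) (Fin n) ℝ × Matrix (Fin n) (Fin n) ℝ,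
        ψ p = ∫ q : Matrix (Fin n) (Fin n) ℝ × Matrix (Fin n) (Fin n) ℝ,
          φ q * Complex.exp (2 * Real.pi * Complex.I *
            ((Matrix.trace (p.1 * q.2) + Matrix.trace (p.2 * q.1) : ℝ) : ℂ))) →
      T ψ = 0) :
    T = 0 := by
  have hT : IsConeEquivariant η T := ⟨fun g h φ => hequiv g h φ _ fun p => rfl, hsupp⟩
  refine hT.eq_zero hn hgood (exists_comp_traceLaplacian_pow_eq_zero fun φ hφ hd => ?_)
  obtain ⟨c, hc, h⟩ := exists_pairFourier_apply (n := n)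
  have h1 := hsuppF φ hφ hd (c⁻¹ • pairFourier n φ) fun p => by
    rw [_root_.smul_apply, h, smul_eq_mul, inv_mul_cancel_left₀ hc]
  rw [map_smul, smul_eq_zero] at h1
  exact h1.resolve_left (inv_ne_zero hc)
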